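/- The map sending a field automorphism φ of F with φ(k) = k to the map g ↦ φ ∘ g ∘ φ⁻¹ is a group isomorphism from the group {φ ∈ Aut(F) : φ(k) = k} of field automorphisms of F preserving k onto the group of continuous automorphisms of G (abstract group automorphisms of G which are homeomorphisms with respect to the given topology). -/

import Mathlib

/-- The topology of pointwise convergence on `Aut(F/k)`, where `F` carries the
discrete topology: a base of open neighbourhoods of the identity is given by
the pointwise stabilizers of finite subsets of `F`. -/
def autTop (k F : Type*) [Field k] [Field F] [Algebra k F] :
    TopologicalSpace (F ≃ₐ[k] F) :=
  TopologicalSpace.induced (fun g (x : F) => g x)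
    (@Pi.topologicalSpace F (fun _ => F) (fun _ => ⊥))

/-- The group of field automorphisms of `F` preserving the subfield `k`
(i.e. mapping the image of `k` in `F` onto itself). -/
def presField (k F : Type*) [Field k] [Field F] [Algebra k F] : Subgroup (F ≃+* F) where
  carrier := {φ | ∀ x : F,
    x ∈ Set.range (algebraMap k F) ↔ φ x ∈ Set.range (algebraMap k F)}
  one_mem' := fun _ => Iff.rfl
  mul_mem' := fun {a b} ha hb x => (hb x).trans (ha (b x))
  inv_mem' := fun {a} ha x => by
    have h := (ha (a⁻¹ x)).symm
    have hx : a (a⁻¹ x) = x := a.apply_symm_apply x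
    rwa [hx] at h

/-- The group of continuous automorphisms of `G = Aut(F/k)`: abstract group
automorphisms which are homeomorphisms for the topology of pointwise convergence. -/
def contAut (k F : Type*) [Field k] [Field F] [Algebra k F] :
    Subgroup (MulAut (F ≃ₐ[k] F)) where
  carrier := {ψ | @Continuous _ _ (autTop k F) (autTop k F) (⇑ψ) ∧
    @Continuous _ _ (autTop k F) (autTop k F) (⇑ψ.symm)}
  one_mem' := ⟨@continuous_id _ (autTop k F), @continuous_id _ (autTop k F)⟩
  mul_mem' := fun {a b} ha hb => by
    constructor
    · show @Continuous _ _ (autTop k F) (autTop k F) (⇑a ∘ ⇑b)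
      exact @Continuous.comp _ _ _ (autTop k F) (autTop k F) (autTop k F) _ _ ha.1 hb.1
    · show @Continuous _ _ (autTop k F) (autTop k F) (⇑b.symm ∘ ⇑a.symm)
      exact @Continuous.comp _ _ _ (autTop k F) (autTop k F) (autTop k F) _ _ hb.2 ha.2
  inv_mem' := fun {a} ha => ⟨ha.2, ha.1⟩

section Extension

/-- Two transcendence bases of algebraically closed fields indexed by the same type are matched
by an isomorphism. -/
theorem exists_algEquiv_of_isTranscendenceBasis {R K L ι : Type*} [Field R] [Field K] [Field L]
    [Algebra R K] [Algebra R L] [IsAlgClosed K] [IsAlgClosed L] {v : ι → K} {w : ι → L}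
    (hv : IsTranscendenceBasis R v) (hw : IsTranscendenceBasis R w) :
    ∃ e : K ≃ₐ[R] L, ∀ i, e (v i) = w i := by
  let := IsAlgClosed.isAlgClosure_of_transcendence_basis v hv
  let := IsAlgClosed.isAlgClosure_of_transcendence_basis w hw
  let f : Algebra.adjoin R (Set.range v) ≃ₐ[R] Algebra.adjoin R (Set.range w) :=
    hv.1.aevalEquiv.symm.trans hw.1.aevalEquiv
  let e := IsAlgClosure.equivOfEquiv K L f.toRingEquiv
  have he : ∀ s : Algebra.adjoin R (Set.range v), e (s : K) = (f s : L) :=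
    IsAlgClosure.equivOfEquiv_algebraMap K L f.toRingEquiv
  refine ⟨AlgEquiv.ofRingEquiv (f := e) fun r => ?_, fun i => ?_⟩
  · have := he (algebraMap R _ r)
    rw [AlgEquiv.commutes] at this
    exact this
  · have h1 : hv.1.aevalEquiv (MvPolynomial.X i) =
        (⟨v i, Algebra.subset_adjoin ⟨i, rfl⟩⟩ : Algebra.adjoin R (Set.range v)) :=
      Subtype.ext (by simp)
    have h2 := he ⟨v i, Algebra.subset_adjoin ⟨i, rfl⟩⟩
    rw [← h1] at h2
    simpa [f] using h2

/-- Two embeddings of an algebraic extension into an algebraically closed field are conjugate. -/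
theorem exists_algEquiv_comp_eq {A L F : Type*} [Field A] [Field L] [Field F] [Algebra A L]
    [Algebra A F] [IsAlgClosed F] [Algebra.IsAlgebraic A L] (σ τ : L →ₐ[A] F) :
    ∃ e : F ≃ₐ[A] F, ∀ z, e (σ z) = τ z := by
  obtain ⟨s, hs⟩ := exists_isTranscendenceBasis A F
  have key : ∀ ρ : L →ₐ[A] F,
      @IsTranscendenceBasis s L F _ _ ρ.toRingHom.toAlgebra ((↑) : s → F) := by
    intro ρ
    let := ρ.toRingHom.toAlgebra
    have : IsScalarTower A L F := IsScalarTower.of_algebraMap_eq fun a => (ρ.commutes a).symm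
    have h1 : AlgebraicIndependent L ((↑) : s → F) := hs.1.extendScalars L
    refine h1.isTranscendenceBasis_iff_isAlgebraic.2 ?_
    have h2 := hs.isAlgebraic
    rw [Algebra.isAlgebraic_def] at h2 ⊢
    intro x
    have hle : Algebra.adjoin A (Set.range ((↑) : s → F)) ≤
        (Algebra.adjoin L (Set.range ((↑) : s → F))).restrictScalars A :=
      Algebra.adjoin_le Algebra.subset_adjoin
    exact IsAlgebraic.tower_top_of_subalgebra_le hle (h2 x)
  obtain ⟨e, he⟩ := @exists_algEquiv_of_isTranscendenceBasis L F F s _ _ _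
    σ.toRingHom.toAlgebra τ.toRingHom.toAlgebra _ _ _ _ (key σ) (key τ)
  let e' : F ≃+* F := @AlgEquiv.toRingEquiv L F F _ _ _ σ.toRingHom.toAlgebra
    τ.toRingHom.toAlgebra e
  have hz : ∀ z, e' (σ z) = τ z := fun z =>
    @AlgEquiv.commutes L F F _ _ _ σ.toRingHom.toAlgebra τ.toRingHom.toAlgebra e z
  refine ⟨AlgEquiv.ofRingEquiv (f := e') fun a => ?_, hz⟩
  exact (congrArg e' (σ.commutes a).symm).trans ((hz _).trans (τ.commutes a))

/-- Transcendental elements over `A` are conjugate under `Aut(F/A)`. -/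
theorem exists_algEquiv_of_transcendental {A F : Type*} [Field A] [Field F] [Algebra A F]
    [IsAlgClosed F] {a b : F} (ha : Transcendental A a) (hb : Transcendental A b) :
    ∃ e : F ≃ₐ[A] F, e a = b := by
  have key : ∀ c : F, Transcendental A c → ∃ s : Set F, c ∉ s ∧
      IsTranscendenceBasis A (Subtype.val : ↥(insert c s : Set F) → F) := by
    intro c hc
    have h1 : AlgebraicIndepOn A id ({c} : Set F) := by
      have := (algebraicIndependent_unique_type_iff (R := A) (ι := ({c} : Set F))
        (x := fun i => (i : F))).2 (by
          have : ((default : ({c} : Set F)) : F) = c := (default : ({c} : Set F)).2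
          simpa [this] using hc)
      exact this
    obtain ⟨t, hct, ht⟩ := exists_isTranscendenceBasis_superset h1
    refine ⟨t \ {c}, by simp, ?_⟩
    have : insert c (t \ {c}) = t := by
      rw [Set.insert_sdiff_singleton, Set.insert_eq_of_mem (hct rfl)]
    rw [this]
    exact ht
  obtain ⟨s, hs, hs'⟩ := key a ha
  obtain ⟨t, ht, ht'⟩ := key b hb
  have hc := hs'.cardinalMk_eq ht'
  rw [Cardinal.mk_insert hs, Cardinal.mk_insert ht] at hc
  have hc' : Cardinal.mk s = Cardinal.mk t := by simpa using hc
  obtain ⟨f⟩ := Cardinal.eq.1 hc'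
  classical
  let g : (insert a s : Set F) ≃ (insert b t : Set F) :=
    (Equiv.Set.insert hs).trans ((Equiv.sumCongr f (Equiv.refl _)).trans
      (Equiv.Set.insert ht).symm)
  have hw : IsTranscendenceBasis A (fun i => ((g i : (insert b t : Set F)) : F)) :=
    (isTranscendenceBasis_equiv g).2 ht'
  obtain ⟨e, he⟩ := exists_algEquiv_of_isTranscendenceBasis hs' hw
  refine ⟨e, ?_⟩
  have := he ⟨a, Set.mem_insert _ _⟩
  simpa [g] using this

end Extension

section Framework

variable {k F : Type*} [Field k] [Field F] [Algebra k F]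

variable (k) in
/-- The pointwise stabilizer of a set in `Aut(F/k)`. -/
def fixS (S : Set F) : Subgroup (F ≃ₐ[k] F) where
  carrier := {g | ∀ s ∈ S, g s = s}
  one_mem' := fun _ _ => rfl
  mul_mem' := fun {a b} ha hb s hs => by
    rw [AlgEquiv.mul_apply, hb s hs, ha s hs]
  inv_mem' := fun {a} ha s hs => by
    have h := ha s hs
    calc a⁻¹ s = a⁻¹ (a s) := by rw [h]
      _ = s := a.symm_apply_apply s

theorem mem_fixS {S : Set F} {g : F ≃ₐ[k] F} : g ∈ fixS k S ↔ ∀ s ∈ S, g s = s := Iff.rfl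

theorem fixS_anti {S T : Set F} (h : S ⊆ T) : fixS k T ≤ fixS k S := fun _ hg s hs => hg s (h hs)

theorem fixS_adjoin (S : Set F) : fixS k (IntermediateField.adjoin k S : Set F) = fixS k S := by
  refine le_antisymm (fixS_anti (IntermediateField.subset_adjoin k S)) fun g hg => ?_
  have h : IntermediateField.adjoin k S ≤
      IntermediateField.fixedField (Subgroup.zpowers g) := by
    rw [IntermediateField.adjoin_le_iff]
    intro s hs ⟨m, hm⟩
    have : Subgroup.zpowers g ≤ fixS k S := by
      rw [Subgroup.zpowers_le]; exact hg
    exact this hm s hs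
  intro s hs
  exact h hs ⟨g, Subgroup.mem_zpowers g⟩

variable (k) in
/-- The relative algebraic closure of `k(S)` in `F`. -/
noncomputable def acl (S : Set F) : IntermediateField k F :=
  (algebraicClosure (IntermediateField.adjoin k S) F).restrictScalars k

theorem mem_acl {S : Set F} {a : F} :
    a ∈ acl k S ↔ IsAlgebraic (IntermediateField.adjoin k S) a :=
  mem_algebraicClosure_iff

theorem mem_acl' {S : Set F} {a : F} :
    a ∈ acl k S ↔ IsAlgebraic (Algebra.adjoin k S) a :=
  mem_acl.trans IntermediateField.isAlgebraic_adjoin_iff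

theorem coe_acl (S : Set F) :
    (acl k S : Set F) = (AlgebraicIndependent.matroid k F).closure S := by
  rw [AlgebraicIndependent.matroid_closure_eq]
  ext a
  exact mem_acl'

theorem subset_acl (S : Set F) : S ⊆ acl k S := by
  rw [coe_acl]
  exact Matroid.subset_closure _ S

theorem adjoin_le_acl (S : Set F) : IntermediateField.adjoin k S ≤ acl k S :=
  IntermediateField.adjoin_le_iff.2 (subset_acl S)

theorem acl_mono {S T : Set F} (h : S ⊆ T) : acl k S ≤ acl k T := by
  rw [← SetLike.coe_subset_coe, coe_acl, coe_acl]
  exact Matroid.closure_subset_closure _ h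

theorem acl_le_of_subset {S T : Set F} (h : S ⊆ acl k T) : acl k S ≤ acl k T := by
  rw [coe_acl] at h
  rw [← SetLike.coe_subset_coe, coe_acl, coe_acl]
  exact Matroid.closure_subset_closure_of_subset_closure h

@[simp] theorem acl_acl (S : Set F) : acl k (acl k S : Set F) = acl k S :=
  le_antisymm (acl_le_of_subset subset_rfl) (subset_acl _)

theorem acl_exchange {S : Set F} {a b : F} (h : b ∈ acl k (insert a S)) (hb : b ∉ acl k S) :
    a ∈ acl k (insert b S) := by
  have h' : b ∈ (AlgebraicIndependent.matroid k F).closure (insert a S) \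
      (AlgebraicIndependent.matroid k F).closure S := by
    rw [← coe_acl, ← coe_acl]; exact ⟨h, hb⟩
  have := (Matroid.closure_exchange h').1
  rwa [← coe_acl] at this

theorem acl_eq_of_mem {a b : F} (hb : b ∈ acl k {a}) (hbk : b ∉ acl k (∅ : Set F)) :
    acl k {b} = acl k {a} := by
  refine le_antisymm (acl_le_of_subset (by simpa using hb)) (acl_le_of_subset ?_)
  have := acl_exchange (S := ∅) (a := a) (b := b) (by simpa using hb) hbk
  simpa using this

theorem mem_acl_of_root {S : Set F} {a : F} {p : Polynomial F} (hp : p ≠ 0)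
    (hc : ∀ i, p.coeff i ∈ acl k S) (ha : p.IsRoot a) : a ∈ acl k S := by
  rw [← acl_acl]
  rw [mem_acl', ← IntermediateField.isAlgebraic_adjoin_iff, IntermediateField.adjoin_self]
  have hl : p ∈ Polynomial.lifts (algebraMap (acl k S) F) := by
    rw [Polynomial.lifts_iff_coeff_lifts]
    intro n
    exact ⟨⟨_, hc n⟩, rfl⟩
  obtain ⟨q, hq⟩ := (Polynomial.mem_lifts p).1 hl
  refine ⟨q, ?_, ?_⟩
  · rintro rfl
    simp at hq
    exact hp hq.symm
  · rw [Polynomial.aeval_def, ← Polynomial.eval_map, hq]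
    exact ha

theorem isAlgebraic_iff_mem_acl (L : IntermediateField k F) {a : F} :
    IsAlgebraic L a ↔ a ∈ acl k (L : Set F) := by
  rw [mem_acl', ← IntermediateField.isAlgebraic_adjoin_iff, IntermediateField.adjoin_self]

theorem isAlgebraic_iff_mem_acl_empty {a : F} : IsAlgebraic k a ↔ a ∈ acl k (∅ : Set F) := by
  rw [mem_acl', Algebra.adjoin_empty]
  constructor
  · intro h
    exact h.extendScalars (algebraMap k (⊥ : Subalgebra k F)).injective
  · intro h
    have hb : Function.Surjective (algebraMap k (⊥ : Subalgebra k F)) :=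
      fun x => (Algebra.mem_bot.1 x.2).imp fun y hy => Subtype.ext hy
    obtain ⟨p, hp, hpa⟩ := h
    obtain ⟨q, rfl⟩ := Polynomial.map_surjective _ hb p
    refine ⟨q, fun h => hp (by rw [h, Polynomial.map_zero]), ?_⟩
    rwa [Polynomial.aeval_map_algebraMap] at hpa

theorem mem_acl_empty [IsAlgClosed k] {a : F} :
    a ∈ acl k (∅ : Set F) ↔ a ∈ Set.range (algebraMap k F) := by
  constructor
  · intro h
    rw [← isAlgebraic_iff_mem_acl_empty] at h
    have hd := IsAlgClosed.degree_eq_one_of_irreducible k (minpoly.irreducible h.isIntegral)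
    exact minpoly.mem_range_of_degree_eq_one k a hd
  · rintro ⟨c, rfl⟩
    exact (acl k (∅ : Set F)).algebraMap_mem c

theorem map_mem_acl {S : Set F} {a : F} (g : F ≃ₐ[k] F) (h : a ∈ acl k S) :
    g a ∈ acl k (g '' S) := by
  rw [mem_acl'] at h ⊢
  have h1 : ∀ x : Algebra.adjoin k S, g x ∈ Algebra.adjoin k (g '' S) := by
    intro x
    have := AlgHom.map_adjoin (g : F →ₐ[k] F) S
    rw [show (g '' S) = ((g : F →ₐ[k] F) '' S) from rfl, ← this]
    exact ⟨x, x.2, rfl⟩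
  let f : Algebra.adjoin k S →+* Algebra.adjoin k (g '' S) :=
    { toFun := fun x => ⟨g x, h1 x⟩
      map_one' := Subtype.ext (by simp)
      map_zero' := Subtype.ext (by simp)
      map_mul' := fun x y => Subtype.ext (by simp)
      map_add' := fun x y => Subtype.ext (by simp) }
  exact IsAlgebraic.ringHom_of_comp_eq f g.toRingEquiv.toRingHom h
    (fun x y hxy => Subtype.ext (g.injective (congrArg Subtype.val hxy))) (by ext; rfl)

theorem map_mem_acl_iff {S : Set F} {a : F} (g : F ≃ₐ[k] F) :
    g a ∈ acl k (g '' S) ↔ a ∈ acl k S := by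
  refine ⟨fun h => ?_, map_mem_acl g⟩
  have := map_mem_acl g.symm h
  rwa [← Set.image_comp, AlgEquiv.symm_apply_apply,
    show ((g.symm : F → F) ∘ g) = id from funext fun x => g.symm_apply_apply x,
    Set.image_id] at this

end Framework

section Tools

variable {k F : Type*} [Field k] [Field F] [Algebra k F]

theorem restrictScalars_mem_fixS {L : IntermediateField k F} (e : F ≃ₐ[L] F) :
    e.restrictScalars k ∈ fixS k (L : Set F) := fun s hs => e.commutes ⟨s, hs⟩

/-- The automorphism over an intermediate field attached to an element of its stabilizer. -/
def overFix {L : IntermediateField k F} {g : F ≃ₐ[k] F} (hg : g ∈ fixS k (L : Set F)) :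
    F ≃ₐ[L] F :=
  AlgEquiv.ofRingEquiv (f := g.toRingEquiv) fun x => hg x x.2

theorem exists_fixS_of_notMem_acl [IsAlgClosed F] {S : Set F} {a b : F} (ha : a ∉ acl k S)
    (hb : b ∉ acl k S) : ∃ g ∈ fixS k (acl k S : Set F), g a = b := by
  have key : ∀ c : F, c ∉ acl k S → Transcendental (acl k S) c := by
    intro c hc h
    rw [isAlgebraic_iff_mem_acl, acl_acl] at h
    exact hc h
  obtain ⟨e, he⟩ := exists_algEquiv_of_transcendental (key a ha) (key b hb)
  exact ⟨_, restrictScalars_mem_fixS e, he⟩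

/-- Conjugate algebraic elements are exchanged by the stabilizer of an intermediate field. -/
theorem exists_fixS_of_aeval_minpoly [IsAlgClosed F] (L : IntermediateField k F) {a b : F}
    (ha : IsAlgebraic L a) (hb : Polynomial.aeval b (minpoly L a) = 0) :
    ∃ g ∈ fixS k (L : Set F), g a = b := by
  have hi := ha.isIntegral
  have : Algebra.IsAlgebraic L (IntermediateField.adjoin L {a}) :=
    IntermediateField.isAlgebraic_adjoin_simple hi
  have hroot : b ∈ (minpoly L a).aroots F := by
    rw [Polynomial.mem_aroots]
    exact ⟨minpoly.ne_zero hi, hb⟩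
  let τ : IntermediateField.adjoin L {a} →ₐ[L] F :=
    (IntermediateField.algHomAdjoinIntegralEquiv L hi).symm ⟨b, hroot⟩
  have hτ : τ (IntermediateField.AdjoinSimple.gen L a) = b :=
    IntermediateField.algHomAdjoinIntegralEquiv_symm_apply_gen L hi ⟨b, hroot⟩
  obtain ⟨e, he⟩ := exists_algEquiv_comp_eq (IntermediateField.val _) τ
  refine ⟨_, restrictScalars_mem_fixS e, ?_⟩
  have := he (IntermediateField.AdjoinSimple.gen L a)
  rw [hτ] at this
  exact this

/-- The orbit of an element under a subgroup of `Aut(F/k)`. -/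
def orb (W : Subgroup (F ≃ₐ[k] F)) (a : F) : Set F := (fun g : F ≃ₐ[k] F => g a) '' (W : Set _)

theorem orb_mono {W V : Subgroup (F ≃ₐ[k] F)} (h : W ≤ V) (a : F) : orb W a ⊆ orb V a :=
  Set.image_mono h

theorem self_mem_orb (W : Subgroup (F ≃ₐ[k] F)) (a : F) : a ∈ orb W a := ⟨1, W.one_mem, rfl⟩

/-- An element whose orbit under the stabilizer of `S` is infinite is not algebraic. -/
theorem orb_finite_of_mem_acl {S : Set F} {a : F} (ha : a ∈ acl k S) :
    (orb (fixS k S) a).Finite := by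
  classical
  rw [mem_acl] at ha
  refine ((minpoly (IntermediateField.adjoin k S) a).aroots F).toFinset.finite_toSet.subset ?_
  rintro _ ⟨g, hg, rfl⟩
  have hg' : g ∈ fixS k (IntermediateField.adjoin k S : Set F) := by
    rw [fixS_adjoin]; exact hg
  simp only [Finset.mem_coe, Multiset.mem_toFinset]
  rw [Polynomial.mem_aroots]
  refine ⟨minpoly.ne_zero ha.isIntegral, ?_⟩
  have := Polynomial.aeval_algHom_apply (overFix hg' : F →ₐ[_] F) a
    (minpoly (IntermediateField.adjoin k S) a)
  rw [minpoly.aeval, map_zero] at this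
  exact this

theorem orb_infinite_of_notMem_acl [IsAlgClosed F] [CharZero F] {S : Set F} {a : F}
    (ha : a ∉ acl k S) : ¬ (orb (fixS k (acl k S : Set F)) a).Finite := by
  intro hf
  have h1 : ∀ m : ℕ, a + m ∉ acl k S := fun m hm => ha (by
    have := (acl k S).sub_mem hm (natCast_mem (acl k S) m)
    simpa using this)
  refine Set.infinite_of_injective_forall_mem (f := fun m : ℕ => a + m) ?_ ?_ hf
  · intro m n h
    simpa using h
  · intro m
    obtain ⟨g, hg, h⟩ := exists_fixS_of_notMem_acl ha (h1 m)
    exact ⟨g, hg, h⟩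

theorem mem_acl_of_orb_finite [IsAlgClosed F] [CharZero F] {S : Set F} {a : F}
    (h : (orb (fixS k S) a).Finite) : a ∈ acl k S := by
  by_contra ha
  exact orb_infinite_of_notMem_acl ha (h.subset (orb_mono (fixS_anti (subset_acl S)) a))

/-- In characteristic zero the fixed field of the stabilizer of `S` is `k(S)`. -/
theorem mem_adjoin_of_fixed [IsAlgClosed F] [CharZero F] {S : Set F} {a : F}
    (h : ∀ g ∈ fixS k S, g a = a) : a ∈ IntermediateField.adjoin k S := by
  have ha : a ∈ acl k S := by
    refine mem_acl_of_orb_finite ((Set.finite_singleton a).subset ?_)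
    rintro _ ⟨g, hg, rfl⟩
    exact h g hg
  rw [mem_acl] at ha
  set L := IntermediateField.adjoin k S
  have hi := ha.isIntegral
  have hsep : (minpoly L a).Separable := (minpoly.irreducible hi).separable
  have hsp : ((minpoly L a).map (algebraMap L F)).Splits := IsAlgClosed.splits _
  have hcard := Polynomial.card_rootSet_eq_natDegree hsep hsp
  have hsub : (minpoly L a).rootSet F ⊆ {a} := by
    intro b hb
    rw [Polynomial.mem_rootSet] at hb
    obtain ⟨g, hg, rfl⟩ := exists_fixS_of_aeval_minpoly L ha hb.2
    rw [fixS_adjoin] at hg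
    exact h g hg
  have hle : Fintype.card ((minpoly L a).rootSet F) ≤ 1 := by
    rw [Fintype.card_le_one_iff]
    intro x y
    exact Subtype.ext ((hsub x.2).trans (hsub y.2).symm)
  rw [hcard] at hle
  have h1 := minpoly.natDegree_pos hi
  have hd : (minpoly L a).degree = 1 := by
    rw [Polynomial.degree_eq_natDegree (minpoly.ne_zero hi)]
    exact_mod_cast le_antisymm hle h1
  obtain ⟨c, hc⟩ := minpoly.mem_range_of_degree_eq_one L a hd
  rw [← hc]
  exact c.2

theorem mem_adjoin_iff_fixed [IsAlgClosed F] [CharZero F] {S : Set F} {a : F} :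
    a ∈ IntermediateField.adjoin k S ↔ ∀ g ∈ fixS k S, g a = a :=
  ⟨fun h g hg => by rw [← fixS_adjoin] at hg; exact hg a h, mem_adjoin_of_fixed⟩

/-- Extending a bijection of transcendence bases over an intermediate field. -/
theorem exists_fixS_of_basis [IsAlgClosed F] {ι : Type*} (L : IntermediateField k F)
    {z w : ι → F} (hz : IsTranscendenceBasis L z) (hw : IsTranscendenceBasis L w) :
    ∃ g ∈ fixS k (L : Set F), ∀ i, g (z i) = w i := by
  obtain ⟨e, he⟩ := exists_algEquiv_of_isTranscendenceBasis hz hw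
  exact ⟨_, restrictScalars_mem_fixS e, he⟩

/-- All orbits of the subgroup on `F` are finite. -/
def TB (W : Subgroup (F ≃ₐ[k] F)) : Prop := ∀ a, (orb W a).Finite

theorem TB_fixS {S : Set F} (h : acl k S = ⊤) : TB (fixS k S) :=
  fun a => orb_finite_of_mem_acl (by rw [h]; trivial)

/-- Neighbourhood form of continuity for group homomorphisms. -/
def NbhdCont (ψ : (F ≃ₐ[k] F) ≃* (F ≃ₐ[k] F)) : Prop :=
  ∀ S : Set F, S.Finite → ∃ T : Set F, T.Finite ∧ ∀ g ∈ fixS k T, ψ g ∈ fixS k S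

theorem finite_restrict_of_orb {W : Subgroup (F ≃ₐ[k] F)} {T : Set F} (hT : T.Finite)
    (h : ∀ t ∈ T, (orb W t).Finite) :
    ((fun (g : F ≃ₐ[k] F) (t : T) => g t) '' (W : Set _)).Finite := by
  have := hT.to_subtype
  refine (Set.Finite.pi' (t := fun t : T => orb W t) fun t => h t t.2).subset ?_
  rintro _ ⟨g, hg, rfl⟩ t
  exact ⟨g, hg, rfl⟩

theorem TB.map {W : Subgroup (F ≃ₐ[k] F)} (hW : TB W) {ψ : (F ≃ₐ[k] F) ≃* (F ≃ₐ[k] F)}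
    (hψ : NbhdCont ψ) : TB (W.map ψ.toMonoidHom) := by
  intro a
  obtain ⟨T, hT, h⟩ := hψ {a} (Set.finite_singleton a)
  have hfin := finite_restrict_of_orb (W := W) hT fun t _ => hW t
  have : ∀ g h' : F ≃ₐ[k] F, (∀ t : T, g t = h' t) → ψ g a = ψ h' a := by
    intro g h' hgh
    have h1 : h'⁻¹ * g ∈ fixS k T := by
      intro t ht
      rw [AlgEquiv.mul_apply, hgh ⟨t, ht⟩]
      exact h'.symm_apply_apply t
    have h2 := h _ h1 a rfl
    rw [map_mul, map_inv, AlgEquiv.mul_apply] at h2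
    have h3 := congrArg (ψ h') h2
    rwa [← AlgEquiv.mul_apply, mul_inv_cancel, AlgEquiv.one_apply] at h3
  refine Set.Finite.subset (hfin.image fun r => ψ (Classical.epsilon fun g : F ≃ₐ[k] F =>
    ∀ t : T, g t = r t) a) ?_
  rintro _ ⟨_, ⟨g, hg, rfl⟩, rfl⟩
  refine ⟨fun t => g t, ⟨g, hg, rfl⟩, ?_⟩
  exact this _ _ (Classical.epsilon_spec (p := fun g' : F ≃ₐ[k] F => ∀ t : T, g' t = g t)
    ⟨g, fun t => rfl⟩)

end Tools

theorem nbhdCont_of_continuous {k F : Type*} [Field k] [Field F] [Algebra k F]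
    {ψ : (F ≃ₐ[k] F) ≃* (F ≃ₐ[k] F)}
    (h : @Continuous _ _ (autTop k F) (autTop k F) ψ) : NbhdCont ψ := by
  intro S hS
  let : TopologicalSpace F := ⊥
  have : DiscreteTopology F := ⟨rfl⟩
  let := autTop k F
  have hU : IsOpen (fixS k S : Set (F ≃ₐ[k] F)) := by
    have : (fixS k S : Set (F ≃ₐ[k] F)) =
        ⋂ s ∈ S, (fun g : F ≃ₐ[k] F => g s) ⁻¹' {s} := by
      ext g
      simp [mem_fixS]
    rw [this]
    refine hS.isOpen_biInter fun s _ => ?_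
    exact (isOpen_discrete _).preimage ((continuous_apply s).comp continuous_induced_dom)
  obtain ⟨t, ht, htU⟩ := isOpen_induced_iff.1 (hU.preimage h)
  have h1 : (fun x : F => (1 : F ≃ₐ[k] F) x) ∈ t := by
    have : (1 : F ≃ₐ[k] F) ∈ ψ ⁻¹' (fixS k S : Set (F ≃ₐ[k] F)) := by
      simp only [Set.mem_preimage, map_one]
      exact (fixS k S).one_mem
    rw [← htU] at this
    exact this
  obtain ⟨I, u, hI, hu⟩ := isOpen_pi_iff.1 ht _ h1
  refine ⟨I, I.finite_toSet, fun g hg => ?_⟩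
  have : g ∈ (fun (g : F ≃ₐ[k] F) (x : F) => g x) ⁻¹' t := by
    refine hu fun a ha => ?_
    have h2 := (hI a ha).2
    show g a ∈ u a
    rw [hg a ha]
    exact h2
  rw [htU] at this
  exact this

section Mobius
open IntermediateField
variable {k F : Type*} [Field k] [Field F] [Algebra k F]

theorem acl_empty [IsAlgClosed k] : acl k (∅ : Set F) = ⊥ := by
  ext a
  rw [mem_acl_empty, IntermediateField.mem_bot]

theorem transcendental_of_notMem_bot [IsAlgClosed k] {a : F}
    (ha : a ∉ (⊥ : IntermediateField k F)) : Transcendental k a := by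
  intro h
  rw [isAlgebraic_iff_mem_acl_empty, acl_empty] at h
  exact ha h

/-- The embedding of the rational function field attached to a transcendental element. -/
noncomputable def ratEmb (a : F) (ha : Transcendental k a) : RatFunc k →ₐ[k] F :=
  (k⟮a⟯).val.comp (RatFunc.algEquivOfTranscendental a ha : RatFunc k →ₐ[k] k⟮a⟯)

theorem ratEmb_apply (a : F) (ha : Transcendental k a) (f : RatFunc k) :
    ratEmb a ha f = Polynomial.aeval a f.num / Polynomial.aeval a f.denom := by
  simp [ratEmb, RatFunc.algEquivOfTranscendental_apply]

theorem ratEmb_X (a : F) (ha : Transcendental k a) : ratEmb a ha RatFunc.X = a := by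
  simp [ratEmb]

theorem exists_ratEmb (a : F) (ha : Transcendental k a) {b : F} (hb : b ∈ k⟮a⟯) :
    ∃ f, ratEmb a ha f = b :=
  ⟨(RatFunc.algEquivOfTranscendental a ha).symm ⟨b, hb⟩, by simp [ratEmb]⟩

theorem luroth [IsAlgClosed k] {x : F} (hx : x ∉ (⊥ : IntermediateField k F))
    {K : IntermediateField k F} (hK : K ≤ k⟮x⟯) : ∃ x₁, K = k⟮x₁⟯ := by
  have ht := transcendental_of_notMem_bot hx
  let E := K.comap (ratEmb x ht)
  refine ⟨ratEmb x ht (RatFunc.Luroth.generator E), ?_⟩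
  have h1 : K = E.map (ratEmb x ht) := by
    ext b
    constructor
    · intro hb
      obtain ⟨f, hf⟩ := exists_ratEmb x ht (hK hb)
      exact ⟨f, show ratEmb x ht f ∈ K by rw [hf]; exact hb, hf⟩
    · rintro ⟨f, hf, rfl⟩
      exact hf
  conv_lhs => rw [h1, RatFunc.Luroth.eq_adjoin_generator (E := E)]
  rw [IntermediateField.adjoin_map, Set.image_singleton]

/-- Two generators of a purely transcendental extension are related by a homography. -/
theorem exists_mobius [IsAlgClosed k] {a b : F} (ha : a ∉ (⊥ : IntermediateField k F))
    (hb : b ∈ k⟮a⟯) (hab : a ∈ k⟮b⟯) :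
    ∃ p ∈ (⊥ : IntermediateField k F), ∃ q ∈ (⊥ : IntermediateField k F),
    ∃ r ∈ (⊥ : IntermediateField k F), ∃ s ∈ (⊥ : IntermediateField k F),
      p * s - q * r ≠ 0 ∧ b * (r * a + s) = p * a + q := by
  have ht := transcendental_of_notMem_bot ha
  obtain ⟨f, hf⟩ := exists_ratEmb a ht hb
  have htop : k⟮f⟯ = ⊤ := by
    rw [← RatFunc.adjoin_X, eq_comm]
    refine le_antisymm ?_ (by rw [RatFunc.adjoin_X]; exact le_top)
    rw [IntermediateField.adjoin_simple_le_iff]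
    have h2 : a ∈ (k⟮f⟯).map (ratEmb a ht) := by
      rw [IntermediateField.adjoin_map, Set.image_singleton, hf]
      exact hab
    obtain ⟨f', hf', h3⟩ := h2
    have : f' = RatFunc.X := (ratEmb a ht).injective (h3.trans (ratEmb_X a ht).symm)
    rwa [← this]
  have hdeg := RatFunc.finrank_eq_max_natDegree (K := k) f
  rw [htop, IntermediateField.finrank_top] at hdeg
  have hn : f.num.natDegree ≤ 1 := by rw [hdeg]; exact le_max_left _ _
  have hd : f.denom.natDegree ≤ 1 := by rw [hdeg]; exact le_max_right _ _
  rw [ratEmb_apply] at hf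
  have hden : Polynomial.aeval a f.denom ≠ 0 := by
    intro h0
    exact f.denom_ne_zero ((transcendental_iff.1 ht) _ h0)
  obtain ⟨p, q, hpq⟩ := Polynomial.exists_eq_X_add_C_of_natDegree_le_one hn
  obtain ⟨r, s, hrs⟩ := Polynomial.exists_eq_X_add_C_of_natDegree_le_one hd
  have hm : ∀ c : k, algebraMap k F c ∈ (⊥ : IntermediateField k F) :=
    fun c => (⊥ : IntermediateField k F).algebraMap_mem c
  refine ⟨_, hm p, _, hm q, _, hm r, _, hm s, ?_, ?_⟩
  · intro h0
    rw [← map_mul, ← map_mul, ← map_sub, map_eq_zero, sub_eq_zero] at h0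
    have hcop := f.isCoprime_num_denom
    have key : ∀ c d : k, Polynomial.C c * f.num = Polynomial.C d * f.denom → c ≠ 0 →
        False := by
      intro c d hcd hc
      have hmem : b ∈ (⊥ : IntermediateField k F) := by
        have := congrArg (Polynomial.aeval a) hcd
        rw [map_mul, map_mul, Polynomial.aeval_C, Polynomial.aeval_C] at this
        have h4 : b = algebraMap k F (d / c) := by
          rw [← hf, map_div₀, div_eq_div_iff hden (by simpa using hc), mul_comm, this]
        rw [h4]
        exact hm _
      have : k⟮b⟯ = ⊥ := by rwa [IntermediateField.adjoin_simple_eq_bot_iff]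
      rw [this] at hab
      exact ha hab
    by_cases hr : r = 0
    · have hs : s ≠ 0 := by
        rintro rfl
        rw [hr] at hrs
        exact f.denom_ne_zero (by simpa using hrs)
      have hp : p = 0 := by simpa [hr, hs] using h0
      refine key s q ?_ hs
      rw [hpq, hrs, hp, hr]
      simp [mul_comm]
    · refine key r p ?_ hr
      rw [hpq, hrs, mul_add, mul_add, ← mul_assoc, ← mul_assoc, ← Polynomial.C_mul,
        ← Polynomial.C_mul, ← Polynomial.C_mul, ← Polynomial.C_mul, h0, mul_comm p r, mul_comm r q]
  · rw [← hf, div_mul_eq_mul_div, div_eq_iff hden]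
    rw [hpq, hrs]
    simp only [map_add, map_mul, Polynomial.aeval_C, Polynomial.aeval_X]

theorem quadratic_eq_zero [IsAlgClosed k] {a A B C : F} (ha : a ∉ (⊥ : IntermediateField k F))
    (hA : A ∈ (⊥ : IntermediateField k F)) (hB : B ∈ (⊥ : IntermediateField k F))
    (hC : C ∈ (⊥ : IntermediateField k F)) (h : A * a ^ 2 + B * a + C = 0) :
    A = 0 ∧ B = 0 ∧ C = 0 := by
  obtain ⟨A, rfl⟩ := IntermediateField.mem_bot.1 hA
  obtain ⟨B, rfl⟩ := IntermediateField.mem_bot.1 hB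
  obtain ⟨C, rfl⟩ := IntermediateField.mem_bot.1 hC
  have ht := transcendental_of_notMem_bot ha
  have h1 := transcendental_iff.1 ht
    (Polynomial.C A * Polynomial.X ^ 2 + Polynomial.C B * Polynomial.X + Polynomial.C C)
    (by simpa using h)
  have hc := fun i => congrArg (fun p => Polynomial.coeff p i) h1
  have h0 := hc 0
  have h1' := hc 1
  have h2 := hc 2
  simp [Polynomial.coeff_X, Polynomial.coeff_C] at h0 h1' h2
  simp [h0, h1', h2]

theorem linear_eq_zero {a B C : F} (ha : a ∉ (⊥ : IntermediateField k F))
    (hB : B ∈ (⊥ : IntermediateField k F)) (hC : C ∈ (⊥ : IntermediateField k F))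
    (h : B * a + C = 0) : B = 0 ∧ C = 0 := by
  have hB0 : B = 0 := by
    by_contra hB0
    apply ha
    have : a = -C / B := by field_simp; linear_combination h
    rw [this]
    exact div_mem (neg_mem hC) hB
  refine ⟨hB0, ?_⟩
  simpa [hB0] using h

end Mobius

section Twist
open IntermediateField
variable {k F : Type*} [Field k] [Field F] [Algebra k F]

theorem map_notMem_bot (g : F ≃ₐ[k] F) {a : F} (ha : a ∉ (⊥ : IntermediateField k F)) :
    g a ∉ (⊥ : IntermediateField k F) := by
  intro h
  obtain ⟨c, hc⟩ := IntermediateField.mem_bot.1 h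
  apply ha
  have : a = algebraMap k F c := g.injective (by rw [← hc, g.commutes])
  rw [this]
  exact (⊥ : IntermediateField k F).algebraMap_mem c

theorem map_mem_bot (g : F ≃ₐ[k] F) {a : F} (ha : a ∈ (⊥ : IntermediateField k F)) :
    g a = a := by
  obtain ⟨c, rfl⟩ := IntermediateField.mem_bot.1 ha
  exact g.commutes c

/-- A bijection of `F ∖ k` equivariant along an automorphism of `Aut(F/k)`. -/
structure IsTwist (ψ : (F ≃ₐ[k] F) ≃* (F ≃ₐ[k] F)) (φ : F → F) : Prop where
  notMem : ∀ a ∉ (⊥ : IntermediateField k F), φ a ∉ (⊥ : IntermediateField k F)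
  equi : ∀ (g : F ≃ₐ[k] F), ∀ a ∉ (⊥ : IntermediateField k F), φ (g a) = ψ g (φ a)
  inj : ∀ a ∉ (⊥ : IntermediateField k F), ∀ b ∉ (⊥ : IntermediateField k F),
    φ a = φ b → a = b
  surj : ∀ b ∉ (⊥ : IntermediateField k F), ∃ a ∉ (⊥ : IntermediateField k F), φ a = b

theorem exists_map_eq [IsAlgClosed k] [IsAlgClosed F] {a b : F}
    (ha : a ∉ (⊥ : IntermediateField k F)) (hb : b ∉ (⊥ : IntermediateField k F)) :
    ∃ g : F ≃ₐ[k] F, g a = b := by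
  rw [← acl_empty] at ha hb
  obtain ⟨g, -, h⟩ := exists_fixS_of_notMem_acl ha hb
  exact ⟨g, h⟩

theorem exists_isTwist [IsAlgClosed k] [IsAlgClosed F] {ψ : (F ≃ₐ[k] F) ≃* (F ≃ₐ[k] F)}
    {x x' : F} (hx : x ∉ (⊥ : IntermediateField k F)) (hx' : x' ∉ (⊥ : IntermediateField k F))
    (h : ∀ g : F ≃ₐ[k] F, g x = x ↔ ψ g x' = x') : ∃ φ, IsTwist ψ φ := by
  have key : ∀ g g' : F ≃ₐ[k] F, g x = g' x ↔ ψ g x' = ψ g' x' := by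
    intro g g'
    have h1 := h (g'⁻¹ * g)
    rw [map_mul, map_inv, AlgEquiv.mul_apply, AlgEquiv.mul_apply] at h1
    have h2 : ∀ (a b : F) (g' : F ≃ₐ[k] F), g'⁻¹ a = b ↔ a = g' b :=
      fun a b g' => AlgEquiv.symm_apply_eq g'
    rwa [h2, h2] at h1
  have hex : ∀ a : F, ∃ g : F ≃ₐ[k] F, a ∉ (⊥ : IntermediateField k F) → g x = a := by
    intro a
    by_cases ha : a ∉ (⊥ : IntermediateField k F)
    · obtain ⟨g, hg⟩ := exists_map_eq hx ha
      exact ⟨g, fun _ => hg⟩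
    · exact ⟨1, fun h => absurd h ha⟩
  choose s hs using hex
  refine ⟨fun a => ψ (s a) x', ?_, ?_, ?_, ?_⟩
  · exact fun a _ => map_notMem_bot _ hx'
  · intro g a ha
    rw [← AlgEquiv.mul_apply, ← map_mul, ← key, hs _ (map_notMem_bot g ha), AlgEquiv.mul_apply,
      hs a ha]
  · intro a ha b hb hab
    rw [← key, hs a ha, hs b hb] at hab
    exact hab
  · intro b hb
    obtain ⟨g, hg⟩ := exists_map_eq hx' hb
    refine ⟨ψ.symm g x, map_notMem_bot _ hx, ?_⟩
    have := (key (s (ψ.symm g x)) (ψ.symm g)).1 (hs _ (map_notMem_bot _ hx))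
    rw [this, MulEquiv.apply_symm_apply, hg]

namespace IsTwist
variable {ψ : (F ≃ₐ[k] F) ≃* (F ≃ₐ[k] F)} {φ : F → F}

theorem comp (h : IsTwist ψ φ) {m n : F → F}
    (hm : ∀ a ∉ (⊥ : IntermediateField k F), m a ∉ (⊥ : IntermediateField k F))
    (hn : ∀ a ∉ (⊥ : IntermediateField k F), n a ∉ (⊥ : IntermediateField k F))
    (hmn : ∀ a ∉ (⊥ : IntermediateField k F), m (n a) = a)
    (hnm : ∀ a ∉ (⊥ : IntermediateField k F), n (m a) = a)
    (hg : ∀ (g : F ≃ₐ[k] F), ∀ a, g (m a) = m (g a)) : IsTwist ψ fun a => m (φ a) where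
  notMem a ha := hm _ (h.notMem a ha)
  equi g a ha := by simp only [h.equi g a ha, hg]
  inj a ha b hb hab := h.inj a ha b hb (by
    have := congrArg n hab
    rwa [hnm _ (h.notMem a ha), hnm _ (h.notMem b hb)] at this)
  surj b hb := by
    obtain ⟨a, ha, hab⟩ := h.surj (n b) (hn b hb)
    exact ⟨a, ha, by rw [hab, hmn b hb]⟩

theorem add_notMem {a c : F} (ha : a ∉ (⊥ : IntermediateField k F))
    (hc : c ∈ (⊥ : IntermediateField k F)) : a + c ∉ (⊥ : IntermediateField k F) := fun h =>
  ha (by simpa using sub_mem h hc)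

theorem mul_notMem {a c : F} (ha : a ∉ (⊥ : IntermediateField k F))
    (hc : c ∈ (⊥ : IntermediateField k F)) (hc0 : c ≠ 0) :
    c * a ∉ (⊥ : IntermediateField k F) := fun h =>
  ha (by simpa [hc0] using mul_mem (inv_mem hc) h)

theorem inv_notMem {a : F} (ha : a ∉ (⊥ : IntermediateField k F)) :
    a⁻¹ ∉ (⊥ : IntermediateField k F) := fun h =>
  ha (by simpa using inv_mem h)

theorem comp_add (h : IsTwist ψ φ) {c : F} (hc : c ∈ (⊥ : IntermediateField k F)) :
    IsTwist ψ fun a => φ a + c :=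
  h.comp (m := fun a => a + c) (n := fun a => a - c) (fun _ ha => add_notMem ha hc)
    (fun a ha => by rw [sub_eq_add_neg]; exact add_notMem ha (neg_mem hc)) (by simp) (by simp)
    (fun g a => by simp [map_mem_bot g hc])

theorem comp_mul (h : IsTwist ψ φ) {c : F} (hc : c ∈ (⊥ : IntermediateField k F)) (hc0 : c ≠ 0) :
    IsTwist ψ fun a => c * φ a :=
  h.comp (m := fun a => c * a) (n := fun a => c⁻¹ * a) (fun _ ha => mul_notMem ha hc hc0)
    (fun _ ha => mul_notMem ha (inv_mem hc) (inv_ne_zero hc0)) (by simp [hc0]) (by simp [hc0])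
    (fun g a => by simp [map_mem_bot g hc])

theorem comp_inv (h : IsTwist ψ φ) : IsTwist ψ fun a => (φ a)⁻¹ :=
  h.comp (m := fun a => a⁻¹) (n := fun a => a⁻¹) (fun _ ha => inv_notMem ha)
    (fun _ ha => inv_notMem ha) (by simp) (by simp) (fun g a => by simp)

theorem fixed_iff (h : IsTwist ψ φ) (g : F ≃ₐ[k] F) {a : F}
    (ha : a ∉ (⊥ : IntermediateField k F)) : ψ g (φ a) = φ a ↔ g a = a := by
  rw [← h.equi g a ha]
  exact ⟨fun hh => h.inj _ (map_notMem_bot g ha) _ ha hh, fun hh => by rw [hh]⟩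

theorem mem_adjoin [IsAlgClosed F] [CharZero F] (h : IsTwist ψ φ) {S : Set F}
    (hS : ∀ s ∈ S, s ∉ (⊥ : IntermediateField k F)) {b : F} (hb : b ∉ (⊥ : IntermediateField k F)) :
    φ b ∈ adjoin k (φ '' S) ↔ b ∈ adjoin k S := by
  rw [mem_adjoin_iff_fixed, mem_adjoin_iff_fixed]
  constructor
  · intro H g hg
    rw [← h.fixed_iff g hb]
    refine H _ ?_
    rintro _ ⟨s, hs, rfl⟩
    rw [h.fixed_iff g (hS s hs)]
    exact hg s hs
  · intro H g hg
    obtain ⟨g, rfl⟩ := ψ.surjective g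
    rw [h.fixed_iff g hb]
    refine H _ fun s hs => ?_
    rw [← h.fixed_iff g (hS s hs)]
    exact hg _ ⟨s, hs, rfl⟩

theorem mem_adjoin_simple [IsAlgClosed F] [CharZero F] (h : IsTwist ψ φ) {a b : F}
    (ha : a ∉ (⊥ : IntermediateField k F)) (hb : b ∉ (⊥ : IntermediateField k F)) :
    φ b ∈ k⟮φ a⟯ ↔ b ∈ k⟮a⟯ := by
  rw [← h.mem_adjoin (S := {a}) (by simpa using ha) hb, Set.image_singleton]

/-- A map of `F ∖ k` commuting with `Aut(F/k)` and preserving the generated fields becomes a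
homography after the twist. -/
theorem exists_mobius [IsAlgClosed k] [IsAlgClosed F] [CharZero F] (h : IsTwist ψ φ) {m n : F → F}
    (hm : ∀ a ∉ (⊥ : IntermediateField k F), m a ∉ (⊥ : IntermediateField k F))
    (hn : ∀ a ∉ (⊥ : IntermediateField k F), n (m a) = a)
    (hmk : ∀ a, m a ∈ k⟮a⟯) (hnk : ∀ a, n a ∈ k⟮a⟯)
    (hg : ∀ (g : F ≃ₐ[k] F), ∀ a, g (m a) = m (g a))
    (hne : ∃ x, x ∉ (⊥ : IntermediateField k F)) :
    ∃ p ∈ (⊥ : IntermediateField k F), ∃ q ∈ (⊥ : IntermediateField k F),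
    ∃ r ∈ (⊥ : IntermediateField k F), ∃ s ∈ (⊥ : IntermediateField k F),
      p * s - q * r ≠ 0 ∧ ∀ a ∉ (⊥ : IntermediateField k F),
        φ (m a) * (r * φ a + s) = p * φ a + q := by
  obtain ⟨x, hx⟩ := hne
  obtain ⟨p, hp, q, hq, r, hr, s, hs, h1, h2⟩ := _root_.exists_mobius (h.notMem x hx)
    ((h.mem_adjoin_simple hx (hm x hx)).2 (hmk x))
    ((h.mem_adjoin_simple (hm x hx) hx).2 (by
      have := hnk (m x)
      rwa [hn x hx] at this))
  refine ⟨p, hp, q, hq, r, hr, s, hs, h1, fun a ha => ?_⟩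
  obtain ⟨g, rfl⟩ := exists_map_eq hx ha
  have h3 := congrArg (ψ g) h2
  simp only [map_mul, map_add, map_mem_bot _ hp, map_mem_bot _ hq, map_mem_bot _ hr,
    map_mem_bot _ hs, ← h.equi g x hx, ← h.equi g (m x) (hm x hx), hg] at h3
  exact h3

end IsTwist
end Twist

section Normalize
open IntermediateField
variable {k F : Type*} [Field k] [Field F] [Algebra k F]

theorem exists_pow_eq_of_mem_bot [IsAlgClosed k] {c : F} (hc : c ∈ (⊥ : IntermediateField k F))
    {n : ℕ} (hn : 0 < n) : ∃ d ∈ (⊥ : IntermediateField k F), d ^ n = c := by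
  obtain ⟨c, rfl⟩ := IntermediateField.mem_bot.1 hc
  obtain ⟨d, hd⟩ := IsAlgClosed.exists_pow_nat_eq c hn
  exact ⟨algebraMap k F d, (⊥ : IntermediateField k F).algebraMap_mem d, by
    rw [← map_pow, hd]⟩

namespace IsTwist
variable {ψ : (F ≃ₐ[k] F) ≃* (F ≃ₐ[k] F)} {φ : F → F}

theorem ne_of_notMem {a c : F} (ha : a ∉ (⊥ : IntermediateField k F))
    (hc : c ∈ (⊥ : IntermediateField k F)) : a ≠ c := fun h => ha (h ▸ hc)

/-- Homographies commuting with the unit translation are translations. -/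
theorem eq_add_of_commute [IsAlgClosed k] {a b p q r s : F} (ha : a ∉ (⊥ : IntermediateField k F))
    (hp : p ∈ (⊥ : IntermediateField k F)) (hq : q ∈ (⊥ : IntermediateField k F))
    (hr : r ∈ (⊥ : IntermediateField k F)) (hs : s ∈ (⊥ : IntermediateField k F))
    (hdet : p * s - q * r ≠ 0) {c : F} (hc : c ∈ (⊥ : IntermediateField k F)) (hc0 : c ≠ 0)
    (h1 : b * (r * a + s) = p * a + q) (h2 : (b + c) * (r * (a + 1) + s) = p * (a + 1) + q) :
    r = 0 ∧ s ≠ 0 ∧ p = c * s := by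
  have e : (c * r ^ 2) * a ^ 2 + (c * r * (2 * s + r)) * a +
      (q * r + c * s * (r + s) - p * s) = 0 := by
    linear_combination (r * a + s) * h2 - (r * (a + 1) + s) * h1
  obtain ⟨c2, -, c0⟩ := quadratic_eq_zero ha (mul_mem hc (pow_mem hr 2))
    (mul_mem (mul_mem hc hr) (add_mem (mul_mem (ofNat_mem _ 2) hs) hr))
    (sub_mem (add_mem (mul_mem hq hr) (mul_mem (mul_mem hc hs) (add_mem hr hs)))
      (mul_mem hp hs)) e
  have hr0 : r = 0 := by simpa [hc0] using c2
  subst hr0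
  have hs0 : s ≠ 0 := by rintro rfl; simp at hdet
  refine ⟨rfl, hs0, mul_right_cancel₀ hs0 ?_⟩
  linear_combination -c0

variable [IsAlgClosed k] [IsAlgClosed F] [CharZero F]

theorem mobius_add (h : IsTwist ψ φ) (hne : ∃ x, x ∉ (⊥ : IntermediateField k F)) {c : F}
    (hc : c ∈ (⊥ : IntermediateField k F)) :
    ∃ p ∈ (⊥ : IntermediateField k F), ∃ q ∈ (⊥ : IntermediateField k F),
    ∃ r ∈ (⊥ : IntermediateField k F), ∃ s ∈ (⊥ : IntermediateField k F),
      p * s - q * r ≠ 0 ∧ ∀ a ∉ (⊥ : IntermediateField k F),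
        φ (a + c) * (r * φ a + s) = p * φ a + q :=
  h.exists_mobius (m := fun a => a + c) (n := fun a => a - c) (fun _ ha => add_notMem ha hc)
    (by simp) (fun a => add_mem (mem_adjoin_simple_self k a) (bot_le (a := k⟮a⟯) hc))
    (fun a => sub_mem (mem_adjoin_simple_self k a) (bot_le (a := k⟮a⟯) hc))
    (fun g a => by simp [map_mem_bot g hc]) hne

theorem mobius_mul (h : IsTwist ψ φ) (hne : ∃ x, x ∉ (⊥ : IntermediateField k F)) {c : F}
    (hc : c ∈ (⊥ : IntermediateField k F)) (hc0 : c ≠ 0) :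
    ∃ p ∈ (⊥ : IntermediateField k F), ∃ q ∈ (⊥ : IntermediateField k F),
    ∃ r ∈ (⊥ : IntermediateField k F), ∃ s ∈ (⊥ : IntermediateField k F),
      p * s - q * r ≠ 0 ∧ ∀ a ∉ (⊥ : IntermediateField k F),
        φ (c * a) * (r * φ a + s) = p * φ a + q :=
  h.exists_mobius (m := fun a => c * a) (n := fun a => c⁻¹ * a)
    (fun _ ha => mul_notMem ha hc hc0)
    (by simp [hc0]) (fun a => mul_mem (bot_le (a := k⟮a⟯) hc) (mem_adjoin_simple_self k a))
    (fun a => mul_mem (inv_mem (bot_le (a := k⟮a⟯) hc)) (mem_adjoin_simple_self k a))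
    (fun g a => by simp [map_mem_bot g hc]) hne

theorem exists_affine (h : IsTwist ψ φ) (hne : ∃ x, x ∉ (⊥ : IntermediateField k F)) :
    ∃ φ', IsTwist ψ φ' ∧ ∃ μ ∈ (⊥ : IntermediateField k F), ∃ ν ∈ (⊥ : IntermediateField k F),
      ∀ a ∉ (⊥ : IntermediateField k F), φ' (a + 1) = μ * φ' a + ν := by
  obtain ⟨p, hp, q, hq, r, hr, s, hs, hdet, H⟩ := h.mobius_add hne (one_mem _)
  by_cases hr0 : r = 0
  · subst hr0
    have hs0 : s ≠ 0 := by rintro rfl; simp at hdet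
    refine ⟨φ, h, p / s, div_mem hp hs, q / s, div_mem hq hs, fun a ha => ?_⟩
    have := H a ha
    field_simp
    linear_combination this
  · obtain ⟨δ, hδ, hδ2⟩ := exists_pow_eq_of_mem_bot (k := k) (c := (s - p) ^ 2 + 4 * r * q)
      (add_mem (pow_mem (sub_mem hs hp) 2) (mul_mem (mul_mem (ofNat_mem _ 4) hr) hq))
      (n := 2) two_pos
    set t := (p - s + δ) / (2 * r) with ht
    have htm : t ∈ (⊥ : IntermediateField k F) :=
      div_mem (add_mem (sub_mem hp hs) hδ) (mul_mem (ofNat_mem _ 2) hr)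
    have ht2 : r * t ^ 2 + (s - p) * t - q = 0 := by
      rw [ht]
      field_simp
      linear_combination hδ2
    clear_value t
    have hpr : p - r * t ≠ 0 := by
      intro h0
      obtain ⟨x, hx⟩ := hne
      have h1 := H x hx
      have h2 : (φ (x + 1) - t) * (r * φ x + s) = 0 := by
        linear_combination h1 + (φ x - t) * h0 - ht2
      rcases mul_eq_zero.1 h2 with h3 | h3
      · exact ne_of_notMem (h.notMem _ (add_notMem hx (one_mem _))) htm (sub_eq_zero.1 h3)
      · exact hr0 (linear_eq_zero (h.notMem x hx) hr hs h3).1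
    refine ⟨_, (h.comp_add (neg_mem htm)).comp_inv, (r * t + s) / (p - r * t),
      div_mem (add_mem (mul_mem hr htm) hs) (sub_mem hp (mul_mem hr htm)), r / (p - r * t),
      div_mem hr (sub_mem hp (mul_mem hr htm)), fun a ha => ?_⟩
    have h1 := H a ha
    simp only [← sub_eq_add_neg]
    have h4 : φ a - t ≠ 0 := fun h0 => ne_of_notMem (h.notMem a ha) htm
      (by linear_combination h0)
    have h5 : φ (a + 1) - t ≠ 0 := fun h0 =>
      ne_of_notMem (h.notMem _ (add_notMem ha (one_mem _))) htm (by linear_combination h0)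
    rw [div_mul_eq_mul_div, ← add_div, eq_div_iff hpr]
    field_simp
    linear_combination (-1) * h1 + ht2

theorem exists_translation (h : IsTwist ψ φ) (hne : ∃ x, x ∉ (⊥ : IntermediateField k F)) :
    ∃ φ', IsTwist ψ φ' ∧ ∀ a ∉ (⊥ : IntermediateField k F), φ' (a + 1) = φ' a + 1 := by
  obtain ⟨φ', h', μ, hμ, ν, hν, H⟩ := h.exists_affine hne
  by_cases hμ1 : μ = 1
  · subst hμ1
    obtain ⟨x, hx⟩ := hne
    have hν0 : ν ≠ 0 := by
      rintro rfl
      have := h'.inj _ (add_notMem hx (one_mem _)) _ hx (by simpa using H x hx)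
      simp at this
    refine ⟨_, h'.comp_mul (inv_mem hν) (inv_ne_zero hν0), fun a ha => ?_⟩
    rw [H a ha]
    field_simp
  · exfalso
    have hm1 : 1 - μ ≠ 0 := fun h0 => hμ1 (sub_eq_zero.1 h0).symm
    have h2 := h'.comp_add (c := -(ν / (1 - μ))) (neg_mem (div_mem hν (sub_mem (one_mem _) hμ)))
    set χ := fun a => φ' a + -(ν / (1 - μ)) with hχ
    have Hχ : ∀ a ∉ (⊥ : IntermediateField k F), χ (a + 1) = μ * χ a := by
      intro a ha
      simp only [hχ, H a ha]
      field_simp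
      ring
    obtain ⟨p, hp, q, hq, r, hr, s, hs, hdet, HN⟩ :=
      h2.mobius_mul hne (ofNat_mem _ 2) two_ne_zero
    obtain ⟨x, hx⟩ := hne
    have hx1 : x + 1 ∉ (⊥ : IntermediateField k F) := add_notMem hx (one_mem _)
    have hx2 : x + 1 + 1 ∉ (⊥ : IntermediateField k F) := add_notMem hx1 (one_mem _)
    have hx3 : x + 1 + 1 + 1 ∉ (⊥ : IntermediateField k F) := add_notMem hx2 (one_mem _)
    have hsq : μ ^ 2 ≠ 1 := by
      intro h0
      have := h2.inj _ hx2 _ hx (by rw [Hχ _ hx1, Hχ _ hx]; linear_combination χ x * h0)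
      rw [add_assoc, add_eq_left] at this
      norm_num at this
    have hcu : μ ^ 3 ≠ 1 := by
      intro h0
      have := h2.inj _ hx3 _ hx
        (by rw [Hχ _ hx2, Hχ _ hx1, Hχ _ hx]; linear_combination χ x * h0)
      rw [add_assoc, add_assoc, add_eq_left] at this
      norm_num at this
    have h2x : 2 * x ∉ (⊥ : IntermediateField k F) :=
      mul_notMem hx (ofNat_mem _ 2) two_ne_zero
    have e1 := HN x hx
    have e2 := HN (x + 1) hx1
    have e3 : χ (2 * (x + 1)) = μ * (μ * χ (2 * x)) := by
      rw [show 2 * (x + 1) = 2 * x + 1 + 1 by ring, Hχ _ (add_notMem h2x (one_mem _)), Hχ _ h2x]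
    have hμ0 : μ ≠ 0 := by
      rintro rfl
      have h3 := h2.notMem _ hx1
      rw [Hχ _ hx, zero_mul] at h3
      exact h3 (zero_mem _)
    rw [e3, Hχ x hx] at e2
    have e4 : (p * r * μ * (1 - μ ^ 2)) * χ x ^ 2 +
        (p * s * (μ - μ ^ 2) + q * r * (1 - μ ^ 3)) * χ x + q * s * (1 - μ ^ 2) = 0 := by
      linear_combination (-(r * χ x + s)) * e2 + μ ^ 2 * (r * μ * χ x + s) * e1
    have hsm : 1 - μ ^ 2 ∈ (⊥ : IntermediateField k F) := sub_mem (one_mem _) (pow_mem hμ _)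
    obtain ⟨c2, c1, c0⟩ := quadratic_eq_zero (h2.notMem x hx)
      (mul_mem (mul_mem (mul_mem hp hr) hμ) hsm)
      (add_mem (mul_mem (mul_mem hp hs) (sub_mem hμ (pow_mem hμ _)))
        (mul_mem (mul_mem hq hr) (sub_mem (one_mem _) (pow_mem hμ _))))
      (mul_mem (mul_mem hq hs) hsm) e4
    have hsq' : 1 - μ ^ 2 ≠ 0 := fun h0 => hsq (sub_eq_zero.1 h0).symm
    have hcu' : 1 - μ ^ 3 ≠ 0 := fun h0 => hcu (sub_eq_zero.1 h0).symm
    have hpr : p = 0 ∨ r = 0 := by simpa [hμ0, hsq'] using c2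
    have hqs : q = 0 ∨ s = 0 := by simpa [hsq'] using c0
    have hmm : μ - μ ^ 2 ≠ 0 := by
      rw [show μ - μ ^ 2 = μ * (1 - μ) by ring]
      exact mul_ne_zero hμ0 hm1
    rcases hpr with rfl | rfl
    · simp only [zero_mul, zero_add, mul_eq_zero, hcu', or_false] at c1
      apply hdet
      rcases c1 with rfl | rfl <;> ring
    · simp only [mul_zero, zero_mul, add_zero, mul_eq_zero, hmm, or_false] at c1
      apply hdet
      rcases c1 with rfl | rfl <;> ring

end IsTwist
end Normalize

section Linear
open IntermediateField
variable {k F : Type*} [Field k] [Field F] [Algebra k F]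

/-- A twist extended to `k` compatibly with translations and homotheties. -/
structure IsLinTwist (ψ : (F ≃ₐ[k] F) ≃* (F ≃ₐ[k] F)) (φ : F → F) : Prop
    extends IsTwist ψ φ where
  mem : ∀ c ∈ (⊥ : IntermediateField k F), φ c ∈ (⊥ : IntermediateField k F)
  map_add_const : ∀ a ∉ (⊥ : IntermediateField k F), ∀ c ∈ (⊥ : IntermediateField k F),
    φ (a + c) = φ a + φ c
  map_const_mul : ∀ a ∉ (⊥ : IntermediateField k F), ∀ c ∈ (⊥ : IntermediateField k F),
    φ (c * a) = φ c * φ a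
  surj_const : ∀ c ∈ (⊥ : IntermediateField k F), ∃ b ∈ (⊥ : IntermediateField k F), φ b = c

variable {ψ : (F ≃ₐ[k] F) ≃* (F ≃ₐ[k] F)} {φ : F → F}

theorem IsTwist.exists_const_add [IsAlgClosed k] [IsAlgClosed F] [CharZero F]
    (h : IsTwist ψ φ) {x : F} (hx : x ∉ (⊥ : IntermediateField k F))
    (h1 : ∀ a ∉ (⊥ : IntermediateField k F), φ (a + 1) = φ a + 1) {c : F}
    (hc : c ∈ (⊥ : IntermediateField k F)) :
    ∃ d ∈ (⊥ : IntermediateField k F), ∀ a ∉ (⊥ : IntermediateField k F), φ (a + c) = φ a + d := by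
  obtain ⟨p, hp, q, hq, r, hr, s, hs, hdet, H⟩ := h.mobius_add ⟨x, hx⟩ hc
  have e1 := H x hx
  have e2 := H (x + 1) (IsTwist.add_notMem hx (one_mem _))
  rw [h1 x hx, show x + 1 + c = x + c + 1 by ring, h1 _ (IsTwist.add_notMem hx hc)] at e2
  obtain ⟨rfl, hs0, hps⟩ := IsTwist.eq_add_of_commute (h.notMem x hx) hp hq hr hs hdet (one_mem _)
    one_ne_zero e1 e2
  refine ⟨q / s, div_mem hq hs, fun a ha => ?_⟩
  have := H a ha
  field_simp
  linear_combination this + φ a * hps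

theorem IsTwist.exists_const_mul [IsAlgClosed k] [IsAlgClosed F] [CharZero F]
    (h : IsTwist ψ φ) {x : F} (hx : x ∉ (⊥ : IntermediateField k F))
    (h1 : ∀ a ∉ (⊥ : IntermediateField k F), φ (a + 1) = φ a + 1) {c d : F}
    (hc : c ∈ (⊥ : IntermediateField k F)) (hc0 : c ≠ 0) (hd : d ∈ (⊥ : IntermediateField k F))
    (hcd : ∀ a ∉ (⊥ : IntermediateField k F), φ (a + c) = φ a + d) :
    ∃ t ∈ (⊥ : IntermediateField k F), ∀ a ∉ (⊥ : IntermediateField k F),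
      φ (c * a) = d * φ a + t := by
  have hd0 : d ≠ 0 := by
    rintro rfl
    have := h.inj _ (IsTwist.add_notMem hx hc) _ hx (by simpa using hcd x hx)
    exact hc0 (by simpa using this)
  obtain ⟨p, hp, q, hq, r, hr, s, hs, hdet, H⟩ := h.mobius_mul ⟨x, hx⟩ hc hc0
  have e1 := H x hx
  have e2 := H (x + 1) (IsTwist.add_notMem hx (one_mem _))
  rw [h1 x hx, show c * (x + 1) = c * x + c by ring, hcd _ (IsTwist.mul_notMem hx hc hc0)] at e2
  obtain ⟨rfl, hs0, hps⟩ := IsTwist.eq_add_of_commute (h.notMem x hx) hp hq hr hs hdet hd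
    hd0 e1 e2
  refine ⟨q / s, div_mem hq hs, fun a ha => ?_⟩
  have := H a ha
  field_simp
  linear_combination this + φ a * hps

theorem IsTwist.exists_homothety [IsAlgClosed k] [IsAlgClosed F] [CharZero F]
    (h : IsTwist ψ φ) {x : F} (hx : x ∉ (⊥ : IntermediateField k F)) :
    ∃ φ', IsTwist ψ φ' ∧ (∀ a ∉ (⊥ : IntermediateField k F), φ' (a + 1) = φ' a + 1) ∧
      ∀ a ∉ (⊥ : IntermediateField k F), φ' (2 * a) = 2 * φ' a := by
  obtain ⟨φ₁, h', h1⟩ := h.exists_translation ⟨x, hx⟩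
  have h2 : ∀ a ∉ (⊥ : IntermediateField k F), φ₁ (a + 2) = φ₁ a + 2 := by
    intro a ha
    rw [show a + 2 = a + 1 + 1 by ring, h1 _ (IsTwist.add_notMem ha (one_mem _)), h1 a ha]
    ring
  obtain ⟨t, ht, H⟩ := h'.exists_const_mul hx h1 (ofNat_mem _ 2) two_ne_zero (ofNat_mem _ 2) h2
  refine ⟨_, h'.comp_add ht, fun a ha => ?_, fun a ha => ?_⟩
  · simp only [h1 a ha]; ring
  · simp only [H a ha]; ring

theorem IsTwist.exists_isLinTwist [IsAlgClosed k] [IsAlgClosed F] [CharZero F]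
    (h : IsTwist ψ φ) {x : F} (hx : x ∉ (⊥ : IntermediateField k F)) :
    ∃ φ', IsLinTwist ψ φ' := by
  classical
  obtain ⟨χ, h', h1, h2⟩ := h.exists_homothety hx
  have hT : ∀ c : F, ∃ d, c ∈ (⊥ : IntermediateField k F) →
      d ∈ (⊥ : IntermediateField k F) ∧ ∀ a ∉ (⊥ : IntermediateField k F), χ (a + c) = χ a + d := by
    intro c
    by_cases hc : c ∈ (⊥ : IntermediateField k F)
    · obtain ⟨d, hd, H⟩ := h'.exists_const_add hx h1 hc
      exact ⟨d, fun _ => ⟨hd, H⟩⟩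
    · exact ⟨0, fun h => absurd h hc⟩
  choose θ hθ using hT
  have hθ0 : θ 0 = 0 := by
    have := (hθ 0 (zero_mem _)).2 x hx
    simpa using this
  have hmul : ∀ c ∈ (⊥ : IntermediateField k F), ∀ a ∉ (⊥ : IntermediateField k F), c ≠ 0 →
      χ (c * a) = θ c * χ a := by
    intro c hc a ha hc0
    obtain ⟨t, -, H⟩ := h'.exists_const_mul hx h1 hc hc0 (hθ c hc).1 (hθ c hc).2
    have h2x := IsTwist.mul_notMem hx (ofNat_mem (⊥ : IntermediateField k F) 2) two_ne_zero
    have e1 := H _ h2x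
    rw [show c * (2 * x) = 2 * (c * x) by ring, h2 _ (IsTwist.mul_notMem hx hc hc0), H x hx,
      h2 x hx] at e1
    have ht : t = 0 := by linear_combination e1
    rw [H a ha, ht, add_zero]
  set φ' : F → F := fun a => if a ∈ (⊥ : IntermediateField k F) then θ a else χ a with hφ'
  have hin : ∀ c ∈ (⊥ : IntermediateField k F), φ' c = θ c := fun c hc => if_pos hc
  have hout : ∀ a ∉ (⊥ : IntermediateField k F), φ' a = χ a := fun c hc => if_neg hc
  refine ⟨φ', ⟨⟨?_, ?_, ?_, ?_⟩, ?_, ?_, ?_, ?_⟩⟩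
  · intro a ha; rw [hout a ha]; exact h'.notMem a ha
  · intro g a ha; rw [hout a ha, hout _ (map_notMem_bot g ha)]; exact h'.equi g a ha
  · intro a ha b hb; rw [hout a ha, hout b hb]; exact h'.inj a ha b hb
  · intro b hb
    obtain ⟨a, ha, hab⟩ := h'.surj b hb
    exact ⟨a, ha, by rw [hout a ha, hab]⟩
  · intro c hc; rw [hin c hc]; exact (hθ c hc).1
  · intro a ha c hc
    rw [hin c hc, hout a ha, hout _ (IsTwist.add_notMem ha hc)]
    exact (hθ c hc).2 a ha
  · intro a ha c hc
    by_cases hc0 : c = 0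
    · rw [hc0, zero_mul, hin 0 (zero_mem _), hθ0, zero_mul]
    · rw [hin c hc, hout a ha, hout _ (IsTwist.mul_notMem ha hc hc0)]
      exact hmul c hc a ha hc0
  · intro c hc
    obtain ⟨y, hy, hyx⟩ := h'.surj _ (IsTwist.add_notMem (h'.notMem x hx) hc)
    have hyk : y ∈ k⟮x⟯ := by
      rw [← h'.mem_adjoin_simple hx hy, hyx]
      exact add_mem (mem_adjoin_simple_self k _) (bot_le (a := k⟮χ x⟯) hc)
    have hxk : x ∈ k⟮y⟯ := by
      rw [← h'.mem_adjoin_simple hy hx, hyx]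
      have := sub_mem (mem_adjoin_simple_self k (χ x + c)) (bot_le (a := k⟮χ x + c⟯) hc)
      rwa [add_sub_cancel_right] at this
    obtain ⟨p, hp, q, hq, r, hr, s, hs, hdet, e1⟩ := _root_.exists_mobius hx hyk hxk
    have hx1 := IsTwist.add_notMem hx (one_mem (⊥ : IntermediateField k F))
    obtain ⟨g, hg⟩ := exists_map_eq hx hx1
    have e2 := congrArg g e1
    simp only [map_mul, map_add, map_mem_bot _ hp, map_mem_bot _ hq, map_mem_bot _ hr,
      map_mem_bot _ hs, hg] at e2
    have hgy : g y = y + 1 := by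
      refine h'.inj _ (map_notMem_bot g hy) _ (IsTwist.add_notMem hy (one_mem _)) ?_
      rw [h'.equi g y hy, hyx, map_add, map_mem_bot _ hc, ← h'.equi g x hx, hg, h1 x hx, h1 y hy,
        hyx]
      ring
    rw [hgy] at e2
    obtain ⟨rfl, hs0, hps⟩ := IsTwist.eq_add_of_commute hx hp hq hr hs hdet (one_mem _)
      one_ne_zero e1 e2
    have hqs : q / s ∈ (⊥ : IntermediateField k F) := div_mem hq hs
    refine ⟨q / s, hqs, ?_⟩
    rw [hin _ hqs]
    have hy' : y = x + q / s := by
      field_simp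
      linear_combination e1 + x * hps
    have := (hθ _ hqs).2 x hx
    rw [← hy', hyx] at this
    exact (add_left_cancel this).symm

end Linear

section Divisible
open IntermediateField
variable {k F : Type*} [Field k] [Field F] [Algebra k F]

theorem eq_of_eqOn_adjoin {S : Set F} {g h : F ≃ₐ[k] F} (hgh : ∀ s ∈ S, g s = h s) {v : F}
    (hv : v ∈ adjoin k S) : g v = h v := by
  have h1 : h⁻¹ * g ∈ fixS k S := fun s hs => by
    rw [AlgEquiv.mul_apply, hgh s hs]
    exact h.symm_apply_apply s
  rw [← fixS_adjoin] at h1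
  have h2 := congrArg h (h1 v hv)
  rwa [AlgEquiv.mul_apply, ← AlgEquiv.mul_apply, mul_inv_cancel, AlgEquiv.one_apply] at h2

theorem notMem_acl_of_pow {B : Set F} {v Q : F} {N : ℕ} (hvQ : v ^ N = Q) (hQ : Q ∉ acl k B) :
    v ∉ acl k B := fun hv => hQ (hvQ ▸ pow_mem hv N)

/-- An element that is not algebraic over `k(B)` has no roots of large order in a finitely
generated extension over which it is transversal. -/
theorem exists_bound_of_pow_eq [IsAlgClosed F] [CharZero F] {B S : Set F} (hS : S.Finite)
    {Q : F} (hQ : Q ∉ acl k B) (hSQ : S ⊆ acl k (insert Q B)) :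
    ∃ d : ℕ, ∀ N > d, ∀ v ∈ adjoin k S, v ^ N ≠ Q := by
  classical
  have hR := finite_restrict_of_orb (W := fixS k (insert Q B)) hS
    fun t ht => orb_finite_of_mem_acl (hSQ ht)
  refine ⟨((fun (g : F ≃ₐ[k] F) (t : S) => g t) '' (fixS k (insert Q B) : Set _)).ncard,
    fun N hN v hv hvN => ?_⟩
  have hN0 : N ≠ 0 := by omega
  have hQ0 : Q ≠ 0 := fun h => hQ (h ▸ zero_mem _)
  have hsep : (Polynomial.X ^ N - Polynomial.C Q).Separable :=
    Polynomial.separable_X_pow_sub_C Q (Nat.cast_ne_zero.2 hN0) hQ0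
  have hcard := Polynomial.card_rootSet_eq_natDegree (K := F) hsep (IsAlgClosed.splits _)
  rw [Polynomial.natDegree_X_pow_sub_C] at hcard
  have hp0 : (Polynomial.X ^ N - Polynomial.C Q : Polynomial F) ≠ 0 :=
    Polynomial.X_pow_sub_C_ne_zero (Nat.pos_of_ne_zero hN0) Q
  have hex : ∀ w : (Polynomial.X ^ N - Polynomial.C Q).rootSet F,
      ∃ g ∈ fixS k (insert Q B), g v = w := by
    rintro ⟨w, hw⟩
    rw [Polynomial.mem_rootSet] at hw
    have hw' : w ^ N = Q := by simpa [sub_eq_zero] using hw.2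
    obtain ⟨g, hg, hgv⟩ := exists_fixS_of_notMem_acl (notMem_acl_of_pow hvN hQ)
      (notMem_acl_of_pow hw' hQ)
    refine ⟨g, ?_, hgv⟩
    rintro s (rfl | hs)
    · rw [← hvN, map_pow, hgv, hw', hvN]
    · exact hg s (subset_acl B hs)
  choose γ hγ hγv using hex
  have := hR.to_subtype
  have hle : Nat.card ((Polynomial.X ^ N - Polynomial.C Q).rootSet F) ≤
      Nat.card ((fun (g : F ≃ₐ[k] F) (t : S) => g t) '' (fixS k (insert Q B) : Set _)) := by
    refine Nat.card_le_card_of_injective (fun w => ⟨fun t => γ w t, γ w, hγ w, rfl⟩) ?_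
    intro w w' hww
    have h1 := congrArg Subtype.val hww
    refine Subtype.ext ?_
    rw [← hγv w, ← hγv w']
    exact eq_of_eqOn_adjoin (fun s hs => congrFun h1 ⟨s, hs⟩) hv
  rw [Nat.card_eq_fintype_card, hcard] at hle
  exact absurd hle (not_le.2 hN)

theorem zpow_notMem [IsAlgClosed k] {w : F} (hw : w ∉ (⊥ : IntermediateField k F)) {N : ℤ}
    (hN : N ≠ 0) : w ^ N ∉ (⊥ : IntermediateField k F) := by
  have key : ∀ n : ℕ, n ≠ 0 → w ^ n ∉ (⊥ : IntermediateField k F) := by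
    intro n hn h
    obtain ⟨d, hd, hdw⟩ := exists_pow_eq_of_mem_bot h (Nat.pos_of_ne_zero hn)
    obtain ⟨c, hc⟩ := IntermediateField.mem_bot.1 h
    apply hw
    rw [← acl_empty, ← isAlgebraic_iff_mem_acl_empty]
    refine IsAlgebraic.of_pow (Nat.pos_of_ne_zero hn) ?_
    rw [← hc]
    exact isAlgebraic_algebraMap c
  rcases Int.eq_nat_or_neg N with ⟨n, rfl | rfl⟩
  · rw [zpow_natCast]; exact key n (by simpa using hN)
  · rw [zpow_neg, zpow_natCast]; exact IsTwist.inv_notMem (key n (by simpa using hN))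

theorem root_of_unity_mem_bot [IsAlgClosed k] {ζ : F} {N : ℕ} (hN : 0 < N) (h : ζ ^ N = 1) :
    ζ ∈ (⊥ : IntermediateField k F) := by
  by_contra hζ
  have := zpow_notMem hζ (N := N) (by omega)
  rw [zpow_natCast, h] at this
  exact this (one_mem _)

end Divisible

namespace IsLinTwist
open IntermediateField
variable {k F : Type*} [Field k] [Field F] [Algebra k F]
variable {ψ : (F ≃ₐ[k] F) ≃* (F ≃ₐ[k] F)} {φ : F → F}

theorem ne_zero (h : IsLinTwist ψ φ) {a : F} (ha : a ∉ (⊥ : IntermediateField k F)) : φ a ≠ 0 :=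
  fun h0 => h.notMem a ha (h0 ▸ zero_mem _)

theorem const_add (h : IsLinTwist ψ φ) {x : F} (hx : x ∉ (⊥ : IntermediateField k F)) {c d : F}
    (hc : c ∈ (⊥ : IntermediateField k F)) (hd : d ∈ (⊥ : IntermediateField k F)) :
    φ (c + d) = φ c + φ d := by
  have e1 := h.map_add_const x hx _ (add_mem hc hd)
  rw [← add_assoc, h.map_add_const _ (IsTwist.add_notMem hx hc) d hd,
    h.map_add_const x hx c hc] at e1
  linear_combination -e1

theorem const_zero (h : IsLinTwist ψ φ) {x : F} (hx : x ∉ (⊥ : IntermediateField k F)) :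
    φ 0 = 0 := by
  have := h.const_add hx (zero_mem _) (zero_mem _)
  simpa using this

theorem const_one (h : IsLinTwist ψ φ) {x : F} (hx : x ∉ (⊥ : IntermediateField k F)) :
    φ 1 = 1 := by
  have := h.map_const_mul x hx 1 (one_mem _)
  rw [one_mul] at this
  exact mul_right_cancel₀ (h.ne_zero hx) (by rw [← this, one_mul])

theorem const_mul (h : IsLinTwist ψ φ) {x : F} (hx : x ∉ (⊥ : IntermediateField k F)) {c d : F}
    (hc : c ∈ (⊥ : IntermediateField k F)) (hd : d ∈ (⊥ : IntermediateField k F)) :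
    φ (c * d) = φ c * φ d := by
  by_cases hd0 : d = 0
  · rw [hd0, mul_zero, h.const_zero hx, mul_zero]
  have e1 := h.map_const_mul x hx _ (mul_mem hc hd)
  rw [mul_assoc, h.map_const_mul _ (IsTwist.mul_notMem hx hd hd0) c hc,
    h.map_const_mul x hx d hd, ← mul_assoc] at e1
  exact (mul_right_cancel₀ (h.ne_zero hx) e1).symm

/-- The induced endomorphism of the constants. -/
def constHom (h : IsLinTwist ψ φ) {x : F} (hx : x ∉ (⊥ : IntermediateField k F)) :
    (⊥ : IntermediateField k F) →+* (⊥ : IntermediateField k F) where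
  toFun c := ⟨φ c, h.mem c c.2⟩
  map_one' := Subtype.ext (h.const_one hx)
  map_zero' := Subtype.ext (h.const_zero hx)
  map_mul' c d := Subtype.ext (h.const_mul hx c.2 d.2)
  map_add' c d := Subtype.ext (h.const_add hx c.2 d.2)

theorem const_zpow (h : IsLinTwist ψ φ) {x : F} (hx : x ∉ (⊥ : IntermediateField k F)) {c : F}
    (hc : c ∈ (⊥ : IntermediateField k F)) (N : ℤ) : φ (c ^ N) = φ c ^ N := by
  have := congrArg (algebraMap (⊥ : IntermediateField k F) F)
    (map_zpow₀ (h.constHom hx) ⟨c, hc⟩ N)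
  exact this.trans (map_zpow₀ _ _ _)

theorem const_natCast (h : IsLinTwist ψ φ) {x : F} (hx : x ∉ (⊥ : IntermediateField k F))
    (m : ℕ) : φ m = m := by
  have := congrArg (algebraMap (⊥ : IntermediateField k F) F) (map_natCast (h.constHom hx) m)
  exact this.trans (map_natCast _ _)

theorem const_ne_zero (h : IsLinTwist ψ φ) {x : F} (hx : x ∉ (⊥ : IntermediateField k F)) {c : F}
    (hc : c ∈ (⊥ : IntermediateField k F)) (hc0 : c ≠ 0) : φ c ≠ 0 := by
  intro h0
  have := h.map_const_mul x hx c hc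
  rw [h0, zero_mul] at this
  exact h.ne_zero (IsTwist.mul_notMem hx hc hc0) this

variable [IsAlgClosed k] [IsAlgClosed F] [CharZero F]

theorem exists_zpow (h : IsLinTwist ψ φ) {w : F} (hw : w ∉ (⊥ : IntermediateField k F)) {N : ℤ}
    (hN : N ≠ 0) : ∃ c ∈ (⊥ : IntermediateField k F), φ (w ^ N) = c * φ w ^ N := by
  set u := φ (w ^ N) / φ w ^ N with hu
  have hw0 := h.ne_zero hw
  refine ⟨u, ?_, by rw [hu, div_mul_cancel₀ _ (zpow_ne_zero N hw0)]⟩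
  by_contra hub
  have huk : u ∈ k⟮φ w⟯ := by
    refine div_mem ?_ (zpow_mem (mem_adjoin_simple_self k _) N)
    rw [h.mem_adjoin_simple hw (zpow_notMem hw hN)]
    exact zpow_mem (mem_adjoin_simple_self k _) N
  have hacl : acl k {u} = acl k {φ w} :=
    acl_eq_of_mem (adjoin_le_acl _ huk) (by rwa [acl_empty])
  have hfin := orb_finite_of_mem_acl (k := k) (S := {u}) (a := φ w)
    (by rw [hacl]; exact subset_acl _ rfl)
  refine Set.infinite_of_injective_forall_mem (f := fun m : ℕ => ((m + 1 : ℕ) : F) * φ w) ?_ ?_ hfin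
  · intro m n hmn
    have := mul_right_cancel₀ hw0 hmn
    simpa using this
  · intro m
    have hm : ((m + 1 : ℕ) : F) ∈ (⊥ : IntermediateField k F) := _root_.natCast_mem _ _
    have hm0 : ((m + 1 : ℕ) : F) ≠ 0 := Nat.cast_ne_zero.2 (Nat.succ_ne_zero m)
    obtain ⟨g, hg⟩ := exists_map_eq hw (IsTwist.mul_notMem hw hm hm0)
    have e1 : ψ g (φ w) = ((m + 1 : ℕ) : F) * φ w := by
      rw [← h.equi g w hw, hg, h.map_const_mul w hw _ hm, h.const_natCast hw]
    refine ⟨ψ g, ?_, e1⟩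
    rintro s rfl
    have e2 : ψ g (φ (w ^ N)) = ((m + 1 : ℕ) : F) ^ N * φ (w ^ N) := by
      rw [← h.equi g _ (zpow_notMem hw hN), map_zpow₀, hg, mul_zpow,
        h.map_const_mul _ (zpow_notMem hw hN) _ (zpow_mem hm N), h.const_zpow hw hm,
        h.const_natCast hw]
    rw [hu, map_div₀, map_zpow₀, e1, e2, mul_zpow, mul_div_mul_left _ _ (zpow_ne_zero N hm0)]

theorem exists_mul_aux (h : IsLinTwist ψ φ) {y z : F} (hy : y ∉ (⊥ : IntermediateField k F))
    (hz : z ∉ (⊥ : IntermediateField k F)) (hyz : y * z ∉ (⊥ : IntermediateField k F)) {N : ℕ}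
    (hN : 0 < N) : ∃ v ∈ adjoin k {φ y, φ z}, v ^ N = φ (y * z) / (φ y * φ z) := by
  obtain ⟨y₁, rfl⟩ := IsAlgClosed.exists_pow_nat_eq y hN
  obtain ⟨z₁, rfl⟩ := IsAlgClosed.exists_pow_nat_eq z hN
  have hy1 : y₁ ∉ (⊥ : IntermediateField k F) := fun h => hy (pow_mem h N)
  have hz1 : z₁ ∉ (⊥ : IntermediateField k F) := fun h => hz (pow_mem h N)
  have hyz1 : y₁ * z₁ ∉ (⊥ : IntermediateField k F) := fun h => hyz (by
    rw [← mul_pow]; exact pow_mem h N)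
  have hNz : (N : ℤ) ≠ 0 := by omega
  obtain ⟨c1, hc1, e1⟩ := h.exists_zpow hy1 hNz
  obtain ⟨c2, hc2, e2⟩ := h.exists_zpow hz1 hNz
  obtain ⟨c3, hc3, e3⟩ := h.exists_zpow hyz1 hNz
  simp only [zpow_natCast] at e1 e2 e3
  obtain ⟨c, hc, hcN⟩ := exists_pow_eq_of_mem_bot (div_mem hc3 (mul_mem hc1 hc2)) hN
  have hy0 := h.ne_zero hy1
  have hz0 := h.ne_zero hz1
  refine ⟨c * (φ (y₁ * z₁) / (φ y₁ * φ z₁)), mul_mem (bot_le (a := adjoin k _) hc) ?_, ?_⟩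
  · rw [mem_adjoin_iff_fixed]
    intro g hg
    obtain ⟨g, rfl⟩ := ψ.surjective g
    have hgy : g (y₁ ^ N) = y₁ ^ N := (h.fixed_iff g hy).1 (hg _ (by simp))
    have hgz : g (z₁ ^ N) = z₁ ^ N := (h.fixed_iff g hz).1 (hg _ (by simp))
    have root : ∀ w : F, w ∉ (⊥ : IntermediateField k F) → g (w ^ N) = w ^ N →
        ∃ ζ ∈ (⊥ : IntermediateField k F), ζ ≠ 0 ∧ g w = ζ * w := by
      intro w hw hgw
      have hw0 : w ≠ 0 := fun h0 => hw (h0 ▸ zero_mem _)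
      refine ⟨g w / w, root_of_unity_mem_bot hN ?_, ?_, by rw [div_mul_cancel₀ _ hw0]⟩
      · rw [div_pow, ← map_pow, hgw, div_self (pow_ne_zero N hw0)]
      · exact div_ne_zero (by simpa using hw0) hw0
    obtain ⟨ζ, hζ, hζ0, eζ⟩ := root y₁ hy1 hgy
    obtain ⟨ξ, hξ, hξ0, eξ⟩ := root z₁ hz1 hgz
    rw [map_div₀, map_mul, ← h.equi g _ hy1, ← h.equi g _ hz1, ← h.equi g _ hyz1, map_mul, eζ, eξ,
      show ζ * y₁ * (ξ * z₁) = ζ * ξ * (y₁ * z₁) by ring, h.map_const_mul _ hy1 _ hζ,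
      h.map_const_mul _ hz1 _ hξ, h.map_const_mul _ hyz1 _ (mul_mem hζ hξ),
      h.const_mul hy1 hζ hξ]
    have h1 := h.const_ne_zero hy1 hζ hζ0
    have h2 := h.const_ne_zero hy1 hξ hξ0
    field_simp
  · rw [mul_pow, hcN, ← mul_pow, e1, e2, e3, div_pow, mul_pow]
    field_simp

theorem exists_mul (h : IsLinTwist ψ φ) {y z : F} (hy : y ∉ (⊥ : IntermediateField k F))
    (hz : z ∉ (⊥ : IntermediateField k F)) (hyz : y * z ∉ (⊥ : IntermediateField k F)) :
    ∃ c ∈ (⊥ : IntermediateField k F), φ (y * z) = c * (φ y * φ z) := by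
  have hy0 := h.ne_zero hy
  have hz0 := h.ne_zero hz
  set Q := φ (y * z) / (φ y * φ z) with hQ
  refine ⟨Q, ?_, by rw [hQ, div_mul_cancel₀ _ (mul_ne_zero hy0 hz0)]⟩
  by_contra hQb
  have hQS : Q ∈ acl k {φ y, φ z} := by
    obtain ⟨v, hv, hv1⟩ := h.exists_mul_aux hy hz hyz one_pos
    rw [pow_one] at hv1
    rw [hQ, ← hv1]
    exact adjoin_le_acl _ hv
  have hB : ∃ B : Set F, Q ∉ acl k B ∧ ({φ y, φ z} : Set F) ⊆ acl k (insert Q B) := by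
    have hQe : Q ∉ acl k (∅ : Set F) := by rwa [acl_empty]
    have key : ∀ s t : F, Q ∈ acl k {s, t} → s ∉ acl k {Q} → Q ∉ acl k {s} ∧
        ({s, t} : Set F) ⊆ acl k (insert Q {s}) := by
      intro s t hst hs
      have h1 : Q ∉ acl k {s} := fun h1 => hs (by
        rw [acl_eq_of_mem h1 hQe]; exact subset_acl _ rfl)
      refine ⟨h1, ?_⟩
      rintro u (rfl | rfl)
      · exact subset_acl _ (by simp)
      · exact acl_exchange (by rwa [Set.pair_comm]) h1
    by_cases hs : φ y ∈ acl k {Q}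
    · by_cases ht : φ z ∈ acl k {Q}
      · refine ⟨∅, hQe, ?_⟩
        rintro u (rfl | rfl)
        · simpa using hs
        · simpa using ht
      · have := key (φ z) (φ y) (by rwa [Set.pair_comm]) ht
        exact ⟨_, this.1, by rw [Set.pair_comm]; exact this.2⟩
    · have := key (φ y) (φ z) hQS hs
      exact ⟨_, this⟩
  obtain ⟨B, hB1, hB2⟩ := hB
  obtain ⟨d, hd⟩ := exists_bound_of_pow_eq (Set.toFinite _) hB1 hB2
  obtain ⟨v, hv, hvN⟩ := h.exists_mul_aux hy hz hyz (Nat.succ_pos d)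
  exact hd _ (Nat.lt_succ_self d) v hv hvN

end IsLinTwist

namespace IsLinTwist
open IntermediateField
variable {k F : Type*} [Field k] [Field F] [Algebra k F]
variable {ψ : (F ≃ₐ[k] F) ≃* (F ≃ₐ[k] F)} {φ : F → F}

theorem map_add_of_affine (h : IsLinTwist ψ φ) {y z : F} (hy : y ∉ (⊥ : IntermediateField k F))
    (hz : z ∉ (⊥ : IntermediateField k F)) (hyz : y + z ∉ (⊥ : IntermediateField k F))
    {α β : F} (hα : α ∈ (⊥ : IntermediateField k F)) (hβ : β ∈ (⊥ : IntermediateField k F))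
    (e : φ z = α * φ y + β) : φ (y + z) = φ y + φ z := by
  obtain ⟨α, hα', rfl⟩ := h.surj_const α hα
  obtain ⟨β, hβ', rfl⟩ := h.surj_const β hβ
  have hα0 : α ≠ 0 := by
    rintro rfl
    rw [h.const_zero hy, zero_mul, zero_add] at e
    exact h.notMem z hz (e ▸ hβ)
  have hαy := IsTwist.mul_notMem hy hα' hα0
  have e1 : z = α * y + β := by
    refine h.inj _ hz _ (IsTwist.add_notMem hαy hβ') ?_
    rw [e, h.map_add_const _ hαy _ hβ', h.map_const_mul _ hy _ hα']
  have h1α : 1 + α ≠ 0 := by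
    intro h0
    refine hyz ?_
    rw [e1, show y + (α * y + β) = (1 + α) * y + β by ring, h0, zero_mul, zero_add]
    exact hβ'
  rw [e, e1, show y + (α * y + β) = (1 + α) * y + β by ring,
    h.map_add_const _ (IsTwist.mul_notMem hy (add_mem (one_mem _) hα') h1α) _ hβ',
    h.map_const_mul _ hy _ (add_mem (one_mem _) hα'), h.const_add hy (one_mem _) hα',
    h.const_one hy]
  ring

variable [IsAlgClosed k] [IsAlgClosed F] [CharZero F]

theorem exists_map_add (h : IsLinTwist ψ φ) {y z : F} (hy : y ∉ (⊥ : IntermediateField k F))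
    (hz : z ∉ (⊥ : IntermediateField k F)) (hyz : y + z ∉ (⊥ : IntermediateField k F))
    (hne : ∀ α ∈ (⊥ : IntermediateField k F), ∀ β ∈ (⊥ : IntermediateField k F),
      φ z ≠ α * φ y + β) :
    ∃ A ∈ (⊥ : IntermediateField k F), ∃ B ∈ (⊥ : IntermediateField k F),
      φ (y + z) = A * φ y + B * φ z := by
  have hy0 : y ≠ 0 := fun h0 => hy (h0 ▸ zero_mem _)
  set w := z / y with hw
  have ez : z = y * w := by rw [hw, mul_div_cancel₀ _ hy0]
  have hwb : w ∉ (⊥ : IntermediateField k F) := by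
    intro hwb
    refine hne (φ w) (h.mem w hwb) 0 (zero_mem _) ?_
    rw [add_zero, ← h.map_const_mul _ hy _ hwb, mul_comm w, ← ez]
  have hw1 : w + 1 ∉ (⊥ : IntermediateField k F) := IsTwist.add_notMem hwb (one_mem _)
  have es : y + z = y * (w + 1) := by rw [ez]; ring
  obtain ⟨c, hc, ec⟩ := h.exists_mul hy hw1 (es ▸ hyz)
  obtain ⟨d, hd, ed⟩ := h.exists_mul hy hwb (ez ▸ hz)
  rw [← ez] at ed
  rw [← es, h.map_add_const _ hwb _ (one_mem _), h.const_one hy] at ec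
  have hd0 : d ≠ 0 := by
    rintro rfl
    exact h.ne_zero hz (by simpa using ed)
  refine ⟨c, hc, c / d, div_mem hc hd, ?_⟩
  rw [ec, ed]
  field_simp
  ring

theorem map_add_of_notMem (h : IsLinTwist ψ φ) {y z : F} (hy : y ∉ (⊥ : IntermediateField k F))
    (hz : z ∉ (⊥ : IntermediateField k F)) (hyz : y + z ∉ (⊥ : IntermediateField k F)) :
    φ (y + z) = φ y + φ z := by
  by_cases hne : ∀ α ∈ (⊥ : IntermediateField k F), ∀ β ∈ (⊥ : IntermediateField k F),
      φ z ≠ α * φ y + β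
  · have indep : ∀ A ∈ (⊥ : IntermediateField k F), ∀ B ∈ (⊥ : IntermediateField k F),
        ∀ C ∈ (⊥ : IntermediateField k F), A * φ y + B * φ z = C → A = 0 ∧ B = 0 ∧ C = 0 := by
      intro A hA B hB C hC e
      have hB0 : B = 0 := by
        by_contra hB0
        refine hne (-A / B) (div_mem (neg_mem hA) hB) (C / B) (div_mem hC hB) ?_
        field_simp
        linear_combination e
      subst hB0
      have hA0 : A = 0 := by
        by_contra hA0
        refine h.notMem y hy ?_
        have : φ y = C / A := by
          field_simp
          linear_combination e
        rw [this]
        exact div_mem hC hA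
      subst hA0
      exact ⟨rfl, rfl, by simpa using e.symm⟩
    have ey := h.map_add_const y hy 1 (one_mem _)
    have ez := h.map_add_const z hz 1 (one_mem _)
    have es := h.map_add_const _ hyz 1 (one_mem _)
    have hs := IsTwist.add_notMem hyz (one_mem _)
    rw [h.const_one hy] at ey ez es
    obtain ⟨A, hA, B, hB, e⟩ := h.exists_map_add hy hz hyz hne
    obtain ⟨A', hA', B', hB', e'⟩ := h.exists_map_add (y := y + 1) (z := z)
      (IsTwist.add_notMem hy (one_mem _)) hz (by
        rw [show y + 1 + z = y + z + 1 by ring]; exact hs) (by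
        intro α hα β hβ e'
        refine hne α hα (α + β) (add_mem hα hβ) ?_
        rw [e', ey]; ring)
    obtain ⟨A'', hA'', B'', hB'', e''⟩ := h.exists_map_add (y := y) (z := z + 1)
      hy (IsTwist.add_notMem hz (one_mem _)) (by
        rw [← add_assoc]; exact hs) (by
        intro α hα β hβ e'
        refine hne α hα (β - 1) (sub_mem hβ (one_mem _)) ?_
        rw [ez] at e'
        linear_combination e')
    rw [show y + 1 + z = y + z + 1 by ring, es, ey, e] at e'
    rw [← add_assoc, es, ez, e] at e''
    obtain ⟨h1, h2, h3⟩ := indep (A - A') (sub_mem hA hA') (B - B') (sub_mem hB hB') (A' - 1)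
      (sub_mem hA' (one_mem _)) (by linear_combination e')
    obtain ⟨h4, h5, h6⟩ := indep (A - A'') (sub_mem hA hA'') (B - B'') (sub_mem hB hB'') (B'' - 1)
      (sub_mem hB'' (one_mem _)) (by linear_combination e'')
    rw [e, show A = 1 by linear_combination h1 + h3, show B = 1 by linear_combination h5 + h6,
      one_mul, one_mul]
  · push Not at hne
    obtain ⟨α, hα, β, hβ, e⟩ := hne
    exact h.map_add_of_affine hy hz hyz hα hβ e

theorem map_add (h : IsLinTwist ψ φ) {x : F} (hx : x ∉ (⊥ : IntermediateField k F)) (y z : F) :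
    φ (y + z) = φ y + φ z := by
  by_cases hy : y ∈ (⊥ : IntermediateField k F)
  · by_cases hz : z ∈ (⊥ : IntermediateField k F)
    · exact h.const_add hx hy hz
    · rw [add_comm, h.map_add_const z hz y hy, add_comm]
  by_cases hz : z ∈ (⊥ : IntermediateField k F)
  · exact h.map_add_const y hy z hz
  by_cases hyz : y + z ∈ (⊥ : IntermediateField k F)
  · have e1 := h.map_add_const (-1 * y) (IsTwist.mul_notMem hy (neg_mem (one_mem _))
      (neg_ne_zero.2 one_ne_zero)) _ hyz
    have e2 := h.map_const_mul y hy (-1) (neg_mem (one_mem _))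
    have e3 := h.const_add hx (one_mem _) (neg_mem (one_mem _))
    rw [add_neg_cancel, h.const_zero hx, h.const_one hx] at e3
    rw [show -1 * y + (y + z) = z by ring, e2] at e1
    linear_combination -e1 + e3 * φ y
  · exact h.map_add_of_notMem hy hz hyz

theorem map_mul_of_notMem (h : IsLinTwist ψ φ) {y z : F} (hy : y ∉ (⊥ : IntermediateField k F))
    (hz : z ∉ (⊥ : IntermediateField k F)) (hyz : y * z ∉ (⊥ : IntermediateField k F)) :
    φ (y * z) = φ y * φ z := by
  obtain ⟨b, hb, hb0, hbz⟩ : ∃ b ∈ (⊥ : IntermediateField k F), b ≠ 0 ∧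
      (y + b) * z ∉ (⊥ : IntermediateField k F) := by
    by_cases h1 : (y + 1) * z ∈ (⊥ : IntermediateField k F)
    · refine ⟨2, ofNat_mem _ 2, two_ne_zero, fun h2 => hz ?_⟩
      have := sub_mem h2 h1
      rwa [show (y + 2) * z - (y + 1) * z = z by ring] at this
    · exact ⟨1, one_mem _, one_ne_zero, h1⟩
  obtain ⟨c, hc, ec⟩ := h.exists_mul hy hz hyz
  obtain ⟨d, hd, ed⟩ := h.exists_mul (IsTwist.add_notMem hy hb) hz hbz
  rw [add_mul, h.map_add hy, h.map_const_mul z hz b hb, ec, h.map_add hy] at ed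
  have hz0 := h.ne_zero hz
  have e : c * φ y + φ b = d * φ y + d * φ b := by
    refine mul_right_cancel₀ hz0 ?_
    linear_combination ed
  have hcd : c = d := by
    by_contra hcd
    have hcd' := sub_ne_zero.2 hcd
    refine h.notMem y hy ?_
    have : φ y = (d - 1) * φ b / (c - d) := by
      field_simp
      linear_combination e
    rw [this]
    exact div_mem (mul_mem (sub_mem hd (one_mem _)) (h.mem b hb)) (sub_mem hc hd)
  have hb0' := h.const_ne_zero hy hb hb0
  have hc1 : c = 1 := by
    refine mul_right_cancel₀ hb0' ?_
    subst hcd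
    linear_combination -e
  rw [ec, hc1, one_mul]

theorem map_inv (h : IsLinTwist ψ φ) {y : F} (hy : y ∉ (⊥ : IntermediateField k F)) :
    φ y⁻¹ = (φ y)⁻¹ := by
  have hy0 : y ≠ 0 := fun h0 => hy (h0 ▸ zero_mem _)
  have hyy : y * y ∉ (⊥ : IntermediateField k F) := by
    have := zpow_notMem hy (N := 2) (by norm_num)
    rwa [zpow_ofNat, sq] at this
  have e1 : y * y * y⁻¹ = y := by field_simp
  have e := h.map_mul_of_notMem hyy (IsTwist.inv_notMem hy) (by rwa [e1])
  rw [e1, h.map_mul_of_notMem hy hy hyy] at e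
  have := h.ne_zero hy
  refine eq_inv_of_mul_eq_one_left (mul_right_cancel₀ this ?_)
  linear_combination -e

theorem map_mul (h : IsLinTwist ψ φ) {x : F} (hx : x ∉ (⊥ : IntermediateField k F)) (y z : F) :
    φ (y * z) = φ y * φ z := by
  by_cases hy : y ∈ (⊥ : IntermediateField k F)
  · by_cases hz : z ∈ (⊥ : IntermediateField k F)
    · exact h.const_mul hx hy hz
    · exact h.map_const_mul z hz y hy
  by_cases hz : z ∈ (⊥ : IntermediateField k F)
  · rw [mul_comm, h.map_const_mul y hy z hz, mul_comm]
  by_cases hyz : y * z ∈ (⊥ : IntermediateField k F)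
  · have hy0 : y ≠ 0 := fun h0 => hy (h0 ▸ zero_mem _)
    have e := h.map_const_mul _ (IsTwist.inv_notMem hy) _ hyz
    rw [show y * z * y⁻¹ = z by field_simp, h.map_inv hy] at e
    have := h.ne_zero hy
    rw [e]
    field_simp
  · exact h.map_mul_of_notMem hy hz hyz

/-- A linear twist is a field automorphism. -/
theorem exists_ringEquiv (h : IsLinTwist ψ φ) {x : F} (hx : x ∉ (⊥ : IntermediateField k F)) :
    ∃ e : F ≃+* F, (∀ a, a ∈ (⊥ : IntermediateField k F) ↔ e a ∈ (⊥ : IntermediateField k F)) ∧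
      ∀ g : F ≃ₐ[k] F, ∀ a, e (g a) = ψ g (e a) := by
  let f : F →+* F :=
    { toFun := φ
      map_one' := h.const_one hx
      map_zero' := h.const_zero hx
      map_mul' := h.map_mul hx
      map_add' := h.map_add hx }
  have hsurj : Function.Surjective f := by
    intro b
    by_cases hb : b ∈ (⊥ : IntermediateField k F)
    · obtain ⟨a, -, e⟩ := h.surj_const b hb
      exact ⟨a, e⟩
    · obtain ⟨a, -, e⟩ := h.surj b hb
      exact ⟨a, e⟩
  refine ⟨RingEquiv.ofBijective f ⟨f.injective, hsurj⟩, fun a => ?_, fun g a => ?_⟩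
  · change _ ↔ φ a ∈ _
    exact ⟨h.mem a, fun ha => by_contra fun ha' => h.notMem a ha' ha⟩
  · change φ (g a) = ψ g (φ a)
    by_cases ha : a ∈ (⊥ : IntermediateField k F)
    · rw [map_mem_bot g ha, map_mem_bot (ψ g) (h.mem a ha)]
    · exact h.equi g a ha

end IsLinTwist

open IntermediateField in
/-- An automorphism of `Aut(F/k)` matching the stabilizers of two transcendental elements is
conjugation by a field automorphism preserving `k`. -/
theorem exists_ringEquiv_of_stabilizer {k F : Type*} [Field k] [Field F] [Algebra k F]
    [IsAlgClosed k] [IsAlgClosed F] [CharZero F] {ψ : (F ≃ₐ[k] F) ≃* (F ≃ₐ[k] F)}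
    {x x' : F} (hx : x ∉ (⊥ : IntermediateField k F)) (hx' : x' ∉ (⊥ : IntermediateField k F))
    (h : ∀ g : F ≃ₐ[k] F, g x = x ↔ ψ g x' = x') :
    ∃ e : F ≃+* F, (∀ a, a ∈ (⊥ : IntermediateField k F) ↔ e a ∈ (⊥ : IntermediateField k F)) ∧
      ∀ g : F ≃ₐ[k] F, ∀ a, e (g a) = ψ g (e a) := by
  obtain ⟨φ, hφ⟩ := exists_isTwist hx hx' h
  obtain ⟨φ', hφ'⟩ := hφ.exists_isLinTwist hx
  exact hφ'.exists_ringEquiv hx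

open IntermediateField in
/-- Only the identity commutes with all of `Aut(F/k)`. -/
theorem eq_self_of_commute {k F : Type*} [Field k] [Field F] [Algebra k F]
    [IsAlgClosed k] [IsAlgClosed F] [CharZero F] {x : F} (hx : x ∉ (⊥ : IntermediateField k F))
    (e : F ≃+* F) (he : ∀ (g : F ≃ₐ[k] F) (a : F), e (g a) = g (e a)) (a : F) : e a = a := by
  have key : ∀ a ∉ (⊥ : IntermediateField k F), ∃ q ∈ (⊥ : IntermediateField k F),
      e a = a + q := by
    intro a ha
    have h1 : e a ∈ k⟮a⟯ := by
      rw [mem_adjoin_iff_fixed]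
      intro g hg
      rw [← he, hg a rfl]
    have h2 : a ∈ k⟮e a⟯ := by
      rw [mem_adjoin_iff_fixed]
      intro g hg
      refine e.injective ?_
      rw [he, hg _ rfl]
    obtain ⟨p, hp, q, hq, r, hr, s, hs, hdet, H⟩ := exists_mobius ha h1 h2
    obtain ⟨g, hg⟩ := exists_map_eq ha (IsTwist.add_notMem ha (one_mem _))
    have H' := congrArg g H
    simp only [map_mul, map_add, map_mem_bot _ hp, map_mem_bot _ hq, map_mem_bot _ hr,
      map_mem_bot _ hs, ← he, hg, map_one] at H'
    obtain ⟨rfl, hs0, hps⟩ := IsTwist.eq_add_of_commute ha hp hq hr hs hdet (one_mem _)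
      one_ne_zero H H'
    refine ⟨q / s, div_mem hq hs, ?_⟩
    field_simp
    linear_combination H + a * hps
  have key' : ∀ a ∉ (⊥ : IntermediateField k F), e a = a := by
    intro a ha
    obtain ⟨q, hq, eq⟩ := key a ha
    have ha2 : a ^ 2 ∉ (⊥ : IntermediateField k F) := by
      have := zpow_notMem ha (N := 2) (by norm_num)
      rwa [zpow_ofNat] at this
    obtain ⟨q', hq', eq'⟩ := key _ ha2
    rw [map_pow, eq] at eq'
    have hq0 : q = 0 := by
      by_contra hq0
      refine ha ?_
      have : a = (q' - q ^ 2) / (2 * q) := by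
        field_simp
        linear_combination eq'
      rw [this]
      exact div_mem (sub_mem hq' (pow_mem hq 2)) (mul_mem (ofNat_mem _ 2) hq)
    rw [eq, hq0, add_zero]
  by_cases ha : a ∈ (⊥ : IntermediateField k F)
  · have h1 := key' _ (IsTwist.add_notMem hx ha)
    rw [map_add, key' x hx] at h1
    exact add_left_cancel h1
  · exact key' a ha

section Bases
open IntermediateField
variable {k F : Type*} [Field k] [Field F] [Algebra k F]

theorem mem_acl_over (L : IntermediateField k F) {S : Set F} {a : F} :
    a ∈ acl L S ↔ a ∈ acl k (L ∪ S : Set F) := by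
  rw [mem_acl, mem_acl, ← restrictScalars_adjoin]
  exact Iff.rfl

theorem algebraicIndependent_iff_acl {ι : Type*} {z : ι → F} :
    AlgebraicIndependent k z ↔ ∀ i, z i ∉ acl k (z '' {i}ᶜ) := by
  constructor
  · intro h i hi
    rw [mem_acl'] at hi
    exact ((AlgebraicIndependent.iff_transcendental_adjoin_image i).1 h).2 hi
  · intro h
    have hinj : Function.Injective z := by
      intro i j hij
      by_contra hne
      refine h i (subset_acl _ ⟨j, fun h => hne h.symm, hij.symm⟩)
    rw [← algebraicIndependent_subtype_range hinj]
    change (AlgebraicIndependent.matroid k F).Indep (Set.range z)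
    rw [Matroid.indep_iff_forall_notMem_closure_sdiff']
    refine ⟨Set.subset_univ _, ?_⟩
    rintro _ ⟨i, rfl⟩
    rw [← coe_acl]
    have : Set.range z \ {z i} = z '' {i}ᶜ := by
      rw [Set.image_compl_eq_range_sdiff_image hinj, Set.image_singleton]
    rw [this]
    exact h i

variable (k) in
/-- Algebraic independence over the subfield generated by a set, in terms of closures. -/
def IndepOver {ι : Type*} (S : Set F) (z : ι → F) : Prop :=
  ∀ i, z i ∉ acl k (S ∪ z '' {i}ᶜ)

theorem isTranscendenceBasis_iff_acl {ι : Type*} {z : ι → F} :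
    IsTranscendenceBasis k z ↔ (∀ i, z i ∉ acl k (z '' {i}ᶜ)) ∧ acl k (Set.range z) = ⊤ := by
  rw [isTranscendenceBasis_iff_algebraicIndependent_isAlgebraic, algebraicIndependent_iff_acl]
  refine and_congr_right fun _ => ?_
  rw [Algebra.isAlgebraic_def, eq_top_iff]
  exact ⟨fun h a _ => mem_acl'.2 (h a), fun h a => mem_acl'.1 (h (mem_top))⟩

theorem isTranscendenceBasis_over_iff {ι : Type*} (L : IntermediateField k F) {z : ι → F} :
    IsTranscendenceBasis L z ↔ IndepOver k (L : Set F) z ∧ acl k (L ∪ Set.range z : Set F) = ⊤ := by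
  rw [isTranscendenceBasis_iff_acl]
  refine and_congr (forall_congr' fun i => not_congr (mem_acl_over L)) ?_
  rw [eq_top_iff, eq_top_iff]
  exact ⟨fun h a _ => (mem_acl_over L).1 (h mem_top), fun h a _ => (mem_acl_over L).2 (h mem_top)⟩

theorem acl_union_acl_left (S T : Set F) : acl k (acl k S ∪ T : Set F) = acl k (S ∪ T) := by
  refine le_antisymm (acl_le_of_subset ?_) (acl_mono (Set.union_subset_union_left T (subset_acl S)))
  exact Set.union_subset (acl_mono Set.subset_union_left)
    (Set.subset_union_right.trans (subset_acl _))

theorem IndepOver.map {ι : Type*} {S : Set F} {z : ι → F} (h : IndepOver k S z) (g : F ≃ₐ[k] F) :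
    IndepOver k (g '' S) (fun i => g (z i)) := by
  intro i hi
  rw [show (fun i => g (z i)) '' {i}ᶜ = g '' (z '' {i}ᶜ) by rw [Set.image_image],
    ← Set.image_union, map_mem_acl_iff] at hi
  exact h i hi

theorem acl_image (g : F ≃ₐ[k] F) (S : Set F) :
    (acl k (g '' S) : Set F) = g '' (acl k S : Set F) := by
  ext a
  constructor
  · intro ha
    refine ⟨g.symm a, ?_, g.apply_symm_apply a⟩
    rw [SetLike.mem_coe, ← map_mem_acl_iff g, g.apply_symm_apply]
    exact ha
  · rintro ⟨b, hb, rfl⟩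
    exact map_mem_acl g hb

/-- Two algebraically independent families completing `L` are exchanged over `L`. -/
theorem exists_fixS_of_indepOver [IsAlgClosed F] {ι : Type*} (L : IntermediateField k F)
    {z w : ι → F} (hz : IndepOver k (L : Set F) z) (hz' : acl k (L ∪ Set.range z : Set F) = ⊤)
    (hw : IndepOver k (L : Set F) w) (hw' : acl k (L ∪ Set.range w : Set F) = ⊤) :
    ∃ g ∈ fixS k (L : Set F), ∀ i, g (z i) = w i :=
  exists_fixS_of_basis L ((isTranscendenceBasis_over_iff L).2 ⟨hz, hz'⟩)
    ((isTranscendenceBasis_over_iff L).2 ⟨hw, hw'⟩)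

variable (k) in
theorem exists_basis_over (L : IntermediateField k F) : ∃ s : Set F,
    IndepOver k (L : Set F) (fun i : s => (i : F)) ∧ acl k (L ∪ s : Set F) = ⊤ := by
  obtain ⟨s, hs⟩ := exists_isTranscendenceBasis L F
  rw [isTranscendenceBasis_over_iff, Subtype.range_coe] at hs
  exact ⟨s, hs⟩

end Bases

section Orbit
open IntermediateField Polynomial
variable {k F : Type*} [Field k] [Field F] [Algebra k F]

theorem mem_fixedField' {P : Subgroup (F ≃ₐ[k] F)} {a : F} :
    a ∈ fixedField P ↔ ∀ g ∈ P, g a = a := by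
  rw [IntermediateField.mem_fixedField_iff]

theorem map_mem_orb {P : Subgroup (F ≃ₐ[k] F)} {a b : F} {g : F ≃ₐ[k] F} (hg : g ∈ P) :
    g b ∈ orb P a ↔ b ∈ orb P a := by
  constructor
  · rintro ⟨h, hh, e⟩
    exact ⟨g⁻¹ * h, P.mul_mem (P.inv_mem hg) hh, by
      have e' : h a = g b := e
      change (g⁻¹ * h) a = b
      rw [AlgEquiv.mul_apply, e']
      exact g.symm_apply_apply b⟩
  · rintro ⟨h, hh, rfl⟩
    exact ⟨g * h, P.mul_mem hg hh, rfl⟩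

/-- The monic polynomial whose roots are a finite orbit. -/
noncomputable def orbPoly {P : Subgroup (F ≃ₐ[k] F)} {a : F} (h : (orb P a).Finite) : F[X] :=
  ∏ o ∈ h.toFinset, (X - C o)

variable {P : Subgroup (F ≃ₐ[k] F)} {a : F}

theorem orbPoly_monic (h : (orb P a).Finite) : (orbPoly h).Monic :=
  monic_prod_of_monic _ _ fun o _ => monic_X_sub_C o

theorem isRoot_orbPoly (h : (orb P a).Finite) {b : F} : (orbPoly h).IsRoot b ↔ b ∈ orb P a := by
  rw [orbPoly, Polynomial.IsRoot, eval_prod, Finset.prod_eq_zero_iff]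
  simp [sub_eq_zero]

theorem map_orbPoly (h : (orb P a).Finite) {g : F ≃ₐ[k] F} (hg : g ∈ P) :
    (orbPoly h).map (g : F →+* F) = orbPoly h := by
  classical
  rw [orbPoly, Polynomial.map_prod]
  refine Finset.prod_bij (fun o _ => g o) ?_ (fun o _ o' _ e => g.injective e) ?_ ?_
  · intro o ho
    simpa [map_mem_orb hg] using ho
  · intro b hb
    refine ⟨g⁻¹ b, ?_, g.apply_symm_apply b⟩
    rw [Set.Finite.mem_toFinset] at hb ⊢
    rwa [map_mem_orb (P.inv_mem hg)]
  · intro o _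
    simp

theorem coeff_orbPoly_mem (h : (orb P a).Finite) (i : ℕ) :
    (orbPoly h).coeff i ∈ fixedField P := by
  rw [mem_fixedField']
  intro g hg
  have := congrArg (fun p => p.coeff i) (map_orbPoly h hg)
  simpa using this

theorem coeff_orbPoly_mem_of_subset (h : (orb P a).Finite) {L : IntermediateField k F}
    (hL : orb P a ⊆ L) (i : ℕ) : (orbPoly h).coeff i ∈ L := by
  have : orbPoly h ∈ Polynomial.lifts (algebraMap L F) := by
    rw [orbPoly]
    refine prod_mem fun o ho => ?_
    have ho' : o ∈ L := hL (h.mem_toFinset.1 ho)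
    exact (Polynomial.mem_lifts _).2 ⟨X - C ⟨o, ho'⟩, by simp⟩
  rw [Polynomial.lifts_iff_coeff_lifts] at this
  obtain ⟨c, hc⟩ := this i
  rw [← hc]
  exact c.2

/-- A finite orbit of a transcendental element yields a transcendental invariant. -/
theorem exists_fixed_of_orb_finite [IsAlgClosed k] (h : (orb P a).Finite)
    (ha : a ∉ (⊥ : IntermediateField k F)) {L : IntermediateField k F} (hL : orb P a ⊆ L) :
    ∃ y ∈ L, y ∉ (⊥ : IntermediateField k F) ∧ y ∈ fixedField P := by
  by_contra! hcon
  refine ha ?_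
  rw [← acl_empty]
  refine mem_acl_of_root (orbPoly_monic h).ne_zero (fun i => ?_)
    ((isRoot_orbPoly h).2 (self_mem_orb P a))
  by_contra hi
  rw [acl_empty] at hi
  exact hcon _ (coeff_orbPoly_mem_of_subset h hL i) hi (coeff_orbPoly_mem h i)

/-- A group containing the stabilizer of `x`, with finite orbit on `x`, is the stabilizer of its
fixed field. -/
theorem mem_of_fixedField {x : F} (h : (orb P x).Finite) (hx : fixS k {x} ≤ P) {g : F ≃ₐ[k] F}
    (hg : ∀ b ∈ fixedField P, g b = b) : g ∈ P := by
  have hmap : (orbPoly h).map (g : F →+* F) = orbPoly h := by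
    ext i
    rw [coeff_map]
    exact hg _ (coeff_orbPoly_mem h i)
  have h1 : (orbPoly h).IsRoot (g x) := by
    have h2 := (isRoot_orbPoly h).2 (self_mem_orb P x)
    rw [← hmap]
    exact h2.map (f := (g : F →+* F))
  obtain ⟨q, hq, e⟩ := (isRoot_orbPoly h).1 h1
  have h3 : q⁻¹ * g ∈ P := hx (by
    rintro s rfl
    rw [AlgEquiv.mul_apply, ← e]
    exact q.symm_apply_apply s)
  simpa using P.mul_mem hq h3

theorem fixed_acl_iff [IsAlgClosed F] [CharZero F] {S : Set F} {b : F} :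
    (∀ g ∈ fixS k (acl k S : Set F), g b = b) ↔ b ∈ acl k S := by
  rw [← mem_adjoin_iff_fixed, IntermediateField.adjoin_self]

end Orbit

section Stabilizer
open IntermediateField
variable {k F : Type*} [Field k] [Field F] [Algebra k F]

theorem image_acl_of_stable {S : Set F} {g : F ≃ₐ[k] F} (h : g '' S = S) :
    g '' (acl k S : Set F) = acl k S := by
  rw [← acl_image, h]

variable [IsAlgClosed F]

/-- The stabilizer of `x` is generated by that of `acl(x)` and a subgroup with finite orbits. -/
theorem exists_TB_complement (x : F) : ∃ W : Subgroup (F ≃ₐ[k] F), TB W ∧ W ≤ fixS k {x} ∧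
    ∀ g ∈ fixS k {x}, ∃ n ∈ fixS k (acl k {x} : Set F), n * g ∈ W := by
  obtain ⟨s, hs, hs'⟩ := exists_basis_over k (acl k {x})
  refine ⟨fixS k ({x} ∪ s), ?_, fixS_anti Set.subset_union_left, ?_⟩
  · refine TB_fixS ?_
    rw [← acl_union_acl_left, hs']
  · intro g hg
    have hgx : g '' {x} = {x} := by rw [Set.image_singleton, hg x rfl]
    have hgE := image_acl_of_stable (k := k) hgx
    have h1 := hs.map g
    rw [hgE] at h1
    have h2 : acl k (acl k {x} ∪ Set.range fun i : s => g i : Set F) = ⊤ := by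
      have : (acl k {x} ∪ Set.range fun i : s => g i : Set F) = g '' (acl k {x} ∪ s) := by
        rw [Set.image_union, hgE]
        congr 1
        ext a
        simp
      rw [this]
      refine SetLike.coe_injective ?_
      rw [acl_image, hs']
      simp
    obtain ⟨n, hn, hnz⟩ := exists_fixS_of_indepOver _ h1 h2 hs (by rwa [Subtype.range_coe])
    refine ⟨n, hn, ?_⟩
    rintro a (rfl | ha)
    · rw [AlgEquiv.mul_apply, hg a rfl]
      exact hn a (subset_acl _ rfl)
    · exact hnz ⟨a, ha⟩

variable [CharZero F]

/-- If `ψ` carries the stabilizer of `acl(x)` to that of `acl(f)`, then the image of the stabilizer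
of `x` has a finite orbit on `f`, contained in `acl(f)`. -/
theorem orb_map_fixS {ψ : (F ≃ₐ[k] F) ≃* (F ≃ₐ[k] F)} (hψ : NbhdCont ψ) {x f : F}
    (h : ∀ g, g ∈ fixS k (acl k {x} : Set F) ↔ ψ g ∈ fixS k (acl k {f} : Set F)) :
    (orb ((fixS k {x}).map ψ.toMonoidHom) f).Finite ∧
      orb ((fixS k {x}).map ψ.toMonoidHom) f ⊆ acl k {f} := by
  obtain ⟨W, hW, hWx, hWn⟩ := exists_TB_complement (k := k) x
  have hstab : ∀ g ∈ fixS k {x}, ψ g f ∈ acl k {f} := by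
    intro g hg
    rw [← fixed_acl_iff]
    intro n hn
    obtain ⟨n, rfl⟩ := ψ.surjective n
    rw [← h] at hn
    have h1 : g⁻¹ * n * g ∈ fixS k (acl k {x} : Set F) := by
      intro a ha
      have hgE := image_acl_of_stable (k := k)
        (show g '' {x} = {x} by rw [Set.image_singleton, hg x rfl])
      have hga : g a ∈ (acl k {x} : Set F) := by rw [← hgE]; exact ⟨a, ha, rfl⟩
      rw [AlgEquiv.mul_apply, AlgEquiv.mul_apply, hn _ hga]
      exact g.symm_apply_apply a
    rw [h] at h1
    have h2 := congrArg (ψ g) (h1 f (subset_acl _ rfl))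
    rw [← AlgEquiv.mul_apply, ← map_mul, mul_assoc, mul_inv_cancel_left, map_mul] at h2
    exact h2
  constructor
  · refine ((hW.map hψ) f).subset ?_
    rintro _ ⟨_, ⟨g, hg, rfl⟩, rfl⟩
    obtain ⟨n, hn, hng⟩ := hWn g hg
    refine ⟨_, ⟨n * g, hng, rfl⟩, ?_⟩
    have := hstab g hg
    change ψ (n * g) f = ψ g f
    rw [map_mul, AlgEquiv.mul_apply]
    exact (h n).1 hn _ this
  · rintro _ ⟨_, ⟨g, hg, rfl⟩, rfl⟩
    exact hstab g hg

/-- Matching stabilizers of algebraically closed subfields of transcendence degree one give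
matching stabilizers of elements. -/
theorem exists_stabilizer_of_acl [IsAlgClosed k] {ψ : (F ≃ₐ[k] F) ≃* (F ≃ₐ[k] F)}
    (hψ : NbhdCont ψ) (hψ' : NbhdCont ψ.symm) {x f : F} (hx : x ∉ (⊥ : IntermediateField k F))
    (hf : f ∉ (⊥ : IntermediateField k F))
    (h : ∀ g, g ∈ fixS k (acl k {x} : Set F) ↔ ψ g ∈ fixS k (acl k {f} : Set F)) :
    ∃ x₁ y : F, x₁ ∉ (⊥ : IntermediateField k F) ∧ y ∉ (⊥ : IntermediateField k F) ∧
      ∀ g : F ≃ₐ[k] F, g x₁ = x₁ ↔ ψ g y = y := by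
  obtain ⟨hfin, hsub⟩ := orb_map_fixS hψ h
  obtain ⟨y, hy, hyb, hyP⟩ := exists_fixed_of_orb_finite hfin hf hsub
  have hE : acl k {y} = acl k {f} := acl_eq_of_mem hy (by rwa [acl_empty])
  have h' : ∀ g, g ∈ fixS k (acl k {y} : Set F) ↔ ψ.symm g ∈ fixS k (acl k {x} : Set F) := by
    intro g
    rw [hE, h, MulEquiv.apply_symm_apply]
  obtain ⟨hfin', hsub'⟩ := orb_map_fixS hψ' h'
  set Q := (fixS k {y}).map ψ.symm.toMonoidHom with hQ
  have hmemQ : ∀ g, g ∈ Q ↔ ψ g y = y := by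
    intro g
    rw [hQ]
    constructor
    · rintro ⟨g, hg, rfl⟩
      have : ψ (ψ.symm g) = g := ψ.apply_symm_apply g
      change ψ (ψ.symm g) y = y
      rw [this]
      exact hg y rfl
    · intro hg
      refine ⟨ψ g, ?_, ψ.symm_apply_apply g⟩
      rintro s rfl
      exact hg
  obtain ⟨x₀, hx₀, hx₀b, hx₀Q⟩ := exists_fixed_of_orb_finite hfin' hx hsub'
  have hle : fixS k {x} ≤ Q := by
    intro g hg
    rw [hmemQ]
    exact mem_fixedField'.1 hyP _ ⟨g, hg, rfl⟩
  have hK : fixedField Q ≤ k⟮x⟯ := by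
    intro b hb
    rw [mem_adjoin_iff_fixed]
    intro g hg
    exact mem_fixedField'.1 hb g (hle hg)
  obtain ⟨x₁, hx₁⟩ := luroth hx hK
  refine ⟨x₁, y, ?_, hyb, fun g => ?_⟩
  · intro hb
    rw [hx₁, IntermediateField.adjoin_simple_eq_bot_iff.2 hb] at hx₀Q
    exact hx₀b hx₀Q
  · rw [← hmemQ]
    constructor
    · intro hg
      refine mem_of_fixedField hfin' hle fun b hb => ?_
      rw [hx₁, mem_adjoin_iff_fixed] at hb
      refine hb g ?_
      rintro s rfl
      exact hg
    · intro hg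
      have h1 : x₁ ∈ fixedField Q := by
        rw [hx₁]
        exact mem_adjoin_simple_self k x₁
      exact mem_fixedField'.1 h1 g hg

end Stabilizer

section Disjoint
open IntermediateField Polynomial
variable {k F : Type*} [Field k] [Field F] [Algebra k F]

/-- Linear disjointness from the existence of enough automorphisms: a linear relation with
coefficients in `N` between elements of `A` yields one with coefficients in `M`. -/
theorem exists_relation_of_automorphisms {M N : IntermediateField k F} {A : Set F}
    (H : ∀ c ∈ N, c ∉ M → ∃ σ : F ≃ₐ[k] F, (∀ a ∈ A, σ a = a) ∧ (∀ x ∈ N, σ x ∈ N) ∧ σ c ≠ c)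
    {ι : Type*} [Fintype ι] {a : ι → F} (ha : ∀ i, a i ∈ A) (c : ι → F) (hc : ∀ i, c i ∈ N)
    (h0 : c ≠ 0) (hsum : ∑ i, c i * a i = 0) :
    ∃ c' : ι → F, (∀ i, c' i ∈ M) ∧ c' ≠ 0 ∧ ∑ i, c' i * a i = 0 := by
  classical
  induction hm : (Finset.univ.filter fun i => c i ≠ 0).card using Nat.strong_induction_on
    generalizing c with
  | _ m ih =>
    obtain ⟨i₀, hi₀⟩ := Function.ne_iff.1 h0
    simp only [Pi.zero_apply] at hi₀
    by_cases hM : ∀ i, c i / c i₀ ∈ M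
    · refine ⟨fun i => c i / c i₀, hM, Function.ne_iff.2 ⟨i₀, by simp [hi₀]⟩, ?_⟩
      simp only [div_mul_eq_mul_div]
      rw [← Finset.sum_div, hsum, zero_div]
    · push Not at hM
      obtain ⟨j, hj⟩ := hM
      obtain ⟨σ, h1, h2, h3⟩ := H _ (N.div_mem (hc j) (hc i₀)) hj
      refine ih _ ?_ (fun i => σ (c i / c i₀) - c i / c i₀)
        (fun i => N.sub_mem (h2 _ (N.div_mem (hc i) (hc i₀))) (N.div_mem (hc i) (hc i₀)))
        (Function.ne_iff.2 ⟨j, sub_ne_zero.2 h3⟩) ?_ rfl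
      · rw [← hm]
        refine Finset.card_lt_card ⟨fun i hi => ?_, fun h => ?_⟩
        · simp only [Finset.mem_filter, Finset.mem_univ, true_and] at hi ⊢
          rintro h
          simp [h] at hi
        · have := h (show i₀ ∈ _ by simpa using hi₀)
          simp [hi₀] at this
      · have e1 : ∑ i, c i / c i₀ * a i = 0 := by
          simp only [div_mul_eq_mul_div]
          rw [← Finset.sum_div, hsum, zero_div]
        have e2 := congrArg σ e1
        rw [map_sum, map_zero] at e2
        simp only [map_mul, h1 _ (ha _)] at e2
        simp only [sub_mul, Finset.sum_sub_distrib, e1, e2, sub_zero]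

variable (k) in
/-- The entries of the list are successively transcendental over the set and their
predecessors. -/
def SeqIndep : Set F → List F → Prop
  | _, [] => True
  | S, a :: l => a ∉ acl k S ∧ SeqIndep (insert a S) l

theorem SeqIndep.mono {S T : Set F} {l : List F} (h : SeqIndep k T l) (hST : S ⊆ acl k T) :
    SeqIndep k S l := by
  induction l generalizing S T with
  | nil => trivial
  | cons a l ih =>
    refine ⟨fun h' => h.1 (acl_le_of_subset hST h'), ih h.2 ?_⟩
    rintro x (rfl | hx)
    · exact subset_acl _ (Set.mem_insert _ _)
    · exact acl_mono (Set.subset_insert _ _) (hST hx)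

theorem SeqIndep.map {S : Set F} {l : List F} (h : SeqIndep k S l) (g : F ≃ₐ[k] F) :
    SeqIndep k (g '' S) (l.map g) := by
  induction l generalizing S with
  | nil => trivial
  | cons a l ih =>
    refine ⟨by rw [map_mem_acl_iff]; exact h.1, ?_⟩
    rw [← Set.image_insert_eq]
    exact ih h.2

theorem SeqIndep.mem_acl_of_mem {N V : Set F} {l : List F} (h : SeqIndep k N l)
    (hV : V ⊆ acl k N) {c : F} (hc : c ∈ acl k N) (hcV : c ∈ acl k (V ∪ {x | x ∈ l})) :
    c ∈ acl k V := by
  induction l generalizing N V with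
  | nil => simpa using hcV
  | cons t l ih =>
    have h1 : c ∈ acl k (insert t V) := by
      refine ih h.2 ?_ (acl_mono (Set.subset_insert _ _) hc) ?_
      · rintro x (rfl | hx)
        · exact subset_acl _ (Set.mem_insert _ _)
        · exact acl_mono (Set.subset_insert _ _) (hV hx)
      · refine acl_mono ?_ hcV
        rintro x (hx | hx)
        · exact Or.inl (Or.inr hx)
        · rcases List.mem_cons.1 hx with rfl | hx
          · exact Or.inl (Or.inl rfl)
          · exact Or.inr hx
    by_contra hcon
    refine h.1 (acl_le_of_subset ?_ (acl_exchange h1 hcon))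
    rintro x (rfl | hx)
    · exact hc
    · exact hV hx

/-- A generic list `l` over the finitely generated `N`: elements of `N` outside `M` are moved by
automorphisms preserving `N` and fixing the algebraic closure of `M` and `l`. -/
theorem exists_move_of_seqIndep [IsAlgClosed F] {S₀ S : Set F} (hS : S.Finite)
    (h0 : S₀ ⊆ acl k S) {l : List F} (hl : SeqIndep k S l) {c : F} (hc : c ∈ acl k S)
    (hc0 : c ∉ acl k S₀) : ∃ σ : F ≃ₐ[k] F, (∀ a ∈ acl k (S₀ ∪ {x | x ∈ l}), σ a = a) ∧
      (∀ x ∈ acl k S, σ x ∈ acl k S) ∧ σ c = c + 1 := by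
  obtain ⟨b, -, hb⟩ := (hS.finite_subsets.inter_of_left
    {b | c ∉ acl k (S₀ ∪ b)}).exists_le_maximal (a := ∅)
      ⟨Set.empty_subset _, by simpa using hc0⟩
  obtain ⟨⟨hbS, hcb⟩, hmax⟩ := hb
  have hbS' : b ⊆ S := hbS
  have hgen : S ⊆ acl k (insert c (S₀ ∪ b)) := by
    intro d hd
    by_contra hd'
    have h1 : c ∉ acl k (S₀ ∪ insert d b) := by
      intro h
      rw [Set.union_insert] at h
      exact hd' (acl_exchange h hcb)
    have := hmax ⟨Set.insert_subset hd hbS', h1⟩ (Set.subset_insert _ _) (Set.mem_insert d b)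
    exact hd' (subset_acl _ (Or.inr (Or.inr this)))
  have hsub : S₀ ∪ b ⊆ acl k S := Set.union_subset h0 (hbS'.trans (subset_acl _))
  have hcX : c ∉ acl k (S₀ ∪ b ∪ {x | x ∈ l}) := fun h => hcb (hl.mem_acl_of_mem hsub hc h)
  have hcX' : c + 1 ∉ acl k (S₀ ∪ b ∪ {x | x ∈ l}) := fun h => hcX (by
    simpa using (acl k (S₀ ∪ b ∪ {x | x ∈ l})).sub_mem h (one_mem _))
  obtain ⟨σ, hσ, hσc⟩ := exists_fixS_of_notMem_acl hcX hcX'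
  refine ⟨σ, fun a ha => hσ a (acl_mono (Set.union_subset_union_left _ Set.subset_union_left) ha),
    fun x hx => ?_, hσc⟩
  have h1 := map_mem_acl σ (acl_le_of_subset hgen hx)
  refine acl_le_of_subset ?_ h1
  rintro _ ⟨y, (rfl | hy), rfl⟩
  · rw [hσc]; exact add_mem hc (one_mem _)
  · rw [hσ y (subset_acl _ (Or.inl hy))]; exact hsub hy

theorem exists_relation_of_seqIndep [IsAlgClosed F] {S₀ S : Set F} (hS : S.Finite)
    (h0 : S₀ ⊆ acl k S) {l : List F} (hl : SeqIndep k S l)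
    {ι : Type*} [Fintype ι] {a : ι → F} (ha : ∀ i, a i ∈ acl k (S₀ ∪ {x | x ∈ l}))
    (c : ι → F) (hc : ∀ i, c i ∈ acl k S) (hc0 : c ≠ 0) (hsum : ∑ i, c i * a i = 0) :
    ∃ c' : ι → F, (∀ i, c' i ∈ acl k S₀) ∧ c' ≠ 0 ∧ ∑ i, c' i * a i = 0 := by
  refine exists_relation_of_automorphisms (A := acl k (S₀ ∪ {x | x ∈ l})) ?_ ha c hc hc0 hsum
  intro c hc hc0
  obtain ⟨σ, h1, h2, h3⟩ := exists_move_of_seqIndep hS h0 hl hc hc0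
  exact ⟨σ, h1, h2, by rw [h3]; simp⟩

end Disjoint

section Regular
open IntermediateField Polynomial
variable {k F : Type*} [Field k] [Field F] [Algebra k F]

/-- Regularity: an element of `N(l)` algebraic over `M(l)` lies in `M(l)`. -/
theorem mem_adjoin_of_seqIndep [IsAlgClosed F] {S₀ S : Set F} (hS : S.Finite)
    (h0 : S₀ ⊆ acl k S) {l : List F} (hl : SeqIndep k S l) {e : F}
    (he : e ∈ acl k (S₀ ∪ {x | x ∈ l})) (he' : e ∈ adjoin k (acl k S ∪ {x | x ∈ l} : Set F)) :
    e ∈ adjoin k (acl k S₀ ∪ {x | x ∈ l} : Set F) := by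
  classical
  rw [← restrictScalars_adjoin, mem_restrictScalars, mem_adjoin_iff_div] at he'
  obtain ⟨r, hr, s, hs, rfl⟩ := he'
  by_cases hs0 : s = 0
  · rw [hs0, div_zero]; exact zero_mem _
  obtain ⟨b, hb, hspan, hlin⟩ := exists_linearIndependent (acl k S)
    (Submonoid.closure {x | x ∈ l} : Set F)
  rw [← Subalgebra.mem_toSubmodule, Algebra.adjoin_eq_span, ← hspan] at hr hs
  obtain ⟨f, hf⟩ := (Finsupp.mem_span_iff_linearCombination _ _ _).1 hr
  obtain ⟨g, hg⟩ := (Finsupp.mem_span_iff_linearCombination _ _ _).1 hs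
  let T : Finset b := f.support ∪ g.support
  have hf' : ∑ m : T, (f m : F) * (m : F) = r := by
    rw [← hf, Finsupp.linearCombination_apply, Finsupp.sum_of_support_subset f
      (s := T) Finset.subset_union_left _ (by simp)]
    exact Finset.sum_coe_sort T fun m => (f m : F) * (m : F)
  have hg' : ∑ m : T, (g m : F) * (m : F) = s := by
    rw [← hg, Finsupp.linearCombination_apply, Finsupp.sum_of_support_subset g
      (s := T) Finset.subset_union_right _ (by simp)]
    exact Finset.sum_coe_sort T fun m => (g m : F) * (m : F)
  have hmon : ∀ K : IntermediateField k F, ∀ m : b,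
      (m : F) ∈ adjoin k (K ∪ {x | x ∈ l} : Set F) := by
    intro K m
    have h1 : Submonoid.closure {x | x ∈ l} ≤
        (adjoin k (K ∪ {x | x ∈ l} : Set F)).toSubalgebra.toSubmonoid :=
      Submonoid.closure_le.2 fun x hx => subset_adjoin _ _ (Or.inr hx)
    exact h1 (hb m.2)
  have hmon' : ∀ m : b, (m : F) ∈ acl k (S₀ ∪ {x | x ∈ l}) := by
    intro m
    have := adjoin_le_acl _ (hmon (acl k S₀) m)
    rwa [acl_union_acl_left] at this
  obtain ⟨c', h1, h2, h3⟩ := exists_relation_of_seqIndep (ι := T ⊕ T) hS h0 hl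
    (a := Sum.elim (fun m => (m : F)) (fun m => r / s * (m : F)))
    (by
      rintro (m | m)
      · exact hmon' m
      · exact mul_mem he (hmon' m))
    (Sum.elim (fun m => (f m : F)) (fun m => -(g m : F)))
    (by
      rintro (m | m)
      · exact (f m).2
      · exact neg_mem (g m).2)
    (by
      intro h
      refine hs0 ?_
      rw [← hg']
      refine Finset.sum_eq_zero fun m _ => ?_
      have := congrFun h (Sum.inr m)
      simp only [Sum.elim_inr, Pi.zero_apply, neg_eq_zero] at this
      rw [this, zero_mul])
    (by
      simp only [Fintype.sum_sum_type, Sum.elim_inl, Sum.elim_inr]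
      rw [hf', Finset.sum_congr rfl (g := fun m : T => - (r / s) * ((g m : F) * (m : F)))
        fun m _ => by ring, ← Finset.mul_sum, hg']
      field_simp
      ring)
  simp only [Fintype.sum_sum_type, Sum.elim_inl, Sum.elim_inr] at h3
  have h3' : ∑ m : T, c' (Sum.inl m) * (m : F) + r / s * ∑ m : T, c' (Sum.inr m) * (m : F) = 0 := by
    rw [← h3, Finset.mul_sum]
    congr 1
    exact Finset.sum_congr rfl fun m _ => by ring
  have hind : ∀ d : T → F, (∀ m, d m ∈ acl k S₀) → ∑ m : T, d m * (m : F) = 0 → d = 0 := by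
    intro d hd hsum
    have hlT : LinearIndependent (acl k S) (fun m : T => ((m : b) : F)) :=
      hlin.comp _ Subtype.val_injective
    rw [Fintype.linearIndependent_iff] at hlT
    funext m
    have := hlT (fun m => ⟨d m, acl_le_of_subset h0 (hd m)⟩) hsum m
    simpa using congrArg Subtype.val this
  have hmem : ∀ d : T → F, (∀ m, d m ∈ acl k S₀) →
      ∑ m : T, d m * (m : F) ∈ adjoin k (acl k S₀ ∪ {x | x ∈ l} : Set F) := fun d hd =>
    sum_mem fun m _ => mul_mem (subset_adjoin _ _ (Or.inl (hd m))) (hmon _ m)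
  by_cases hz : ∑ m : T, c' (Sum.inr m) * (m : F) = 0
  · exfalso
    rw [hz, mul_zero, add_zero] at h3'
    refine h2 (funext ?_)
    rintro (m | m)
    · exact congrFun (hind _ (fun m => h1 _) h3') m
    · exact congrFun (hind _ (fun m => h1 _) hz) m
  · have : r / s = - (∑ m : T, c' (Sum.inl m) * (m : F)) / ∑ m : T, c' (Sum.inr m) * (m : F) := by
      rw [eq_div_iff hz]
      linear_combination h3'
    rw [this]
    exact div_mem (neg_mem (hmem _ fun m => h1 _)) (hmem _ fun m => h1 _)

theorem orb_subset_of_seqIndep [IsAlgClosed F] [CharZero F] {S₀ S : Set F} (hS : S.Finite)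
    (h0 : S₀ ⊆ acl k S) {l : List F} (hl : SeqIndep k S l) {e : F}
    (he : e ∈ acl k (S₀ ∪ {x | x ∈ l})) :
    orb (fixS k (acl k S₀ ∪ {x | x ∈ l} : Set F)) e ⊆
      orb (fixS k (acl k S ∪ {x | x ∈ l} : Set F)) e := by
  have hfin : (orb (fixS k (acl k S ∪ {x | x ∈ l} : Set F)) e).Finite := by
    refine orb_finite_of_mem_acl (acl_le_of_subset ?_ he)
    rintro x (hx | hx)
    · exact subset_acl _ (Or.inl (h0 hx))
    · exact subset_acl _ (Or.inr hx)
  have hcoef : ∀ i, (orbPoly hfin).coeff i ∈ adjoin k (acl k S₀ ∪ {x | x ∈ l} : Set F) := by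
    intro i
    refine mem_adjoin_of_seqIndep hS h0 hl (coeff_orbPoly_mem_of_subset hfin ?_ i)
      (mem_adjoin_of_fixed ((mem_fixedField').1 (coeff_orbPoly_mem hfin i)))
    rintro _ ⟨g, hg, rfl⟩
    have := map_mem_acl g he
    refine acl_le_of_subset ?_ this
    rintro _ ⟨y, hy, rfl⟩
    have : g y = y := hg y (hy.imp (fun h => h0 h) id)
    change g y ∈ _
    rw [this]
    exact subset_acl _ hy
  rintro _ ⟨g, hg, rfl⟩
  change g e ∈ _
  rw [← isRoot_orbPoly hfin]
  have hmap : (orbPoly hfin).map (g : F →+* F) = orbPoly hfin := by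
    ext i
    rw [coeff_map]
    exact (mem_adjoin_iff_fixed.1 (hcoef i)) g hg
  have hr : (orbPoly hfin).IsRoot e := (isRoot_orbPoly hfin).2 (self_mem_orb _ _)
  rw [← hmap]
  exact hr.map (f := (g : F →+* F))

/-- Stationarity: automorphisms over `M(l)` agree on finite subsets of the algebraic closure of
`M(l)` with automorphisms over `N(l)`. -/
theorem exists_fixS_eqOn [IsAlgClosed F] [CharZero F] {S₀ S : Set F} (hS : S.Finite)
    (h0 : S₀ ⊆ acl k S) {l : List F} (hl : SeqIndep k S l) {C : Set F} (hC : C.Finite)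
    (hCl : C ⊆ acl k (S₀ ∪ {x | x ∈ l})) {σ : F ≃ₐ[k] F}
    (hσ : σ ∈ fixS k (acl k S₀ ∪ {x | x ∈ l} : Set F)) :
    ∃ ρ ∈ fixS k (acl k S ∪ {x | x ∈ l} : Set F), ∀ c ∈ C, ρ c = σ c := by
  let K := adjoin k (acl k S₀ ∪ {x | x ∈ l} : Set F)
  have hCK : ∀ c ∈ C, IsIntegral K c := fun c hc => by
    have : c ∈ acl k (acl k S₀ ∪ {x | x ∈ l} : Set F) := by
      rw [acl_union_acl_left]; exact hCl hc
    exact (mem_acl.1 this).isIntegral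
  have hfd : FiniteDimensional K (adjoin K C) := by
    have := hC.to_subtype
    exact finiteDimensional_adjoin hCK
  have : CharZero K := (algebraMap K F).charZero
  obtain ⟨e, he⟩ := Field.exists_primitive_element K (adjoin K C)
  have heacl : (e : F) ∈ acl k (S₀ ∪ {x | x ∈ l}) := by
    rw [← acl_union_acl_left, mem_acl]
    exact ((Algebra.IsIntegral.isIntegral (R := K) e).map
      (adjoin K C).val).isAlgebraic
  obtain ⟨ρ, hρ, hρe⟩ := orb_subset_of_seqIndep hS h0 hl heacl ⟨σ, hσ, rfl⟩
  refine ⟨ρ, hρ, fun c hc => ?_⟩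
  have hσ' : σ ∈ fixS k (K : Set F) := by rw [fixS_adjoin]; exact hσ
  have hρ' : ρ ∈ fixS k (K : Set F) := by
    rw [fixS_adjoin]
    rintro x (hx | hx)
    · exact hρ x (Or.inl (acl_le_of_subset h0 hx))
    · exact hρ x (Or.inr hx)
  let f : adjoin K C →ₐ[K] F := (overFix hσ' : F →ₐ[K] F).comp (adjoin K C).val
  let f' : adjoin K C →ₐ[K] F := (overFix hρ' : F →ₐ[K] F).comp (adjoin K C).val
  have hff : f' = f := by
    have he' : Algebra.adjoin K {e} = ⊤ := by
      rw [← adjoin_toSubalgebra, he, top_toSubalgebra]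
    refine AlgHom.ext_of_adjoin_eq_top he' ?_
    rintro x hx
    rw [Set.mem_singleton_iff.1 hx]
    exact hρe
  exact congrArg (fun φ => φ ⟨c, subset_adjoin _ _ hc⟩) hff

end Regular

section Intersection
open IntermediateField Polynomial
variable {k F : Type*} [Field k] [Field F] [Algebra k F]

theorem eq_zero_of_eval_eq_zero {S : Set F} {t : F} (ht : t ∉ acl k S) {p : F[X]}
    (hp : ∀ i, p.coeff i ∈ acl k S) (h : p.eval t = 0) : p = 0 := by
  by_contra h0
  exact ht (mem_acl_of_root h0 hp h)

theorem exists_minimal_fraction {S : Set F} {t f : F}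
    (hf : f ∈ adjoin k (insert t (acl k S : Set F))) :
    ∃ p q : F[X], (∀ i, p.coeff i ∈ acl k S) ∧ (∀ i, q.coeff i ∈ acl k S) ∧ q.Monic ∧
      f * q.eval t = p.eval t ∧
      ∀ p' q' : F[X], (∀ i, p'.coeff i ∈ acl k S) → (∀ i, q'.coeff i ∈ acl k S) → q' ≠ 0 →
        f * q'.eval t = p'.eval t → q.natDegree ≤ q'.natDegree := by
  classical
  have hex : ∃ n, ∃ p q : F[X], (∀ i, p.coeff i ∈ acl k S) ∧ (∀ i, q.coeff i ∈ acl k S) ∧ q ≠ 0 ∧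
      f * q.eval t = p.eval t ∧ q.natDegree = n := by
    rw [← Set.union_singleton, ← restrictScalars_adjoin, mem_restrictScalars,
      mem_adjoin_simple_iff] at hf
    obtain ⟨r, s, rfl⟩ := hf
    have hc : ∀ u : (acl k S)[X], ∀ i, (u.map (algebraMap (acl k S) F)).coeff i ∈ acl k S :=
      fun u i => by rw [coeff_map]; exact (u.coeff i).2
    by_cases hs : aeval t s = 0
    · refine ⟨_, 0, 1, by simp [zero_mem], fun i => ?_, one_ne_zero, by simp [hs], rfl⟩
      rw [coeff_one]; split_ifs <;> simp [zero_mem, one_mem]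
    · refine ⟨_, r.map (algebraMap _ F), s.map (algebraMap _ F), hc r, hc s, ?_, ?_, rfl⟩
      · rintro h
        rw [← eval_map_algebraMap, h, eval_zero] at hs
        exact hs rfl
      · rw [eval_map_algebraMap, eval_map_algebraMap, div_mul_cancel₀ _ hs]
  obtain ⟨p, q, hp, hq, hq0, h, hn⟩ := Nat.find_spec hex
  have hl : q.leadingCoeff ≠ 0 := leadingCoeff_ne_zero.2 hq0
  refine ⟨C q.leadingCoeff⁻¹ * p, C q.leadingCoeff⁻¹ * q, fun i => ?_, fun i => ?_, ?_, ?_, ?_⟩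
  · rw [coeff_C_mul]; exact mul_mem (inv_mem (hq _)) (hp i)
  · rw [coeff_C_mul]; exact mul_mem (inv_mem (hq _)) (hq i)
  · rw [mul_comm]; exact monic_mul_leadingCoeff_inv hq0
  · rw [eval_mul, eval_mul, eval_C, ← h]; ring
  · intro p' q' hp' hq' hq0' h'
    rw [natDegree_C_mul (inv_ne_zero hl), hn]
    exact Nat.find_min' hex ⟨p', q', hp', hq', hq0', h', rfl⟩

/-- `N(t) ∩ acl (M₁, t) ∩ acl (M₂, t) ⊆ (M₁ ∩ M₂)(t)` for `t` generic over `N`. -/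
theorem mem_acl_insert_of_fraction [IsAlgClosed F] {S S₀ S₁ S₂ : Set F} (hS : S.Finite)
    (h1 : S₁ ⊆ acl k S) (h2 : S₂ ⊆ acl k S) (h0 : acl k S₁ ⊓ acl k S₂ ≤ acl k S₀) {t f : F}
    (ht : t ∉ acl k S) (hf : f ∈ adjoin k (insert t (acl k S : Set F)))
    (hf1 : f ∈ acl k (insert t S₁)) (hf2 : f ∈ acl k (insert t S₂)) :
    f ∈ acl k (insert t S₀) := by
  obtain ⟨p, q, hp, hq, hqm, h, hmin⟩ := exists_minimal_fraction hf
  have huniq : ∀ σ : F ≃ₐ[k] F, (∀ x ∈ acl k S, σ x ∈ acl k S) → σ t = t → σ f = f →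
      q.map (σ : F →+* F) = q ∧ p.map (σ : F →+* F) = p := by
    intro σ hσ hσt hσf
    have hev : ∀ r : F[X], (r.map (σ : F →+* F)).eval t = σ (r.eval t) := fun r => by
      conv_lhs => rw [← hσt]
      exact (eval_map_apply (f := (σ : F →+* F)) (p := r) (x := t))
    have hq' : ∀ i, (q.map (σ : F →+* F)).coeff i ∈ acl k S := fun i => by
      rw [coeff_map]; exact hσ _ (hq i)
    have hp' : ∀ i, (p.map (σ : F →+* F)).coeff i ∈ acl k S := fun i => by
      rw [coeff_map]; exact hσ _ (hp i)
    have e1 : f * (q.map (σ : F →+* F)).eval t = (p.map (σ : F →+* F)).eval t := by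
      rw [hev, hev, ← h, map_mul, hσf]
    have e2 : q.map (σ : F →+* F) = q := by
      by_contra hne
      have hdeg : (q.map (σ : F →+* F) - q).degree < q.degree := by
        have := degree_sub_lt_left (p := q.map (σ : F →+* F)) (q := q) (by simp [degree_map])
          (by simpa using hqm.ne_zero) (by
            rw [(hqm.map _).leadingCoeff, hqm.leadingCoeff])
        simpa [degree_map] using this
      have := hmin (p.map (σ : F →+* F) - p) (q.map (σ : F →+* F) - q)
        (fun i => by rw [coeff_sub]; exact sub_mem (hp' i) (hp i))
        (fun i => by rw [coeff_sub]; exact sub_mem (hq' i) (hq i))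
        (sub_ne_zero.2 hne) (by rw [eval_sub, eval_sub, mul_sub, e1, h])
      exact absurd (natDegree_lt_natDegree (sub_ne_zero.2 hne) hdeg) (not_lt.2 this)
    refine ⟨e2, ?_⟩
    rw [e2, h] at e1
    rw [← sub_eq_zero]
    refine eq_zero_of_eval_eq_zero ht (fun i => by rw [coeff_sub]; exact sub_mem (hp' i) (hp i)) ?_
    rw [eval_sub, ← e1, sub_self]
  have key : ∀ T : Set F, T ⊆ acl k S → f ∈ acl k (insert t T) →
      ∀ i, q.coeff i ∈ acl k T ∧ p.coeff i ∈ acl k T := by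
    intro T hT hfT i
    have hmv : ∀ c ∈ acl k S, c ∉ acl k T → ∃ σ : F ≃ₐ[k] F,
        (q.map (σ : F →+* F) = q ∧ p.map (σ : F →+* F) = p) ∧ σ c = c + 1 := by
      intro c hc hcT
      obtain ⟨σ, hσ1, hσ2, hσ3⟩ := exists_move_of_seqIndep (l := [t]) hS hT ⟨ht, trivial⟩ hc hcT
      have hins : (T ∪ {x | x ∈ [t]}) = insert t T := by
        ext x; simp [or_comm]
      rw [hins] at hσ1
      exact ⟨σ, huniq σ hσ2 (hσ1 t (subset_acl _ (Set.mem_insert _ _))) (hσ1 f hfT), hσ3⟩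
    constructor
    · by_contra hcon
      obtain ⟨σ, ⟨hσ, -⟩, hσc⟩ := hmv _ (hq i) hcon
      have := congrArg (fun r => r.coeff i) hσ
      simp only [coeff_map] at this
      change σ (q.coeff i) = _ at this
      rw [hσc] at this
      simp at this
    · by_contra hcon
      obtain ⟨σ, ⟨-, hσ⟩, hσc⟩ := hmv _ (hp i) hcon
      have := congrArg (fun r => r.coeff i) hσ
      simp only [coeff_map] at this
      change σ (p.coeff i) = _ at this
      rw [hσc] at this
      simp at this
  have hev : ∀ r : F[X], (∀ i, r.coeff i ∈ acl k S₀) → r.eval t ∈ acl k (insert t S₀) := by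
    intro r hr
    rw [eval_eq_sum_range]
    exact sum_mem fun i _ => mul_mem (acl_mono (Set.subset_insert _ _) (hr i))
      (pow_mem (subset_acl _ (Set.mem_insert _ _)) _)
  have hq0 : q.eval t ≠ 0 := fun h' => hqm.ne_zero (eq_zero_of_eval_eq_zero ht hq h')
  rw [eq_div_of_mul_eq hq0 h]
  exact div_mem (hev p fun i => h0 ⟨(key S₁ h1 hf1 i).2, (key S₂ h2 hf2 i).2⟩)
    (hev q fun i => h0 ⟨(key S₁ h1 hf1 i).1, (key S₂ h2 hf2 i).1⟩)

theorem acl_insert_inf [IsAlgClosed F] [CharZero F] {S₀ S₁ S₂ : Set F} (hf1 : S₁.Finite)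
    (hf2 : S₂.Finite) (h0 : acl k S₁ ⊓ acl k S₂ ≤ acl k S₀) {t : F} (ht : t ∉ acl k (S₁ ∪ S₂)) :
    acl k (insert t S₁) ⊓ acl k (insert t S₂) ≤ acl k (insert t S₀) := by
  rintro e ⟨he1, he2⟩
  have hi1 : S₁ ⊆ acl k (S₁ ∪ S₂) := Set.subset_union_left.trans (subset_acl _)
  have hi2 : S₂ ⊆ acl k (S₁ ∪ S₂) := Set.subset_union_right.trans (subset_acl _)
  have hfin : (orb (fixS k (insert t (acl k (S₁ ∪ S₂)) : Set F)) e).Finite := by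
    refine orb_finite_of_mem_acl (acl_mono ?_ he1)
    exact Set.insert_subset_insert hi1
  have hstab : ∀ T : Set F, T ⊆ acl k (S₁ ∪ S₂) → e ∈ acl k (insert t T) →
      ∀ i, (orbPoly hfin).coeff i ∈ acl k (insert t T) := by
    intro T hT heT i
    refine coeff_orbPoly_mem_of_subset hfin ?_ i
    rintro _ ⟨g, hg, rfl⟩
    refine acl_le_of_subset ?_ (map_mem_acl g heT)
    rintro _ ⟨y, hy, rfl⟩
    have : g y = y := hg y (hy.imp id fun h => hT h)
    rw [this]
    exact subset_acl _ hy
  refine (acl_acl (k := k) (insert t S₀)) ▸ mem_acl_of_root (p := orbPoly hfin)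
    (S := (acl k (insert t S₀) : Set F)) (orbPoly_monic hfin).ne_zero (fun i => ?_)
    ((isRoot_orbPoly hfin).2 (self_mem_orb _ _))
  rw [acl_acl]
  exact mem_acl_insert_of_fraction (hf1.union hf2) hi1 hi2 h0 ht
    (mem_adjoin_of_fixed (mem_fixedField'.1 (coeff_orbPoly_mem hfin i)))
    (hstab S₁ hi1 he1 i) (hstab S₂ hi2 he2 i)

end Intersection

section Interval
open IntermediateField Polynomial
variable {k F : Type*} [Field k] [Field F] [Algebra k F]

theorem exists_move_list [IsAlgClosed F] [CharZero F] {S₀ S₁ S₂ : Set F} (hf1 : S₁.Finite)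
    (hf2 : S₂.Finite) (h01 : S₀ ⊆ acl k S₁) (h02 : S₀ ⊆ acl k S₂)
    (h0 : acl k S₁ ⊓ acl k S₂ ≤ acl k S₀) {P : Subgroup (F ≃ₐ[k] F)}
    (hP1 : fixS k (acl k S₁ : Set F) ≤ P) (hP2 : fixS k (acl k S₂ : Set F) ≤ P) {l u : List F}
    (hlu : l.length = u.length) (hl : SeqIndep k S₀ l) (hu : SeqIndep k (S₁ ∪ S₂) u) :
    ∃ p ∈ P, p ∈ fixS k (acl k S₀ : Set F) ∧ l.map p = u := by
  induction u generalizing S₀ S₁ S₂ P l with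
  | nil =>
    refine ⟨1, P.one_mem, one_mem _, ?_⟩
    rw [List.length_eq_zero_iff.1 (hlu.trans List.length_nil), List.map_nil]
  | cons v u ih =>
    obtain _ | ⟨a, l⟩ := l
    · simp at hlu
    obtain ⟨p, hp, hp0, hpa⟩ : ∃ p ∈ P, p ∈ fixS k (acl k S₀ : Set F) ∧ p a = v := by
      have hv1 : v ∉ acl k S₁ := fun h => hu.1 (acl_mono Set.subset_union_left h)
      have hv2 : v ∉ acl k S₂ := fun h => hu.1 (acl_mono Set.subset_union_right h)
      by_cases ha : a ∈ acl k S₁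
      · have ha2 : a ∉ acl k S₂ := fun h => hl.1 (h0 ⟨ha, h⟩)
        obtain ⟨p, hp, hpa⟩ := exists_fixS_of_notMem_acl ha2 hv2
        exact ⟨p, hP2 hp, fixS_anti (acl_le_of_subset h02) hp, hpa⟩
      · obtain ⟨p, hp, hpa⟩ := exists_fixS_of_notMem_acl ha hv1
        exact ⟨p, hP1 hp, fixS_anti (acl_le_of_subset h01) hp, hpa⟩
    have hins : ∀ {A B : Set F}, A ⊆ acl k B → insert v A ⊆ acl k (insert v B) := by
      intro A B h
      rintro x (rfl | hx)
      · exact subset_acl _ (Set.mem_insert _ _)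
      · exact acl_mono (Set.subset_insert _ _) (h hx)
    have hle : ∀ {A : Set F}, fixS k (acl k A : Set F) ≤ P →
        fixS k (acl k (insert v A) : Set F) ≤ P ⊓ fixS k {v} := fun h =>
      le_inf ((fixS_anti (acl_mono (Set.subset_insert _ _))).trans h)
        (fixS_anti (by rintro _ rfl; exact subset_acl _ (Set.mem_insert _ _)))
    obtain ⟨q, hq, hq0, hqu⟩ := ih (hf1.insert v) (hf2.insert v) (hins h01) (hins h02)
      (acl_insert_inf hf1 hf2 h0 hu.1) (hle hP1) (hle hP2) (l := l.map p)
      (by simpa using hlu)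
      (by
        have := hl.2.map p
        rw [Set.image_insert_eq, hpa, Set.image_congr (g := id) fun x hx =>
          hp0 x (subset_acl _ hx), Set.image_id] at this
        exact this)
      (hu.2.mono (by
        rw [← Set.insert_union_distrib]
        exact subset_acl _))
    refine ⟨q * p, P.mul_mem hq.1 hp, mul_mem (fixS_anti (acl_mono (Set.subset_insert _ _)) hq0) hp0,
      ?_⟩
    rw [List.map_cons, List.cons.injEq]
    refine ⟨?_, by rw [← hqu, List.map_map]; rfl⟩
    rw [AlgEquiv.mul_apply, hpa]
    exact hq.2 v rfl

/-- Closed subgroups for the topology of pointwise convergence. -/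
def ClosedSub (P : Subgroup (F ≃ₐ[k] F)) : Prop :=
  ∀ g : F ≃ₐ[k] F, (∀ C : Set F, C.Finite → ∃ h ∈ P, ∀ c ∈ C, h c = g c) → g ∈ P

theorem exists_seqIndep_of_finite {C : Set F} (hC : C.Finite) (S : Set F) :
    ∃ l : List F, SeqIndep k S l ∧ (∀ x ∈ l, x ∈ C) ∧ C ⊆ acl k (S ∪ {x | x ∈ l}) := by
  induction C, hC using Set.Finite.induction_on generalizing S with
  | empty => exact ⟨[], trivial, by simp, Set.empty_subset _⟩
  | @insert a C _ _ ih =>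
    by_cases ha : a ∈ acl k S
    · obtain ⟨l, h1, h2, h3⟩ := ih S
      refine ⟨l, h1, fun x hx => Or.inr (h2 x hx), ?_⟩
      rintro x (rfl | hx)
      · exact acl_mono Set.subset_union_left ha
      · exact h3 hx
    · obtain ⟨l, h1, h2, h3⟩ := ih (insert a S)
      have he : S ∪ {x | x ∈ a :: l} = insert a S ∪ {x | x ∈ l} := by
        ext x; simp only [Set.mem_union, Set.mem_ofPred_eq, List.mem_cons, Set.mem_insert_iff]; tauto
      refine ⟨a :: l, ⟨ha, h1⟩, ?_, ?_⟩
      · intro x hx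
        rcases List.mem_cons.1 hx with rfl | hx
        · exact Or.inl rfl
        · exact Or.inr (h2 x hx)
      · rw [he]
        rintro x (rfl | hx)
        · exact subset_acl _ (Or.inl (Or.inl rfl))
        · exact h3 hx

theorem exists_seqIndep_of_infinite (hinf : ∀ S : Set F, S.Finite → ∃ t, t ∉ acl k S) {S : Set F}
    (hS : S.Finite) (n : ℕ) : ∃ u : List F, u.length = n ∧ SeqIndep k S u := by
  induction n generalizing S with
  | zero => exact ⟨[], rfl, trivial⟩
  | succ n ih =>
    obtain ⟨t, ht⟩ := hinf S hS
    obtain ⟨u, h1, h2⟩ := ih (hS.insert t)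
    exact ⟨t :: u, by simp [h1], ht, h2⟩

/-- In infinite transcendence degree, the closed subgroup generated by two stabilizers is the
stabilizer of the intersection. -/
theorem fixS_inf_le [IsAlgClosed F] [CharZero F]
    (hinf : ∀ S : Set F, S.Finite → ∃ t, t ∉ acl k S) {S₀ S₁ S₂ : Set F} (hf1 : S₁.Finite)
    (hf2 : S₂.Finite) (h01 : S₀ ⊆ acl k S₁) (h02 : S₀ ⊆ acl k S₂)
    (h0 : acl k S₁ ⊓ acl k S₂ ≤ acl k S₀) {P : Subgroup (F ≃ₐ[k] F)} (hP : ClosedSub P)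
    (hP1 : fixS k (acl k S₁ : Set F) ≤ P) (hP2 : fixS k (acl k S₂ : Set F) ≤ P) :
    fixS k (acl k S₀ : Set F) ≤ P := by
  intro g hg
  refine hP g fun C hC => ?_
  obtain ⟨l, hl, -, hCl⟩ := exists_seqIndep_of_finite (k := k) hC S₀
  obtain ⟨u, hu, hu'⟩ := exists_seqIndep_of_infinite hinf (hf1.union hf2) l.length
  have hgl := hl.map g
  rw [Set.image_congr (g := id) fun x hx => hg x (subset_acl _ hx), Set.image_id] at hgl
  obtain ⟨p, hp, hp0, hpl⟩ := exists_move_list hf1 hf2 h01 h02 h0 hP1 hP2 hu.symm hl hu'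
  obtain ⟨p', hp', hp0', hpl'⟩ := exists_move_list hf1 hf2 h01 h02 h0 hP1 hP2
    (l := l.map g) (by simp [hu]) hgl hu'
  have hτ : p' * g * p⁻¹ ∈ fixS k (acl k S₀ ∪ {x | x ∈ u} : Set F) := by
    rintro x (hx | hx)
    · exact mul_mem (mul_mem hp0' hg) (inv_mem hp0) x hx
    · change x ∈ u at hx
      rw [← hpl, List.mem_map] at hx
      obtain ⟨y, hy, rfl⟩ := hx
      have : p⁻¹ (p y) = y := p.symm_apply_apply y
      rw [AlgEquiv.mul_apply, AlgEquiv.mul_apply, this]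
      rw [← hpl', List.map_map] at hpl
      exact (List.map_inj_left.1 hpl y hy).symm
  have hCu : p '' C ⊆ acl k (S₀ ∪ {x | x ∈ u}) := by
    rintro _ ⟨c, hc, rfl⟩
    refine acl_mono ?_ (map_mem_acl p (hCl hc))
    rintro _ ⟨y, hy | hy, rfl⟩
    · rw [hp0 y (subset_acl _ hy)]; exact Or.inl hy
    · right
      change p y ∈ u
      rw [← hpl]
      exact List.mem_map_of_mem hy
  obtain ⟨ρ, hρ, hρC⟩ := exists_fixS_eqOn hf1 h01 (hu'.mono (Set.subset_union_left.trans
    (subset_acl _))) (hC.image p) hCu hτ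
  refine ⟨p'⁻¹ * ρ * p, P.mul_mem (P.mul_mem (P.inv_mem hp')
    (hP1 (fixS_anti Set.subset_union_left hρ))) hp, fun c hc => ?_⟩
  have h1 := hρC (p c) ⟨c, hc, rfl⟩
  have : p⁻¹ (p c) = c := p.symm_apply_apply c
  rw [AlgEquiv.mul_apply, AlgEquiv.mul_apply, this] at h1
  rw [AlgEquiv.mul_apply, AlgEquiv.mul_apply, h1]
  exact p'.symm_apply_apply _

end Interval

section Infinite
open IntermediateField Polynomial
variable {k F : Type*} [Field k] [Field F] [Algebra k F]

theorem conj_mem_fixS_image {S : Set F} {g h : F ≃ₐ[k] F}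
    (hh : h ∈ fixS k (acl k (g '' S) : Set F)) : g⁻¹ * h * g ∈ fixS k (acl k S : Set F) := by
  intro x hx
  rw [AlgEquiv.mul_apply, AlgEquiv.mul_apply, hh (g x) (map_mem_acl g hx)]
  exact g.symm_apply_apply x

/-- A closed subgroup normalized by the stabilizer of `S` and containing some stabilizer of a
finite set contains the stabilizer of `S`. -/
theorem fixS_le_of_normalized [IsAlgClosed F] [CharZero F]
    (hinf : ∀ S : Set F, S.Finite → ∃ t, t ∉ acl k S) {S T : Set F} (hS : S.Finite)
    (hT : T.Finite) {Q : Subgroup (F ≃ₐ[k] F)} (hQ : ClosedSub Q)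
    (hQT : fixS k (acl k T : Set F) ≤ Q)
    (hn : ∀ g ∈ fixS k (acl k S : Set F), ∀ q ∈ Q, g * q * g⁻¹ ∈ Q) :
    fixS k (acl k S : Set F) ≤ Q := by
  obtain ⟨l, hl, -, hTl⟩ := exists_seqIndep_of_finite (k := k) hT S
  obtain ⟨u, hu, hu'⟩ := exists_seqIndep_of_infinite hinf (hS.union hT) l.length
  obtain ⟨g, hg, -, hgl⟩ := exists_move_list hS hS (subset_acl S) (subset_acl S)
    (inf_le_left) le_rfl le_rfl hu.symm hl (hu'.mono (S := S ∪ S)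
      (by rw [Set.union_self]; exact Set.subset_union_left.trans (subset_acl _)))
  have hgS : ∀ x ∈ S, g x = x := fun x hx => hg x (subset_acl _ hx)
  have himg : g '' (S ∪ T) ⊆ acl k (S ∪ {x | x ∈ u}) := by
    have h1 : g '' (S ∪ {x | x ∈ l}) ⊆ S ∪ {x | x ∈ u} := by
      rintro _ ⟨y, hy | hy, rfl⟩
      · rw [hgS y hy]; exact Or.inl hy
      · right
        change g y ∈ u
        rw [← hgl]
        exact List.mem_map_of_mem hy
    rintro _ ⟨y, hy, rfl⟩
    refine acl_mono h1 (map_mem_acl g ?_)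
    exact hy.elim (fun h => subset_acl _ (Or.inl h)) fun h => hTl h
  have hST : fixS k (acl k (S ∪ T) : Set F) ≤ Q :=
    (fixS_anti (acl_mono Set.subset_union_right)).trans hQT
  refine fixS_inf_le hinf (hS.union hT) ((hS.union hT).image g)
    (Set.subset_union_left.trans (subset_acl _)) ?_ ?_ hQ hST ?_
  · intro x hx
    exact subset_acl _ ⟨x, Or.inl hx, hgS x hx⟩
  · rintro c ⟨hc1, hc2⟩
    exact hu'.mem_acl_of_mem (Set.subset_union_left.trans (subset_acl _)) hc1
      (acl_le_of_subset himg hc2)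
  · intro h hh
    have := hn g hg _ (hST (conj_mem_fixS_image hh))
    simpa [mul_assoc] using this

theorem closedSub_map {ψ : (F ≃ₐ[k] F) ≃* (F ≃ₐ[k] F)} (hψ' : NbhdCont ψ.symm) (S : Set F) :
    ClosedSub ((fixS k S).map ψ.toMonoidHom) := by
  intro g hg
  refine ⟨ψ.symm g, fun e he => ?_, ψ.apply_symm_apply g⟩
  obtain ⟨T, hT, h⟩ := hψ' {e} (Set.finite_singleton e)
  obtain ⟨_, ⟨h', hh', rfl⟩, hTg⟩ := hg T hT
  have h1 := h ((ψ h')⁻¹ * g) (fun t ht => by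
    rw [AlgEquiv.mul_apply, ← hTg t ht]
    exact (ψ h').symm_apply_apply t) e rfl
  rw [map_mul, map_inv, ψ.symm_apply_apply, AlgEquiv.mul_apply] at h1
  have h2 := congrArg h' h1
  rw [hh' e he] at h2
  exact (h'.apply_symm_apply _).symm.trans h2

/-- The image of the stabilizer of `acl S` contains a stabilizer of a finite set. -/
theorem exists_fixS_acl_le_map [IsAlgClosed F] [CharZero F]
    (hinf : ∀ S : Set F, S.Finite → ∃ t, t ∉ acl k S) {ψ : (F ≃ₐ[k] F) ≃* (F ≃ₐ[k] F)}
    (hψ' : NbhdCont ψ.symm) {S : Set F} (hS : S.Finite) :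
    ∃ T : Set F, T.Finite ∧ ∀ g ∈ fixS k (acl k T : Set F),
      ψ.symm g ∈ fixS k (acl k S : Set F) := by
  obtain ⟨T, hT, h⟩ := hψ' S hS
  refine ⟨T, hT, fun g hg e he => ?_⟩
  have hgS : ∀ g ∈ fixS k (acl k T : Set F), ψ.symm g ∈ fixS k S :=
    fun g hg => h g (fixS_anti (subset_acl T) hg)
  have hfin := orb_finite_of_mem_acl he
  let O : Set F := orb (fixS k S) e
  obtain ⟨T', hT', h'⟩ := hψ' O hfin
  have hle : fixS k (acl k T : Set F) ≤ (fixS k O).map ψ.toMonoidHom := by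
    refine fixS_le_of_normalized hinf hT hT' (closedSub_map hψ' O) ?_ ?_
    · intro g hg
      exact ⟨ψ.symm g, h' g (fixS_anti (subset_acl _) hg), ψ.apply_symm_apply g⟩
    · rintro g hg _ ⟨q, hq, rfl⟩
      refine ⟨ψ.symm g * q * (ψ.symm g)⁻¹, ?_, by simp⟩
      intro x hx
      have hx' : (ψ.symm g)⁻¹ x ∈ O := map_mem_orb (inv_mem (hgS g hg)) |>.2 hx
      rw [AlgEquiv.mul_apply, AlgEquiv.mul_apply, hq _ hx']
      exact (ψ.symm g).apply_symm_apply x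
  obtain ⟨q, hq, hqg⟩ := hle hg
  have : ψ.symm g = q := by rw [← hqg]; exact ψ.symm_apply_apply q
  rw [this]
  exact hq e (self_mem_orb _ _)

theorem exists_finite_acl_eq {A : IntermediateField k F} (hA : acl k (A : Set F) = A) {S : Set F}
    (hS : S.Finite) (hAS : A ≤ acl k S) : ∃ S₀ : Set F, S₀.Finite ∧ acl k S₀ = A ∧
      S₀.encard ≤ S.encard ∧ (S.encard ≤ S₀.encard → acl k S ≤ A) := by
  let M := AlgebraicIndependent.matroid k F
  obtain ⟨I, hI⟩ := M.exists_isBasis (A : Set F) (Set.subset_univ _)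
  have hclI : M.closure I = A := by
    rw [hI.closure_eq_closure, ← coe_acl, hA]
  have hIA : acl k I = A := by
    apply SetLike.coe_injective
    rw [coe_acl]; exact hclI
  have hIS : I ⊆ M.closure S := by
    rw [← coe_acl]; exact hI.subset.trans hAS
  have hle : I.encard ≤ S.encard := by
    rw [← hI.indep.eRk_eq_encard]
    exact (M.eRk_mono hIS).trans ((M.eRk_closure_eq S).le.trans (M.eRk_le_encard S))
  have hfin : I.Finite := Set.encard_lt_top_iff.1 (hle.trans_lt hS.encard_lt_top)
  refine ⟨I, hfin, hIA, hle, fun h => ?_⟩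
  have hb : M.IsBasis I (M.closure S) := by
    refine hI.indep.isBasis_of_eRk_ge hfin hIS ?_
    rw [M.eRk_closure_eq]
    exact (M.eRk_le_encard S).trans (h.trans hI.indep.eRk_eq_encard.ge)
  intro x hx
  rw [← hIA, ← SetLike.mem_coe, coe_acl]
  rw [← SetLike.mem_coe, coe_acl] at hx
  change x ∈ M.closure I
  rw [hb.closure_eq_closure, M.closure_closure]
  exact hx

theorem exists_least_fixS [IsAlgClosed F] [CharZero F]
    (hinf : ∀ S : Set F, S.Finite → ∃ t, t ∉ acl k S) {P : Subgroup (F ≃ₐ[k] F)}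
    (hP : ClosedSub P) {T : Set F} (hT : T.Finite) (hTP : fixS k (acl k T : Set F) ≤ P) :
    ∃ B : Set F, B.Finite ∧ fixS k (acl k B : Set F) ≤ P ∧
      ∀ T : Set F, T.Finite → fixS k (acl k T : Set F) ≤ P → acl k B ≤ acl k T := by
  classical
  have hex : ∃ n : ℕ, ∃ B : Set F, B.Finite ∧ fixS k (acl k B : Set F) ≤ P ∧ B.encard = n :=
    ⟨T.ncard, T, hT, hTP, hT.cast_ncard_eq.symm⟩
  obtain ⟨B, hB, hBP, hBn⟩ := Nat.find_spec hex
  refine ⟨B, hB, hBP, fun T hT hTP => ?_⟩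
  have hcl : acl k ((acl k B ⊓ acl k T : IntermediateField k F) : Set F) = acl k B ⊓ acl k T := by
    refine le_antisymm (le_inf ?_ ?_) (subset_acl _)
    · exact acl_le_of_subset fun x hx => hx.1
    · exact acl_le_of_subset fun x hx => hx.2
  obtain ⟨S₀, hS₀, hS₀eq, -, hge⟩ := exists_finite_acl_eq hcl hB inf_le_left
  have h1 : fixS k (acl k S₀ : Set F) ≤ P := by
    refine fixS_inf_le hinf hB hT ?_ ?_ hS₀eq.ge hP hBP hTP
    · exact fun x hx => (hS₀eq.le (subset_acl _ hx)).1
    · exact fun x hx => (hS₀eq.le (subset_acl _ hx)).2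
  refine (hge ?_).trans inf_le_right
  rw [hBn, ← hS₀.cast_ncard_eq]
  exact_mod_cast Nat.find_min' hex ⟨S₀, hS₀, h1, hS₀.cast_ncard_eq.symm⟩

/-- In infinite transcendence degree, continuous automorphisms permute the stabilizers of
algebraically closed subfields of finite transcendence degree. -/
theorem exists_map_fixS_acl [IsAlgClosed F] [CharZero F]
    (hinf : ∀ S : Set F, S.Finite → ∃ t, t ∉ acl k S) {ψ : (F ≃ₐ[k] F) ≃* (F ≃ₐ[k] F)}
    (hψ : NbhdCont ψ) (hψ' : NbhdCont ψ.symm) {S : Set F} (hS : S.Finite) :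
    ∃ B : Set F, B.Finite ∧ ∀ g, g ∈ fixS k (acl k S : Set F) ↔ ψ g ∈ fixS k (acl k B : Set F) := by
  let P := (fixS k (acl k S : Set F)).map ψ.toMonoidHom
  have hP : ClosedSub P := closedSub_map hψ' _
  obtain ⟨T, hT, h⟩ := exists_fixS_acl_le_map hinf hψ' hS
  obtain ⟨B, hB, hBP, hmin⟩ := exists_least_fixS hinf hP hT
    fun g hg => ⟨ψ.symm g, h g hg, ψ.apply_symm_apply g⟩
  have hstab : ∀ g ∈ P, ∀ x ∈ acl k B, g⁻¹ x ∈ acl k B := by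
    intro g hg x hx
    have h1 : acl k B ≤ acl k (g '' B) := by
      refine hmin _ (hB.image g) fun h hh => ?_
      have := P.mul_mem (P.mul_mem hg (hBP (conj_mem_fixS_image hh))) (P.inv_mem hg)
      simpa [mul_assoc] using this
    rw [← map_mem_acl_iff g]
    have : g (g⁻¹ x) = x := g.apply_symm_apply x
    rw [this]
    exact h1 hx
  obtain ⟨T', hT', h'⟩ := exists_fixS_acl_le_map hinf (ψ := ψ.symm) hψ hB
  have hle : fixS k (acl k S : Set F) ≤ (fixS k (acl k B : Set F)).map ψ.symm.toMonoidHom := by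
    refine fixS_le_of_normalized hinf hS hT' (closedSub_map (ψ := ψ.symm) hψ _) ?_ ?_
    · intro g hg
      exact ⟨ψ g, h' g hg, ψ.symm_apply_apply g⟩
    · rintro g hg _ ⟨q, hq, rfl⟩
      refine ⟨ψ g * q * (ψ g)⁻¹, fun x hx => ?_, by simp⟩
      rw [AlgEquiv.mul_apply, AlgEquiv.mul_apply, hq _ (hstab (ψ g) ⟨g, hg, rfl⟩ x hx)]
      exact (ψ g).apply_symm_apply x
  refine ⟨B, hB, fun g => ⟨fun hg => ?_, fun hg => ?_⟩⟩
  · obtain ⟨q, hq, rfl⟩ := hle hg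
    have : ψ (ψ.symm.toMonoidHom q) = q := ψ.apply_symm_apply q
    rwa [this]
  · obtain ⟨q, hq, hqg⟩ := hBP hg
    rwa [← ψ.injective hqg]

theorem exists_acl_correspondence_of_infinite [IsAlgClosed k] [IsAlgClosed F] [CharZero F]
    (hinf : ∀ S : Set F, S.Finite → ∃ t, t ∉ acl k S) {ψ : (F ≃ₐ[k] F) ≃* (F ≃ₐ[k] F)}
    (hψ : NbhdCont ψ) (hψ' : NbhdCont ψ.symm) :
    ∃ x f : F, x ∉ (⊥ : IntermediateField k F) ∧ f ∉ (⊥ : IntermediateField k F) ∧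
      ∀ g, g ∈ fixS k (acl k {x} : Set F) ↔ ψ g ∈ fixS k (acl k {f} : Set F) := by
  obtain ⟨x, hx⟩ := hinf ∅ Set.finite_empty
  obtain ⟨B, hB, hxB⟩ := exists_map_fixS_acl hinf hψ hψ' (Set.finite_singleton x)
  have hne : ∀ y : F, y ∉ acl k (∅ : Set F) → ∃ g : F ≃ₐ[k] F, g ∉ fixS k (acl k {y} : Set F) := by
    intro y hy
    have hy1 : y + 1 ∉ acl k (∅ : Set F) := fun h => hy (by
      simpa using (acl k (∅ : Set F)).sub_mem h (one_mem _))
    obtain ⟨g, -, hg⟩ := exists_fixS_of_notMem_acl hy hy1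
    refine ⟨g, fun h => ?_⟩
    have := h y (subset_acl _ rfl)
    rw [hg] at this
    simp at this
  have hbot : ∀ A : Set F, (∀ a ∈ A, a ∈ acl k (∅ : Set F)) → ∀ g : F ≃ₐ[k] F,
      g ∈ fixS k (acl k A : Set F) := by
    intro A hA g a ha
    have : a ∈ acl k (∅ : Set F) := acl_le_of_subset hA ha
    rw [acl_empty] at this
    obtain ⟨c, rfl⟩ := mem_bot.1 this
    exact g.commutes c
  obtain ⟨f, hfB, hf⟩ : ∃ f ∈ B, f ∉ acl k (∅ : Set F) := by
    by_contra! hcon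
    obtain ⟨g, hg⟩ := hne x hx
    exact hg ((hxB g).2 (hbot B hcon _))
  obtain ⟨C, hC, hfC⟩ := exists_map_fixS_acl hinf (ψ := ψ.symm) hψ' hψ (Set.finite_singleton f)
  obtain ⟨c, hcC, hc⟩ : ∃ c ∈ C, c ∉ acl k (∅ : Set F) := by
    by_contra! hcon
    obtain ⟨g, hg⟩ := hne f hf
    exact hg ((hfC g).2 (hbot C hcon _))
  have hle : ∀ g ∈ fixS k (acl k {x} : Set F), ψ g ∈ fixS k (acl k {f} : Set F) := fun g hg =>
    fixS_anti (acl_mono (Set.singleton_subset_iff.2 hfB)) ((hxB g).1 hg)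
  have hCx : C ⊆ acl k {x} := by
    intro b hb
    rw [SetLike.mem_coe, ← fixed_acl_iff]
    intro g hg
    have := (hfC (ψ g)).1 (hle g hg)
    rw [ψ.symm_apply_apply] at this
    exact this b (subset_acl _ hb)
  refine ⟨x, f, by rwa [← acl_empty], by rwa [← acl_empty], fun g => ⟨hle g, fun hg => ?_⟩⟩
  have h1 := (hfC (ψ g)).1 hg
  rw [ψ.symm_apply_apply] at h1
  refine fixS_anti ?_ h1
  rw [← acl_eq_of_mem (hCx hcC) hc]
  exact acl_mono (Set.singleton_subset_iff.2 hcC)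

end Infinite

section FiniteTrdeg
open IntermediateField Polynomial
variable {k F : Type*} [Field k] [Field F] [Algebra k F]

/-- The elements fixed by the images under `ψ` of all elements of `Φ`. -/
def fixedBy (ψ : (F ≃ₐ[k] F) ≃* (F ≃ₐ[k] F)) (Φ : Set (F ≃ₐ[k] F)) : Set F :=
  {a | ∀ g ∈ Φ, ψ g a = a}

theorem fixedBy_anti {ψ : (F ≃ₐ[k] F) ≃* (F ≃ₐ[k] F)} {Φ Φ' : Set (F ≃ₐ[k] F)} (h : Φ ⊆ Φ') :
    fixedBy ψ Φ' ⊆ fixedBy ψ Φ := fun _ ha g hg => ha g (h hg)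

/-- The elements that are algebraic over the fixed field of every finite subset of
`ψ (fixS k S)`, for some finite `S` in the relative algebraic closure of `k(x)`. -/
def locFin (ψ : (F ≃ₐ[k] F) ≃* (F ≃ₐ[k] F)) (x : F) : Set F :=
  {c | ∃ S : Set F, S.Finite ∧ S ⊆ acl k {x} ∧ ∀ Φ : Set (F ≃ₐ[k] F), Φ.Finite →
    Φ ⊆ fixS k S → c ∈ acl k (fixedBy ψ Φ)}

theorem exists_finite_of_mem_acl {S : Set F} {a : F} (h : a ∈ acl k S) :
    ∃ T ⊆ S, T.Finite ∧ a ∈ acl k T := by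
  rw [← SetLike.mem_coe, coe_acl] at h
  obtain ⟨T, hT, hf, -, ha⟩ := Matroid.exists_mem_finite_closure_of_mem_closure h
  refine ⟨T, hT, hf, ?_⟩
  rw [← SetLike.mem_coe, coe_acl]
  exact ha

variable {ψ : (F ≃ₐ[k] F) ≃* (F ≃ₐ[k] F)} {x : F}

theorem exists_uniform_of_subset_locFin {T : Set F} (hT : T.Finite) (h : T ⊆ locFin ψ x) :
    ∃ S : Set F, S.Finite ∧ S ⊆ acl k {x} ∧ ∀ Φ : Set (F ≃ₐ[k] F), Φ.Finite →
      Φ ⊆ fixS k S → T ⊆ acl k (fixedBy ψ Φ) := by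
  have h' : ∀ t : T, ∃ S : Set F, S.Finite ∧ S ⊆ acl k {x} ∧ ∀ Φ : Set (F ≃ₐ[k] F), Φ.Finite →
    Φ ⊆ fixS k S → (t : F) ∈ acl k (fixedBy ψ Φ) := fun t => h t.2
  choose S hS hSx hSΦ using h'
  have := hT.to_subtype
  refine ⟨⋃ t, S t, Set.finite_iUnion hS, Set.iUnion_subset hSx, fun Φ hΦ hΦS t ht => ?_⟩
  exact hSΦ ⟨t, ht⟩ Φ hΦ (hΦS.trans (fixS_anti (Set.subset_iUnion S ⟨t, ht⟩)))

theorem acl_locFin : (acl k (locFin ψ x) : Set F) = locFin ψ x := by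
  refine Set.Subset.antisymm (fun c hc => ?_) (subset_acl _)
  obtain ⟨T, hT, hTf, hc⟩ := exists_finite_of_mem_acl hc
  obtain ⟨S, hS, hSx, h⟩ := exists_uniform_of_subset_locFin hTf hT
  exact ⟨S, hS, hSx, fun Φ hΦ hΦS => acl_le_of_subset (h Φ hΦ hΦS) hc⟩

theorem image_acl_singleton {s : F ≃ₐ[k] F} (hs : s x ∈ acl k {x}) :
    s '' (acl k {x} : Set F) ⊆ acl k {x} := by
  rw [← acl_image, Set.image_singleton]
  exact acl_le_of_subset (Set.singleton_subset_iff.2 hs)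

theorem map_mem_locFin {s : F ≃ₐ[k] F} (hs : s x ∈ acl k {x}) {c : F} (hc : c ∈ locFin ψ x) :
    ψ s c ∈ locFin ψ x := by
  obtain ⟨S, hS, hSx, h⟩ := hc
  refine ⟨s '' S, hS.image s, (Set.image_mono hSx).trans (image_acl_singleton hs), ?_⟩
  intro Φ hΦ hΦS
  have h1 := h ((fun g => s⁻¹ * g * s) '' Φ) (hΦ.image _) (by
    rintro _ ⟨g, hg, rfl⟩ t ht
    rw [AlgEquiv.mul_apply, AlgEquiv.mul_apply, hΦS hg (s t) ⟨t, ht, rfl⟩]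
    exact s.symm_apply_apply t)
  have h2 : ψ s c ∈ acl k (ψ s '' fixedBy ψ ((fun g => s⁻¹ * g * s) '' Φ)) := by
    rw [← SetLike.mem_coe, acl_image]
    exact ⟨c, h1, rfl⟩
  refine acl_mono ?_ h2
  rintro _ ⟨a, ha, rfl⟩ g hg
  have h3 := ha _ ⟨g, hg, rfl⟩
  rw [map_mul, map_mul, map_inv, AlgEquiv.mul_apply, AlgEquiv.mul_apply] at h3
  have h4 := congrArg (ψ s) h3
  exact ((ψ s).apply_symm_apply _).symm.trans h4

theorem orb_finite_of_locFin {g : F ≃ₐ[k] F} (hg : g ∈ fixS k (acl k {x} : Set F)) {c : F}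
    (hc : c ∈ locFin ψ x) : (orb (Subgroup.zpowers (ψ g)) c).Finite := by
  obtain ⟨S, hS, hSx, h⟩ := hc
  have h1 := h {g} (Set.finite_singleton g) (Set.singleton_subset_iff.2 (fixS_anti hSx hg))
  refine (orb_finite_of_mem_acl h1).subset (orb_mono ?_ c)
  rw [Subgroup.zpowers_le]
  exact fun s hs => hs g rfl

theorem orb_zpowers_infinite [CharZero F] {g : F ≃ₐ[k] F} {a d : F} (hd : d ≠ 0) (hgd : g d = d)
    (h : g a = a + d) : ¬ (orb (Subgroup.zpowers g) a).Finite := by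
  intro hf
  have h1 : ∀ m : ℕ, (g ^ m) a = a + m * d := by
    intro m
    induction m with
    | zero => simp
    | succ m ih =>
      rw [pow_succ', AlgEquiv.mul_apply, ih, map_add, map_mul, map_natCast, hgd, h]
      push_cast
      ring
  refine Set.infinite_of_injective_forall_mem (f := fun m : ℕ => a + m * d) ?_ ?_ hf
  · intro m m' hm
    simpa [hd] using hm
  · intro m
    exact ⟨g ^ m, Subgroup.npow_mem_zpowers g m, h1 m⟩

/-- An element that is algebraic over all the fixed fields of finite subsets exists, since the
algebraic closures of these fixed fields form a directed family of bounded rank. -/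
theorem exists_mem_acl_fixedBy {P : Set (F ≃ₐ[k] F)} {T : Set F} (hT : T.Finite)
    (hT' : acl k T = ⊤)
    (h : ∀ Φ : Set (F ≃ₐ[k] F), Φ.Finite → Φ ⊆ P → ∃ c ∉ (⊥ : IntermediateField k F),
      c ∈ fixedBy ψ Φ) :
    ∃ c ∉ (⊥ : IntermediateField k F), ∀ Φ : Set (F ≃ₐ[k] F), Φ.Finite → Φ ⊆ P →
      c ∈ acl k (fixedBy ψ Φ) := by
  let M := AlgebraicIndependent.matroid k F
  have hM : ∀ X : Set F, M.IsRkFinite X := by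
    intro X
    rw [← Matroid.eRk_lt_top_iff]
    have : X ⊆ M.closure T := by
      rw [← coe_acl, hT']
      exact fun _ _ => trivial
    exact ((M.eRk_mono this).trans (M.eRk_closure_eq T).le).trans_lt
      ((M.eRk_le_encard T).trans_lt hT.encard_lt_top)
  let I : Set (Set (F ≃ₐ[k] F)) := {Φ | Φ.Finite ∧ Φ ⊆ P}
  have hI : I.Nonempty := ⟨∅, Set.finite_empty, Set.empty_subset _⟩
  obtain ⟨Φ, ⟨hΦ, hΦP⟩, hmin⟩ :=
    (InvImage.wf (fun Φ : Set (F ≃ₐ[k] F) => M.eRk (fixedBy ψ Φ)) wellFounded_lt).has_min I hI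
  obtain ⟨c, hc, hcΦ⟩ := h Φ hΦ hΦP
  refine ⟨c, hc, fun Φ' hΦ' hΦP' => ?_⟩
  have h1 := hmin (Φ ∪ Φ') ⟨hΦ.union hΦ', Set.union_subset hΦP hΦP'⟩
  have h2 : M.eRk (fixedBy ψ Φ) ≤ M.eRk (fixedBy ψ (Φ ∪ Φ')) := not_lt.1 h1
  have h3 := (hM (fixedBy ψ (Φ ∪ Φ'))).closure_eq_closure_of_subset_of_eRk_ge_eRk
    (fixedBy_anti Set.subset_union_left) h2
  refine acl_mono (fixedBy_anti (Set.subset_union_right (s := Φ))) ?_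
  rw [← SetLike.mem_coe, coe_acl]
  change c ∈ M.closure _
  rw [h3]
  exact M.subset_closure _ (Set.subset_univ _) hcΦ

end FiniteTrdeg

section FiniteTrdeg
open IntermediateField Polynomial
variable {k F : Type*} [Field k] [Field F] [Algebra k F]
variable {ψ : (F ≃ₐ[k] F) ≃* (F ≃ₐ[k] F)} {x : F}

theorem exists_eigenvector [IsAlgClosed k] [CharZero F] {j : F ≃ₐ[k] F} {a : F}
    (hf : (orb (Subgroup.zpowers j) a).Finite) (ha : j a ≠ a) {E : IntermediateField k F}
    (hE : orb (Subgroup.zpowers j) a ⊆ E)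
    (hfin : ∀ c ∈ E, (orb (Subgroup.zpowers j) c).Finite) :
    ∃ (ζ : k) (θ : F), ζ ≠ 1 ∧ θ ≠ 0 ∧ θ ∈ E ∧ j θ = ζ • θ := by
  let U : Submodule k F := Submodule.span k (orb (Subgroup.zpowers j) a)
  have hUE : ∀ u ∈ U, u ∈ E := fun u hu =>
    (Submodule.span_le.2 hE : U ≤ Subalgebra.toSubmodule E.toSubalgebra) hu
  have hjU : ∀ u ∈ U, j u ∈ U := by
    intro u hu
    have : U ≤ U.comap j.toLinearMap := by
      refine Submodule.span_le.2 fun b hb => Submodule.subset_span ?_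
      exact (map_mem_orb (Subgroup.mem_zpowers j)).2 hb
    exact this hu
  have : FiniteDimensional k U := FiniteDimensional.span_of_finite k hf
  let δ : F →ₗ[k] F := j.toLinearMap - LinearMap.id
  have hδ : ∀ u, δ u = j u - u := fun _ => rfl
  let W : Submodule k F := U.map δ
  have hjW : ∀ w ∈ W, j.toLinearMap w ∈ W := by
    rintro _ ⟨u, hu, rfl⟩
    refine ⟨j u, hjU u hu, ?_⟩
    rw [hδ, hδ, AlgEquiv.toLinearMap_apply, map_sub]
  have haW : δ a ∈ W := ⟨a, Submodule.subset_span (self_mem_orb _ _), rfl⟩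
  have : Nontrivial W := ⟨⟨⟨δ a, haW⟩, 0, fun h => by
    have := congrArg Subtype.val h
    exact ha (sub_eq_zero.1 this)⟩⟩
  obtain ⟨ζ, hζ⟩ := Module.End.exists_eigenvalue (j.toLinearMap.restrict hjW)
  obtain ⟨⟨θ, u, hu, hθ⟩, hv⟩ := hζ.exists_hasEigenvector
  have hθ0 : θ ≠ 0 := fun h => hv.2 (Subtype.ext h)
  have hj : j θ = ζ • θ := congrArg Subtype.val hv.apply_eq_smul
  refine ⟨ζ, θ, ?_, hθ0, ?_, hj⟩
  · rintro rfl
    rw [one_smul] at hj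
    refine orb_zpowers_infinite hθ0 hj (a := u) ?_ (hfin u (hUE u hu))
    rw [← hθ, hδ]
    ring
  · rw [← hθ, hδ]
    exact E.sub_mem (hUE _ (hjU u hu)) (hUE u hu)

variable [IsAlgClosed F]

theorem exists_notMem_locFin [CharZero F] (hψ' : NbhdCont ψ.symm) {T : Set F} (hT : T.Finite)
    (hT' : acl k T = ⊤) {z : F} (hz : z ∉ acl k {x}) : ∃ c, c ∉ locFin ψ x := by
  by_contra! hall
  obtain ⟨S, -, hSx, hS⟩ := exists_uniform_of_subset_locFin (ψ := ψ) (x := x) hT fun c _ => hall c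
  obtain ⟨j, hj, hjz⟩ := exists_fixS_of_notMem_acl hz (b := z + 1) fun h => hz (by
    simpa using (acl k {x}).sub_mem h (acl k {x}).one_mem)
  have h1 : TB (Subgroup.zpowers (ψ j)) := by
    intro a
    have h2 := hS {j} (Set.finite_singleton j) (Set.singleton_subset_iff.2 (fixS_anti hSx hj))
    have h3 : a ∈ acl k (fixedBy ψ {j}) := acl_le_of_subset h2 (by rw [hT']; trivial)
    refine (orb_finite_of_mem_acl h3).subset (orb_mono ?_ a)
    rw [Subgroup.zpowers_le]
    exact fun s hs => hs j rfl
  have h2 := h1.map hψ'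
  rw [MonoidHom.map_zpowers] at h2
  have h3 : ψ.symm.toMonoidHom (ψ j) = j := ψ.symm_apply_apply j
  rw [h3] at h2
  exact orb_zpowers_infinite one_ne_zero (map_one j) hjz (h2 z)

/-- The image under `ψ` of the stabilizer of a one-dimensional closed subfield is a maximal
subgroup. -/
theorem mem_acl_of_stable_locFin [IsAlgClosed k] {c d : F} (hc : c ∉ (⊥ : IntermediateField k F))
    (hcL : c ∈ locFin ψ x) (hd : d ∉ locFin ψ x) {p : F ≃ₐ[k] F}
    (hp : ∀ a ∈ locFin ψ x, p a ∈ locFin ψ x) : ψ.symm p x ∈ acl k {x} := by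
  by_contra hq
  have hall : ∀ g : F ≃ₐ[k] F, ∀ a ∈ locFin ψ x, ψ g a ∈ locFin ψ x := by
    intro g a ha
    by_cases hg : g x ∈ acl k {x}
    · exact map_mem_locFin hg ha
    · obtain ⟨h, hh, hgx⟩ := exists_fixS_of_notMem_acl hq hg
      have hhx : h x = x := hh x (subset_acl _ rfl)
      have hs : (g⁻¹ * h * ψ.symm p)⁻¹ x = x := by
        have : (g⁻¹ * h * ψ.symm p) x = x := by
          rw [AlgEquiv.mul_apply, AlgEquiv.mul_apply, hgx]
          exact g.symm_apply_apply x
        conv_lhs => rw [← this]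
        exact (g⁻¹ * h * ψ.symm p).symm_apply_apply x
      have hg' : g = h * ψ.symm p * (g⁻¹ * h * ψ.symm p)⁻¹ := by group
      rw [hg', map_mul, map_mul, ψ.apply_symm_apply, AlgEquiv.mul_apply, AlgEquiv.mul_apply]
      refine map_mem_locFin (by rw [hhx]; exact subset_acl _ rfl) (hp _ (map_mem_locFin ?_ ha))
      rw [hs]; exact subset_acl _ rfl
  have hd' : d ∉ (⊥ : IntermediateField k F) := by
    intro h
    rw [← acl_locFin] at hd
    exact hd ((bot_le : ⊥ ≤ acl k (locFin ψ x)) h)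
  rw [← acl_empty] at hc hd'
  obtain ⟨g, -, hg⟩ := exists_fixS_of_notMem_acl hc hd'
  refine hd ?_
  have := hall (ψ.symm g) c hcL
  rwa [ψ.apply_symm_apply, hg] at this

/-- A transcendental element of a closed subfield can be translated by an automorphism that
preserves the subfield. -/
theorem exists_translation [IsAlgClosed k] {E : IntermediateField k F} (hE : acl k (E : Set F) = E) {θ : F}
    (hθ : θ ∉ (⊥ : IntermediateField k F)) (hθE : θ ∈ E) :
    ∃ p : F ≃ₐ[k] F, p θ = θ + 1 ∧ ∀ a ∈ E, p a ∈ E := by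
  let M := AlgebraicIndependent.matroid k F
  have hM : ∀ S : Set F, M.closure S = acl k S := fun S => (coe_acl S).symm
  have hi : M.Indep {θ} := by
    rw [← insert_empty_eq, M.empty_indep.insert_indep_iff_of_notMem (Set.notMem_empty θ), hM,
      acl_empty]
    exact ⟨trivial, hθ⟩
  obtain ⟨I, hI, hθI⟩ := hi.subset_isBasis_of_subset (Set.singleton_subset_iff.2 hθE)
    (Set.subset_univ _)
  have hθ' : θ ∉ acl k (I \ {θ}) := by
    have := hI.indep.notMem_closure_sdiff_of_mem (Set.singleton_subset_iff.1 hθI)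
    rwa [hM] at this
  obtain ⟨p, hp, hpθ⟩ := exists_fixS_of_notMem_acl hθ' (b := θ + 1) fun h => hθ' (by
    simpa using (acl k (I \ {θ})).sub_mem h (one_mem _))
  have hIE : (acl k I : Set F) = E := by
    rw [← hM, hI.closure_eq_closure, hM, hE]
  refine ⟨p, hpθ, fun a ha => ?_⟩
  have ha' : a ∈ (acl k I : Set F) := by rw [hIE]; exact ha
  have h1 : p a ∈ acl k (p '' I) := by
    rw [← SetLike.mem_coe, acl_image]; exact ⟨a, ha', rfl⟩
  rw [← hE]
  refine acl_mono ?_ h1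
  rintro _ ⟨i, hiI, rfl⟩
  by_cases hiθ : i = θ
  · rw [hiθ, hpθ]
    exact E.add_mem hθE E.one_mem
  · rw [hp i (subset_acl _ ⟨hiI, hiθ⟩)]
    exact hI.subset hiI

theorem fixed_of_locFin [IsAlgClosed k] [CharZero F] (hx : x ∉ (⊥ : IntermediateField k F)) {c d : F} (hc : c ∉ (⊥ : IntermediateField k F))
    (hcL : c ∈ locFin ψ x) (hd : d ∉ locFin ψ x) {g : F ≃ₐ[k] F}
    (hg : g ∈ fixS k (acl k {x} : Set F)) : ψ g ∈ fixS k (locFin ψ x) := by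
  intro a ha
  by_contra hne
  have hE : ∀ b, b ∈ acl k (locFin ψ x) ↔ b ∈ locFin ψ x := fun b => by
    rw [← SetLike.mem_coe, acl_locFin]
  have hmap : ∀ g ∈ fixS k (acl k {x} : Set F), ∀ b ∈ locFin ψ x, ψ g b ∈ locFin ψ x :=
    fun g hg b hb => map_mem_locFin (by
      rw [hg x (subset_acl _ rfl)]; exact subset_acl _ rfl) hb
  obtain ⟨ζ, θ, hζ, hθ0, hθE, hθ⟩ := exists_eigenvector (orb_finite_of_locFin hg ha) hne
    (E := acl k (locFin ψ x)) (by
      rintro _ ⟨_, ⟨m, rfl⟩, rfl⟩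
      refine (hE _).2 ?_
      simp only [← map_zpow]
      exact hmap _ (zpow_mem hg m) a ha)
    fun b hb => orb_finite_of_locFin hg ((hE b).1 hb)
  have hθb : θ ∉ (⊥ : IntermediateField k F) := by
    intro h
    obtain ⟨t, rfl⟩ := IntermediateField.mem_bot.1 h
    rw [AlgEquiv.commutes, Algebra.smul_def, eq_comm, mul_eq_right₀ hθ0] at hθ
    exact hζ ((algebraMap k F).injective (by rw [hθ, map_one]))
  obtain ⟨p, hpθ, hp⟩ := exists_translation (acl_acl _) hθb hθE
  have hq := mem_acl_of_stable_locFin hc hcL hd (p := p) fun a ha => (hE _).1 (hp a ((hE a).2 ha))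
  have hinv : ∀ e ∈ acl k {x}, (ψ.symm p)⁻¹ e ∈ acl k {x} := by
    intro e he
    have h1 : acl k {ψ.symm p x} = acl k {x} := acl_eq_of_mem hq (by
      rw [acl_empty] at *
      intro h
      obtain ⟨t, ht⟩ := IntermediateField.mem_bot.1 h
      refine hx (IntermediateField.mem_bot.2 ⟨t, ?_⟩)
      exact (ψ.symm p).injective (((ψ.symm p).commutes t).trans ht))
    have h2 : e ∈ (acl k ((ψ.symm p) '' {x}) : Set F) := by
      rw [Set.image_singleton, h1]; exact he
    rw [acl_image] at h2
    obtain ⟨e', he', rfl⟩ := h2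
    rwa [show (ψ.symm p)⁻¹ ((ψ.symm p) e') = e' from (ψ.symm p).symm_apply_apply e']
  have hj : ψ.symm p * g * (ψ.symm p)⁻¹ * g⁻¹ ∈ fixS k (acl k {x} : Set F) := by
    refine mul_mem (fun e he => ?_) (inv_mem hg)
    rw [AlgEquiv.mul_apply, AlgEquiv.mul_apply, hg _ (hinv e he)]
    exact (ψ.symm p).apply_symm_apply e
  refine orb_zpowers_infinite (d := algebraMap k F (ζ - 1)) ?_ (AlgEquiv.commutes _ _)
    (a := ψ g θ) ?_ (orb_finite_of_locFin hj (hmap g hg _ ((hE θ).1 hθE)))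
  · rw [_root_.map_ne_zero]
    exact sub_ne_zero.2 hζ
  · have hpi : p⁻¹ θ = θ - 1 := by
      have : p (θ - 1) = θ := by rw [map_sub, hpθ, map_one]; ring
      conv_lhs => rw [← this]
      exact p.symm_apply_apply _
    rw [map_mul, map_mul, map_mul, map_inv, map_inv, ψ.apply_symm_apply, AlgEquiv.mul_apply,
      AlgEquiv.mul_apply, AlgEquiv.mul_apply,
      show (ψ g)⁻¹ (ψ g θ) = θ from (ψ g).symm_apply_apply θ, hpi, map_sub, map_one, hθ, map_sub,
      map_one, Algebra.smul_def, map_mul, AlgEquiv.commutes, hpθ, map_sub, map_one]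
    ring

variable [IsAlgClosed k] [CharZero F]

/-- The property of `ψ` that the image of every finite set of automorphisms fixing some
transcendental element fixes a transcendental element. -/
def HasInvariants (ψ : (F ≃ₐ[k] F) ≃* (F ≃ₐ[k] F)) : Prop :=
  ∃ x ∉ (⊥ : IntermediateField k F), ∀ Φ : Set (F ≃ₐ[k] F), Φ.Finite → Φ ⊆ fixS k {x} →
    ∃ c ∉ (⊥ : IntermediateField k F), c ∈ fixedBy ψ Φ

theorem exists_closed_fixed (hψ' : NbhdCont ψ.symm) (hψ : HasInvariants ψ)
    {T : Set F} (hT : T.Finite) (hT' : acl k T = ⊤) (hx : x ∉ (⊥ : IntermediateField k F))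
    (hz : ∃ z, z ∉ acl k {x}) : ∃ f ∉ (⊥ : IntermediateField k F),
      ∀ g ∈ fixS k (acl k {x} : Set F), ψ g ∈ fixS k (acl k {f} : Set F) := by
  obtain ⟨z, hz⟩ := hz
  have hinv : ∀ Φ : Set (F ≃ₐ[k] F), Φ.Finite → Φ ⊆ fixS k {x} →
      ∃ c ∉ (⊥ : IntermediateField k F), c ∈ fixedBy ψ Φ := by
    intro Φ hΦ hΦx
    obtain ⟨x₀, hx₀, h⟩ := hψ
    rw [← acl_empty] at hx₀ hx
    obtain ⟨s, -, hs⟩ := exists_fixS_of_notMem_acl hx₀ hx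
    obtain ⟨c, hc, hc'⟩ := h ((fun g => s⁻¹ * g * s) '' Φ) (hΦ.image _) (by
      rintro _ ⟨g, hg, rfl⟩ t rfl
      rw [AlgEquiv.mul_apply, AlgEquiv.mul_apply, hs, hΦx hg x rfl, ← hs]
      exact s.symm_apply_apply t)
    refine ⟨ψ s c, fun h => hc ?_, fun g hg => ?_⟩
    · obtain ⟨t, ht⟩ := IntermediateField.mem_bot.1 h
      exact IntermediateField.mem_bot.2 ⟨t, (ψ s).injective (((ψ s).commutes t).trans ht)⟩
    · have h3 := hc' _ ⟨g, hg, rfl⟩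
      rw [map_mul, map_mul, map_inv, AlgEquiv.mul_apply, AlgEquiv.mul_apply] at h3
      exact ((ψ s).apply_symm_apply _).symm.trans (congrArg (ψ s) h3)
  obtain ⟨c, hc, hcΦ⟩ := exists_mem_acl_fixedBy hT hT' hinv
  have hcL : c ∈ locFin ψ x := ⟨{x}, Set.finite_singleton x, subset_acl _, hcΦ⟩
  obtain ⟨d, hd⟩ := exists_notMem_locFin hψ' hT hT' hz
  refine ⟨c, hc, fun g hg a ha => fixed_of_locFin hx hc hcL hd hg a ?_⟩
  rw [← acl_locFin]
  exact acl_le_of_subset (Set.singleton_subset_iff.2 (subset_acl _ hcL)) ha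

theorem exists_acl_correspondence_of_invariants (hψ : NbhdCont ψ) (hψ' : NbhdCont ψ.symm)
    (hi : HasInvariants ψ) (hi' : HasInvariants ψ.symm) {T : Set F} (hT : T.Finite)
    (hT' : acl k T = ⊤) (hz : ∀ x : F, ∃ z, z ∉ acl k {x}) :
    ∃ x f : F, x ∉ (⊥ : IntermediateField k F) ∧ f ∉ (⊥ : IntermediateField k F) ∧
      ∀ g, g ∈ fixS k (acl k {x} : Set F) ↔ ψ g ∈ fixS k (acl k {f} : Set F) := by
  obtain ⟨x, hx, -⟩ := id hi
  obtain ⟨f, hf, h1⟩ := exists_closed_fixed hψ' hi hT hT' hx (hz x)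
  obtain ⟨c, hc, h2⟩ := exists_closed_fixed (ψ := ψ.symm) hψ hi' hT hT' hf (hz f)
  have hcx : c ∈ acl k {x} := fixed_acl_iff.1 fun g hg => by
    have := h2 _ (h1 g hg)
    rw [ψ.symm_apply_apply] at this
    exact this c (subset_acl _ rfl)
  have he : acl k {c} = acl k {x} := acl_eq_of_mem hcx (by rwa [acl_empty])
  refine ⟨x, f, hx, hf, fun g => ⟨h1 g, fun hg => ?_⟩⟩
  have := h2 _ hg
  rwa [ψ.symm_apply_apply, he] at this

end FiniteTrdeg

section FinitelyGenerated
open IntermediateField Polynomial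

/-- In a factorial domain, a squarefree element divides any element divisible by all of its
prime factors. -/
theorem dvd_of_squarefree_of_prime_dvd {R : Type*} [CommRing R] [IsDomain R]
    [UniqueFactorizationMonoid R] {p c : R} (hp : Squarefree p)
    (h : ∀ π, Prime π → π ∣ p → π ∣ c) : p ∣ c := by
  classical
  let _ : StrongNormalizationMonoid R := UniqueFactorizationMonoid.strongNormalizationMonoid
  rcases eq_or_ne c 0 with rfl | hc
  · exact dvd_zero p
  have hp0 := hp.ne_zero
  rw [UniqueFactorizationMonoid.dvd_iff_normalizedFactors_le_normalizedFactors hp0 hc,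
    Multiset.le_iff_subset
      ((UniqueFactorizationMonoid.squarefree_iff_nodup_normalizedFactors hp0).1 hp)]
  intro π hπ
  rw [UniqueFactorizationMonoid.mem_normalizedFactors_iff' hp0] at hπ
  rw [UniqueFactorizationMonoid.mem_normalizedFactors_iff' hc]
  exact ⟨hπ.1, hπ.2.1, h π hπ.1.prime hπ.2.2⟩

/-- If `P` is separable modulo every prime not dividing `δ` and `f ^ 2` vanishes modulo `P` and a
squarefree `p`, then `f` vanishes modulo `p` up to the factor `δ`. -/
theorem dvd_mul_coeff_of_sq {R : Type*} [CommRing R] [IsDomain R]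
    [UniqueFactorizationMonoid R] {P f h q u w : R[X]} {δ p : R} (hP : P.Monic)
    (hδ : u * P + w * derivative P = C δ) (hf : f.degree < P.degree)
    (hsq : f ^ 2 = C p * h + P * q) (hp : Squarefree p) (i : ℕ) : p ∣ δ * f.coeff i := by
  refine dvd_of_squarefree_of_prime_dvd hp fun π hπ hπp ↦ ?_
  by_cases hd : π ∣ δ
  · exact hd.mul_right _
  refine Dvd.dvd.mul_left ?_ _
  have hprime : (Ideal.span {π}).IsPrime := (Ideal.span_singleton_prime hπ.ne_zero).2 hπ
  let κ := FractionRing (R ⧸ Ideal.span {π})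
  let φ : R →+* κ := (algebraMap (R ⧸ Ideal.span {π}) κ).comp (Ideal.Quotient.mk _)
  have hφ : ∀ a, φ a = 0 ↔ π ∣ a := fun a ↦ by
    rw [← Ideal.mem_span_singleton, ← Ideal.Quotient.eq_zero_iff_mem]
    exact map_eq_zero_iff _ (IsFractionRing.injective (R ⧸ Ideal.span {π}) κ)
  have hsep : (P.map φ).Separable := by
    have h1 := congrArg (Polynomial.map φ) hδ
    simp only [Polynomial.map_add, Polynomial.map_mul, ← derivative_map, Polynomial.map_C] at h1
    have h2 : φ δ ≠ 0 := fun h0 ↦ hd ((hφ δ).1 h0)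
    refine ⟨C (φ δ)⁻¹ * u.map φ, C (φ δ)⁻¹ * w.map φ, ?_⟩
    rw [mul_assoc, mul_assoc, ← mul_add, h1, ← C_mul, inv_mul_cancel₀ h2, C_1]
  have hdvd : P.map φ ∣ f.map φ ^ 2 := by
    have h1 := congrArg (Polynomial.map φ) hsq
    rw [Polynomial.map_add, Polynomial.map_mul, Polynomial.map_mul, Polynomial.map_C,
      (hφ p).2 hπp, C_0, zero_mul, zero_add, Polynomial.map_pow] at h1
    exact ⟨_, h1⟩
  have hdvd' : P.map φ ∣ f.map φ := (hsep.squarefree.dvd_pow_iff_dvd two_ne_zero).1 hdvd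
  have h0 : f.map φ = 0 := by
    refine eq_zero_of_dvd_of_degree_lt hdvd' ?_
    rw [hP.degree_map φ]
    exact (degree_map_le).trans_lt hf
  rw [← hφ, ← coeff_map, h0, coeff_zero]

theorem exists_pow_smul_isIntegral {R M : Type*} [CommRing R] [CommRing M] [Algebra R M]
    {Q : Set M} {s : R} (hs : ∀ q ∈ Q, IsIntegral R (s • q)) {b : M}
    (hb : b ∈ Algebra.adjoin R Q) : ∃ m : ℕ, IsIntegral R (s ^ m • b) := by
  induction hb using Algebra.adjoin_induction with
  | mem x hx => exact ⟨1, by simpa using hs x hx⟩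
  | algebraMap r => exact ⟨0, by simpa using isIntegral_algebraMap⟩
  | add x y _ _ hx hy =>
    obtain ⟨m, hm⟩ := hx
    obtain ⟨l, hl⟩ := hy
    refine ⟨m + l, ?_⟩
    have : s ^ (m + l) • (x + y) = s ^ l • (s ^ m • x) + s ^ m • (s ^ l • y) := by
      rw [smul_smul, smul_smul, ← pow_add, ← pow_add, smul_add, add_comm l m]
    rw [this]
    exact (hm.smul _).add (hl.smul _)
  | mul x y _ _ hx hy =>
    obtain ⟨m, hm⟩ := hx
    obtain ⟨l, hl⟩ := hy
    refine ⟨m + l, ?_⟩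
    have : s ^ (m + l) • (x * y) = (s ^ m • x) * (s ^ l • y) := by
      rw [smul_mul_smul_comm, pow_add]
    rw [this]
    exact hm.mul hl

theorem exists_bezout_derivative {R : Type*} (K : Type*) [CommRing R] [IsDomain R] [Field K]
    [Algebra R K] [IsFractionRing R K] {P : R[X]} (hP : (P.map (algebraMap R K)).Separable) :
    ∃ (u w : R[X]) (δ : R), δ ≠ 0 ∧ u * P + w * derivative P = C δ := by
  obtain ⟨a, b, hab⟩ := hP
  obtain ⟨c, hc, hc'⟩ := IsLocalization.integerNormalization_spec (nonZeroDivisors R) a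
  obtain ⟨d, hd, hd'⟩ := IsLocalization.integerNormalization_spec (nonZeroDivisors R) b
  refine ⟨C d * IsLocalization.integerNormalization (nonZeroDivisors R) a,
    C c * IsLocalization.integerNormalization (nonZeroDivisors R) b, c * d,
    mul_ne_zero (nonZeroDivisors.ne_zero hc) (nonZeroDivisors.ne_zero hd), ?_⟩
  apply Polynomial.map_injective (algebraMap R K) (IsFractionRing.injective R K)
  simp only [Polynomial.map_add, Polynomial.map_mul, Polynomial.map_C, hc', hd', ← derivative_map]
  rw [Algebra.smul_def, Algebra.smul_def, Polynomial.algebraMap_apply, Polynomial.algebraMap_apply, RingHom.map_mul]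
  simp only [C_mul]
  linear_combination (C (algebraMap R K c) * C (algebraMap R K d)) * hab

/-- A multiplier `s` and a generator `θ` such that every `z` whose square becomes a polynomial in
`Q` after multiplication by a squarefree element lies in `R[θ, 1/s]`. -/
theorem exists_pow_smul_mem_adjoin {R K M : Type*} [CommRing R] [IsDomain R]
    [UniqueFactorizationMonoid R] [Field K] [Algebra R K] [IsFractionRing R K] [Field M]
    [Algebra K M] [Algebra R M] [IsScalarTower R K M] [FiniteDimensional K M]
    [Algebra.IsSeparable K M] (Q : Finset M) :
    ∃ s : R, s ≠ 0 ∧ ∃ θ : M, ∀ (p : R) (z : M), Squarefree p →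
      z ^ 2 * algebraMap R M p ∈ Algebra.adjoin R (Q : Set M) →
      ∃ N : ℕ, s ^ N • z ∈ Algebra.adjoin R {θ} := by
  have halg : Algebra.IsAlgebraic R M :=
    (IsFractionRing.comap_isAlgebraic_iff (A := R) (K := K) (C := M)).2 inferInstance
  have hinj : Function.Injective (algebraMap R M) := by
    rw [IsScalarTower.algebraMap_eq R K M]
    exact (algebraMap K M).injective.comp (IsFractionRing.injective R K)
  have htf : Module.IsTorsionFree R M := Module.IsTorsionFree.trans_faithfulSMul R K M
  obtain ⟨s₀, hs₀, hinteg⟩ := Algebra.IsAlgebraic.exists_integral_multiples R Q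
  obtain ⟨θ₀, hθ₀⟩ := Field.exists_primitive_element K M
  obtain ⟨c, hc, hcθ⟩ := (halg.1 θ₀).exists_integral_multiple
  let θ := c • θ₀
  have hθ : K⟮θ⟯ = ⊤ := by
    rw [eq_top_iff, ← hθ₀, adjoin_simple_le_iff]
    have h1 : θ₀ = (algebraMap R K c)⁻¹ • θ := by
      rw [show θ = algebraMap R K c • θ₀ from (algebraMap_smul K c θ₀).symm, inv_smul_smul₀]
      rwa [Ne, map_eq_zero_iff _ (IsFractionRing.injective R K)]
    rw [h1]
    exact K⟮θ⟯.smul_mem (mem_adjoin_simple_self K θ)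
  let B : PowerBasis K M := (adjoin.powerBasis (Algebra.IsIntegral.isIntegral (R := K) θ)).map
    ((IntermediateField.equivOfEq hθ).trans topEquiv)
  have hB : B.gen = θ := rfl
  obtain ⟨d, hd⟩ : ∃ d : R, algebraMap R K d = Algebra.discr K B.basis := by
    refine IsIntegrallyClosed.isIntegral_iff.1 (Algebra.discr_isIntegral K fun i ↦ ?_)
    rw [B.basis_eq_pow, hB]
    exact hcθ.pow _
  have hd0 : d ≠ 0 := by
    rintro rfl
    rw [map_zero] at hd
    exact Algebra.discr_not_zero_of_basis K B.basis hd.symm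
  have hdm : ∀ z : M, IsIntegral R z → d • z ∈ Algebra.adjoin R {θ} := fun z hz ↦ by
    have := Algebra.discr_mul_isIntegral_mem_adjoin K (B := B) hcθ hz
    rwa [← hd, algebraMap_smul] at this
  have hmin := minpoly.isIntegrallyClosed_eq_field_fractions' K hcθ
  have hmonic := minpoly.monic hcθ
  obtain ⟨u, w, δ, hδ, hbez⟩ := exists_bezout_derivative K (P := minpoly R θ)
    (hmin ▸ Algebra.IsSeparable.isSeparable K θ)
  refine ⟨s₀ * d * δ, mul_ne_zero (mul_ne_zero hs₀ hd0) hδ, θ, fun p z hp hz ↦ ?_⟩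
  obtain ⟨m, hm⟩ := exists_pow_smul_isIntegral hinteg hz
  have hpM : algebraMap R M p ≠ 0 := by
    rw [Ne, map_eq_zero_iff _ hinj]; exact hp.ne_zero
  let W₀ := s₀ ^ m • (z * algebraMap R M p)
  have hW₀ : IsIntegral R W₀ := by
    refine IsIntegral.of_pow two_pos ?_
    have : W₀ ^ 2 = (s₀ ^ m * p) • (s₀ ^ m • (z ^ 2 * algebraMap R M p)) := by
      simp only [W₀, Algebra.smul_def, map_mul]; ring
    rw [this]
    exact hm.smul _
  have hW := hdm _ hW₀
  have hH := (Algebra.adjoin R {θ}).smul_mem (hdm _ hm) (d * s₀ ^ m)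
  rw [Algebra.adjoin_singleton_eq_range_aeval] at hW hH
  obtain ⟨f₀, hf₀⟩ := hW
  obtain ⟨h, hh⟩ := hH
  change aeval θ f₀ = _ at hf₀
  change aeval θ h = _ at hh
  set f := f₀ %ₘ minpoly R θ with hf
  have hfW : aeval θ f = d • W₀ := by
    rw [← hf₀, ← modByMonic_add_div f₀ (minpoly R θ), map_add, map_mul, minpoly.aeval, zero_mul,
      add_zero]
  obtain ⟨q, hq⟩ : minpoly R θ ∣ f ^ 2 - C p * h := by
    refine minpoly.isIntegrallyClosed_dvd hcθ ?_
    rw [map_sub, map_mul, map_pow, hfW, aeval_C, hh]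
    simp only [W₀, Algebra.smul_def, map_mul]; ring
  have hcoeff := fun i ↦ dvd_mul_coeff_of_sq hmonic hbez (degree_modByMonic_lt f₀ hmonic)
    (show f ^ 2 = C p * h + minpoly R θ * q by rw [← hq]; ring) hp i
  obtain ⟨X', hX'⟩ : C p ∣ C δ * f := by
    rw [C_dvd_iff_dvd_coeff]
    intro i
    rw [coeff_C_mul]
    exact hcoeff i
  have hX : (δ * d * s₀ ^ m) • z = aeval θ X' := by
    apply mul_right_cancel₀ hpM
    have := congrArg (aeval θ) hX'
    rw [map_mul, map_mul, aeval_C, aeval_C, hfW] at this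
    rw [mul_comm (aeval θ X'), ← this]
    simp only [W₀, Algebra.smul_def, map_mul]; ring
  refine ⟨m + 1, ?_⟩
  have : (s₀ * d * δ) ^ (m + 1) • z = (s₀ * d ^ m * δ ^ m) • ((δ * d * s₀ ^ m) • z) := by
    rw [smul_smul]; congr 1; ring
  rw [this, hX, Algebra.adjoin_singleton_eq_range_aeval]
  exact (aeval θ).range.smul_mem (AlgHom.mem_range_self _ X') _

theorem Squarefree.map_mulEquiv {R S : Type*} [Monoid R] [Monoid S] (e : R ≃* S) {p : R}
    (hp : Squarefree p) : Squarefree (e p) := by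
  intro x hx
  have h1 : e.symm x * e.symm x ∣ p := by
    have := map_dvd e.symm hx
    rwa [map_mul, MulEquiv.symm_apply_apply] at this
  have := (hp _ h1).map e
  rwa [MulEquiv.apply_symm_apply] at this

open scoped IntermediateField.algebraAdjoinAdjoin in
/-- Square roots of quotients of squarefree polynomials in two transcendence bases lie in a common
finitely generated algebra. -/
theorem exists_finite_mem_algebraAdjoin {k F : Type*} [Field k] [Field F] [Algebra k F]
    [CharZero k] {ι : Type*} [Finite ι] {y y' : ι → F} (hy : IsTranscendenceBasis k y) :
    ∃ D : Set F, D.Finite ∧ ∀ (p p' : MvPolynomial ι k) (z : F), Squarefree p →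
      z ∈ adjoin k (Set.range y ∪ Set.range y') →
      z ^ 2 * MvPolynomial.aeval y p = MvPolynomial.aeval y' p' →
      z ∈ Algebra.adjoin k D := by
  let R := Algebra.adjoin k (Set.range y)
  let K := adjoin k (Set.range y)
  have halg : Algebra.IsAlgebraic K F := hy.isAlgebraic_field
  have hchar : CharZero K := charZero_of_injective_algebraMap (algebraMap k K).injective
  let e : MvPolynomial ι k ≃ₐ[k] R := hy.1.aevalEquiv
  have hufd : UniqueFactorizationMonoid R :=
    e.toMulEquiv.uniqueFactorizationMonoid inferInstance
  let M : IntermediateField K F := adjoin K (Set.range y')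
  have hfin : FiniteDimensional K M :=
    finiteDimensional_adjoin fun x _ ↦ Algebra.IsIntegral.isIntegral x
  let _ : Algebra R M := ((algebraMap K M).comp (algebraMap R K)).toAlgebra
  have htow : IsScalarTower R K M := IsScalarTower.of_algebraMap_eq fun _ ↦ rfl
  have hRF : ∀ r : R, ((algebraMap R M r : M) : F) = r := fun _ ↦ rfl
  have hMy' : ∀ i, y' i ∈ M := fun i ↦ subset_adjoin K _ ⟨i, rfl⟩
  let Q : Finset M := (Set.finite_range fun i ↦ (⟨y' i, hMy' i⟩ : M)).toFinset
  obtain ⟨s, hs, θ, h⟩ := exists_pow_smul_mem_adjoin (R := R) (K := K) (M := M) Q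
  refine ⟨Set.range y ∪ {(θ : F), ((s : F))⁻¹}, (Set.finite_range y).union (by simp), ?_⟩
  intro p p' z hp hz hzp
  set D : Set F := Set.range y ∪ {(θ : F), ((s : F))⁻¹} with hD
  have hRD : R ≤ Algebra.adjoin k D := Algebra.adjoin_mono Set.subset_union_left
  have hzM : z ∈ M := by
    have h1 : adjoin k (Set.range y ∪ Set.range y') ≤ M.restrictScalars k := by
      rw [adjoin_le_iff]
      rintro _ (hx | ⟨i, rfl⟩)
      · exact M.algebraMap_mem (⟨_, subset_adjoin k _ hx⟩ : K)
      · exact hMy' i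
    exact h1 hz
  have hbase : ∀ r : R, (r : F) ∈ Algebra.adjoin k D := fun r ↦ hRD r.2
  have hθ : ∀ t ∈ Algebra.adjoin R {θ}, (t : F) ∈ Algebra.adjoin k D := fun t ht ↦ by
    induction ht using Algebra.adjoin_induction with
    | mem x hx =>
      rw [Set.mem_singleton_iff.1 hx]
      exact Algebra.subset_adjoin (by simp [hD])
    | algebraMap r => exact hbase r
    | add x y _ _ hx hy => exact add_mem hx hy
    | mul x y _ _ hx hy => exact mul_mem hx hy
  have hp' : ∀ q : MvPolynomial ι k, ∃ t ∈ Algebra.adjoin R (Q : Set M),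
      (t : F) = MvPolynomial.aeval y' q := fun q ↦ by
    induction q using MvPolynomial.induction_on with
    | C a => exact ⟨algebraMap R M (algebraMap k R a), Subalgebra.algebraMap_mem _ _, by
        rw [hRF, MvPolynomial.aeval_C]; rfl⟩
    | add q r hq hr =>
      obtain ⟨t, ht, ht'⟩ := hq
      obtain ⟨v, hv, hv'⟩ := hr
      exact ⟨t + v, add_mem ht hv, by rw [map_add, ← ht', ← hv']; rfl⟩
    | mul_X q i hq =>
      obtain ⟨t, ht, ht'⟩ := hq
      refine ⟨t * ⟨y' i, hMy' i⟩, mul_mem ht (Algebra.subset_adjoin ?_), ?_⟩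
      · simp [Q]
      · rw [map_mul, ← ht', MvPolynomial.aeval_X]; rfl
  obtain ⟨t, ht, ht'⟩ := hp' p'
  have heq : (⟨z, hzM⟩ : M) ^ 2 * algebraMap R M (e p) = t := by
    apply Subtype.ext
    rw [ht', ← hzp]
    exact congrArg (z ^ 2 * ·) (hy.1.algebraMap_aevalEquiv p)
  obtain ⟨N, hN⟩ := h (e p) ⟨z, hzM⟩ (hp.map_mulEquiv e.toMulEquiv) (heq ▸ ht)
  have h1 := hθ _ hN
  have h2 : ((s ^ N • (⟨z, hzM⟩ : M) : M) : F) = (s : F) ^ N * z := by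
    rw [Algebra.smul_def]; rfl
  rw [h2] at h1
  have h3 : z = ((s : F)⁻¹) ^ N * ((s : F) ^ N * z) := by
    have : (s : F) ≠ 0 := by simpa using hs
    rw [inv_pow, inv_mul_cancel_left₀ (pow_ne_zero _ this)]
  rw [h3]
  exact mul_mem (pow_mem (Algebra.subset_adjoin (by simp [hD])) _) h1

/-- Finitely many valuations detect integrality among the units of a finitely generated algebra. -/
theorem exists_finite_valuations {A K M : Type*} [CommRing A] [IsDedekindDomain A] [Field K]
    [Algebra A K] [IsFractionRing A K] [Field M] [Algebra K M] [Algebra A M] [IsScalarTower A K M]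
    [FiniteDimensional K M] [Algebra.IsSeparable K M] {D : Set M} (hD : D.Finite) :
    ∃ S : Set (M → ℤ), S.Finite ∧ (∀ ν ∈ S, ∀ a b, a ≠ 0 → b ≠ 0 → ν (a * b) = ν a + ν b) ∧
      ∀ a ∈ Algebra.adjoin A D, (∀ ν ∈ S, ν a = 0) → IsIntegral A a := by
  let B := integralClosure A M
  have hB : IsDedekindDomain B := integralClosure.isDedekindDomain A K M
  have hBM : IsFractionRing B M := integralClosure.isFractionRing_of_finite_extension K M
  let bad : Set (IsDedekindDomain.HeightOneSpectrum B) :=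
    ⋃ d ∈ D, IsDedekindDomain.HeightOneSpectrum.Support B d
  refine ⟨(fun v (a : M) ↦ WithZero.log (v.valuation M a)) '' bad, ?_, ?_, ?_⟩
  · exact (hD.biUnion fun d _ ↦ IsDedekindDomain.HeightOneSpectrum.Support.finite B d).image _
  · rintro _ ⟨v, _, rfl⟩ a b ha hb
    simp only [map_mul]
    exact WithZero.log_mul (by simpa using ha) (by simpa using hb)
  · intro a ha h
    rcases eq_or_ne a 0 with rfl | ha0
    · exact isIntegral_zero
    have key : ∀ v : IsDedekindDomain.HeightOneSpectrum B, v.valuation M a ≤ 1 := fun v ↦ by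
      by_cases hv : v ∈ bad
      · have h1 : WithZero.log (v.valuation M a) = 0 := h _ ⟨v, hv, rfl⟩
        have h2 : v.valuation M a ≠ 0 := by simpa using ha0
        rw [← WithZero.exp_log h2, h1, WithZero.exp_zero]
      · have h1 : ∀ d ∈ D, v.valuation M d ≤ 1 := fun d hd ↦ by
          by_contra hlt
          exact hv (Set.mem_biUnion hd (not_le.1 hlt))
        clear h ha0
        induction ha using Algebra.adjoin_induction with
        | mem x hx => exact h1 x hx
        | algebraMap r => exact v.valuation_le_one (K := M) (algebraMap A B r)
        | add x y _ _ hx hy => exact (v.valuation M).map_add_le hx hy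
        | mul x y _ _ hx hy => rw [map_mul]; exact mul_le_one' hx hy
    obtain ⟨b, rfl⟩ := IsDedekindDomain.HeightOneSpectrum.mem_integers_of_valuation_le_one (R := B) M a key
    exact b.2

open scoped IntermediateField.algebraAdjoinAdjoin in
theorem exists_finite_valuations_over {L F : Type*} [Field L] [Field F] [Algebra L F] [CharZero L]
    {Y : F} (hY : Transcendental L Y) [Algebra.IsAlgebraic L⟮Y⟯ F] {D : Set F} (hD : D.Finite) :
    ∃ S : Set (F → ℤ), S.Finite ∧
      (∀ ν ∈ S, ∀ a ∈ Algebra.adjoin L D, ∀ b ∈ Algebra.adjoin L D, a ≠ 0 → b ≠ 0 →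
        ν (a * b) = ν a + ν b) ∧
      ∀ a ∈ Algebra.adjoin L D, (∀ ν ∈ S, ν a = 0) → IsIntegral (Algebra.adjoin L {Y}) a := by
  classical
  let A := Algebra.adjoin L {Y}
  let K := L⟮Y⟯
  have hchar : CharZero K := charZero_of_injective_algebraMap (algebraMap L K).injective
  let e : L[X] ≃ₐ[L] A := AlgEquiv.ofInjective (aeval Y) (transcendental_iff_injective.1 hY) |>.trans
    (Subalgebra.equivOfEq _ _ (Algebra.adjoin_singleton_eq_range_aeval L Y).symm)
  have hpid : IsPrincipalIdealRing A :=
    IsPrincipalIdealRing.of_surjective e.toRingEquiv.toRingHom e.surjective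
  let M : IntermediateField K F := adjoin K D
  have hDf : Finite D := hD
  have hfin : FiniteDimensional K M :=
    finiteDimensional_adjoin fun x _ ↦ Algebra.IsIntegral.isIntegral x
  let _ : Algebra A M := ((algebraMap K M).comp (algebraMap A K)).toAlgebra
  have htow : IsScalarTower A K M := IsScalarTower.of_algebraMap_eq fun _ ↦ rfl
  have hAF : ∀ r : A, ((algebraMap A M r : M) : F) = r := fun _ ↦ rfl
  let D' : Set M := Subtype.val ⁻¹' D
  obtain ⟨S, hS, hadd, hinteg⟩ := exists_finite_valuations (A := A) (K := K) (M := M) (D := D')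
    (hD.preimage Subtype.val_injective.injOn)
  have hlift : ∀ a ∈ Algebra.adjoin L D, ∃ t ∈ Algebra.adjoin A D', (t : F) = a := fun a ha ↦ by
    induction ha using Algebra.adjoin_induction with
    | mem x hx =>
      exact ⟨⟨x, subset_adjoin K _ hx⟩, Algebra.subset_adjoin hx, rfl⟩
    | algebraMap r => exact ⟨algebraMap A M (algebraMap L A r), Subalgebra.algebraMap_mem _ _, rfl⟩
    | add x y _ _ hx hy =>
      obtain ⟨t, ht, rfl⟩ := hx
      obtain ⟨v, hv, rfl⟩ := hy
      exact ⟨t + v, add_mem ht hv, rfl⟩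
    | mul x y _ _ hx hy =>
      obtain ⟨t, ht, rfl⟩ := hx
      obtain ⟨v, hv, rfl⟩ := hy
      exact ⟨t * v, mul_mem ht hv, rfl⟩
  let ext : (M → ℤ) → F → ℤ := fun ν a ↦ if h : a ∈ M then ν ⟨a, h⟩ else 0
  have hext : ∀ (ν : M → ℤ) (t : M), ext ν t = ν t := fun ν t ↦ dif_pos t.2
  refine ⟨ext '' S, hS.image _, ?_, ?_⟩
  · rintro _ ⟨ν, hν, rfl⟩ a ha b hb ha0 hb0
    obtain ⟨t, -, rfl⟩ := hlift a ha
    obtain ⟨v, -, rfl⟩ := hlift b hb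
    have : (t : F) * v = ((t * v : M) : F) := rfl
    rw [this, hext, hext, hext]
    exact hadd ν hν t v (by simpa using ha0) (by simpa using hb0)
  · intro a ha h
    obtain ⟨t, ht, rfl⟩ := hlift a ha
    obtain ⟨P, hP, hP'⟩ := hinteg t ht fun ν hν ↦ (hext ν t).symm.trans (h _ ⟨ν, hν, rfl⟩)
    refine ⟨P, hP, ?_⟩
    have := congrArg (algebraMap M F) hP'
    rwa [map_zero, hom_eval₂] at this

theorem exists_algebraMap_eq_of_aeval_inv {L F : Type*} [Field L] [Field F] [Algebra L F] {Y : F}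
    (hY : Transcendental L Y) {P Q : L[X]} (h : aeval Y P = aeval Y⁻¹ Q) :
    ∃ c, P = C c := by
  rcases eq_or_ne P 0 with rfl | hP
  · exact ⟨0, by simp⟩
  have hY0 : Y ≠ 0 := fun h0 ↦ hY (h0 ▸ isAlgebraic_zero)
  let _ : Invertible Y⁻¹ := invertibleOfNonzero (inv_ne_zero hY0)
  have h1 := eval₂_reverse_mul_pow (algebraMap L F) Y⁻¹ Q
  rw [invOf_eq_inv, inv_inv, ← aeval_def, ← aeval_def, ← h, inv_pow] at h1
  have h2 : Q.reverse = P * X ^ Q.natDegree := by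
    apply transcendental_iff_injective.1 hY
    rw [map_mul, map_pow, aeval_X, ← h1, inv_mul_cancel_right₀ (pow_ne_zero _ hY0)]
  have h3 := congrArg natDegree h2
  rw [natDegree_mul_X_pow _ hP] at h3
  have h4 := reverse_natDegree_le Q
  exact ⟨P.coeff 0, eq_C_of_natDegree_eq_zero (by omega)⟩

open scoped IntermediateField.algebraAdjoinAdjoin in
theorem coeff_minpoly_of_isIntegral {L F : Type*} [Field L] [Field F] [Algebra L F]
    {Y : F} (hY : Transcendental L Y) {a : F}
    (h : IsIntegral (Algebra.adjoin L {Y}) a) (i : ℕ) :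
    ∃ P : L[X], aeval Y P = ((minpoly L⟮Y⟯ a).coeff i : F) := by
  let A := Algebra.adjoin L {Y}
  let e : L[X] ≃ₐ[L] A := AlgEquiv.ofInjective (aeval Y) (transcendental_iff_injective.1 hY) |>.trans
    (Subalgebra.equivOfEq _ _ (Algebra.adjoin_singleton_eq_range_aeval L Y).symm)
  have hpid : IsPrincipalIdealRing A :=
    IsPrincipalIdealRing.of_surjective e.toRingEquiv.toRingHom e.surjective
  have htow : IsScalarTower A L⟮Y⟯ F := IsScalarTower.of_algebraMap_eq fun _ ↦ rfl
  have h1 := minpoly.isIntegrallyClosed_eq_field_fractions' L⟮Y⟯ h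
  rw [h1, coeff_map]
  exact (Algebra.adjoin_singleton_eq_range_aeval L Y).le ((minpoly A a).coeff i).2

open scoped IntermediateField.algebraAdjoinAdjoin in
/-- An element integral over both `L[Y]` and `L[1/Y]` is algebraic over `L`. -/
theorem isAlgebraic_of_isIntegral_inv {L F : Type*} [Field L] [Field F] [Algebra L F]
    {Y : F} (hY : Transcendental L Y) {a : F} (h : IsIntegral (Algebra.adjoin L {Y}) a)
    (h' : IsIntegral (Algebra.adjoin L {Y⁻¹}) a) : IsAlgebraic L a := by
  have hY' : Transcendental L Y⁻¹ := fun h0 ↦ hY (by simpa using h0.inv)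
  have hadj : L⟮Y⁻¹⟯ = L⟮Y⟯ := by
    apply le_antisymm <;> rw [adjoin_simple_le_iff]
    · exact inv_mem (mem_adjoin_simple_self L Y)
    · simpa using inv_mem (mem_adjoin_simple_self L Y⁻¹)
  have hc : ∀ i, ∃ c : L, ((minpoly L⟮Y⟯ a).coeff i : F) = algebraMap L F c := fun i ↦ by
    obtain ⟨P, hP⟩ := coeff_minpoly_of_isIntegral hY h i
    obtain ⟨Q, hQ⟩ := coeff_minpoly_of_isIntegral hY' h' i
    rw [hadj] at hQ
    obtain ⟨c, rfl⟩ := exists_algebraMap_eq_of_aeval_inv hY (hP.trans hQ.symm)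
    exact ⟨c, by rw [← hP, aeval_C]⟩
  have hai : IsIntegral L⟮Y⟯ a := by
    obtain ⟨P, hP, hP'⟩ := h
    let j : Algebra.adjoin L {Y} →+* L⟮Y⟯ := algebraMap _ _
    exact ⟨P.map j, hP.map j, by rw [eval₂_map]; exact hP'⟩
  choose c hc using hc
  have hlift : (minpoly L⟮Y⟯ a) ∈ Polynomial.lifts (algebraMap L L⟮Y⟯) := by
    rw [lifts_iff_coeff_lifts]
    intro i
    exact ⟨c i, Subtype.ext (hc i).symm⟩
  obtain ⟨q, hq⟩ := hlift
  refine ⟨q, ?_, ?_⟩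
  · rintro rfl
    exact minpoly.ne_zero hai (by simpa using hq.symm)
  · have := minpoly.aeval L⟮Y⟯ a
    rw [← hq, coe_mapRingHom, aeval_map_algebraMap] at this
    exact this

section Units
variable {k F : Type*} [Field k] [Field F] [Algebra k F]

theorem mem_acl_empty_of_forall {ι : Type*} [Finite ι] {y : ι → F}
    (hy : IsTranscendenceBasis k y) {a : F} (h : ∀ i, a ∈ acl k (y '' {i}ᶜ)) :
    a ∈ acl k (∅ : Set F) := by
  classical
  rw [isTranscendenceBasis_iff_acl] at hy
  have key : ∀ T : Set ι, T.Finite → a ∈ acl k (y '' T) → a ∈ acl k (∅ : Set F) := by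
    intro T hT
    induction T, hT using Set.Finite.induction_on with
    | empty => simp
    | @insert i T hi _ ih =>
      intro ha
      refine ih ?_
      by_contra hna
      rw [Set.image_insert_eq] at ha
      have h1 := acl_exchange ha hna
      refine hy.1 i (acl_le_of_subset (Set.insert_subset (h i) ?_) h1)
      refine (Set.image_mono ?_).trans (subset_acl _)
      rintro j hj rfl
      exact hi hj
  refine key Set.univ Set.finite_univ ?_
  rw [Set.image_univ, hy.2]
  exact mem_top

/-- The units of a finitely generated algebra are detected, up to constants, by finitely many
additive functions. -/
theorem exists_finite_unit_valuations [CharZero k] {ι : Type*} [Finite ι] {y : ι → F}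
    (hy : IsTranscendenceBasis k y) {D : Set F} (hD : D.Finite) :
    ∃ S : Set (F → ℤ), S.Finite ∧
      (∀ ν ∈ S, ∀ a ∈ Algebra.adjoin k D, ∀ b ∈ Algebra.adjoin k D, a ≠ 0 → b ≠ 0 →
        ν (a * b) = ν a + ν b) ∧
      ∀ a ∈ Algebra.adjoin k D, (∀ ν ∈ S, ν a = 0) → a ∈ acl k (∅ : Set F) := by
  have key : ∀ i, ∃ S : Set (F → ℤ), S.Finite ∧
      (∀ ν ∈ S, ∀ a ∈ Algebra.adjoin k D, ∀ b ∈ Algebra.adjoin k D, a ≠ 0 → b ≠ 0 →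
        ν (a * b) = ν a + ν b) ∧
      ∀ a ∈ Algebra.adjoin k D, (∀ ν ∈ S, ν a = 0) → a ∈ acl k (y '' {i}ᶜ) := by
    intro i
    let L := acl k (y '' {i}ᶜ)
    have hchar : CharZero L := charZero_of_injective_algebraMap (algebraMap k L).injective
    have hY : Transcendental L (y i) := by
      intro h
      rw [isAlgebraic_iff_mem_acl, acl_acl] at h
      exact (isTranscendenceBasis_iff_acl.1 hy).1 i h
    have halg : ∀ t : F, y i ∈ L⟮t⟯ → Algebra.IsAlgebraic L⟮t⟯ F := by
      intro t ht
      refine ⟨fun a ↦ mem_acl.1 ((mem_acl_over L).2 ?_)⟩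
      have h1 : y i ∈ acl k (L ∪ {t} : Set F) := (mem_acl_over L).1 (adjoin_le_acl _ ht)
      have h2 : Set.range y ⊆ acl k (L ∪ {t} : Set F) := by
        rintro _ ⟨j, rfl⟩
        rcases eq_or_ne j i with rfl | hj
        · exact h1
        · exact subset_acl _ (Or.inl (subset_acl _ ⟨j, hj, rfl⟩))
      refine acl_le_of_subset h2 ?_
      rw [(isTranscendenceBasis_iff_acl.1 hy).2]
      exact mem_top
    have hle : ∀ a ∈ Algebra.adjoin k D, a ∈ Algebra.adjoin L D := fun a ha ↦ by
      have h1 : Algebra.adjoin k D ≤ (Algebra.adjoin L D).restrictScalars k :=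
        Algebra.adjoin_le Algebra.subset_adjoin
      exact h1 ha
    have hY' : Transcendental L (y i)⁻¹ := fun h0 ↦ hY (by simpa using h0.inv)
    have _ := halg (y i) (mem_adjoin_simple_self L _)
    have _ := halg (y i)⁻¹ (by simpa using inv_mem (mem_adjoin_simple_self L (y i)⁻¹))
    obtain ⟨S, hS, hSa, hSi⟩ := exists_finite_valuations_over hY hD
    obtain ⟨S', hS', hSa', hSi'⟩ := exists_finite_valuations_over hY' hD
    refine ⟨S ∪ S', hS.union hS', ?_, ?_⟩
    · rintro ν (hν | hν) a ha b hb
      · exact hSa ν hν a (hle a ha) b (hle b hb)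
      · exact hSa' ν hν a (hle a ha) b (hle b hb)
    · intro a ha h
      have := isAlgebraic_of_isIntegral_inv hY
        (hSi a (hle a ha) fun ν hν ↦ h ν (Or.inl hν)) (hSi' a (hle a ha) fun ν hν ↦ h ν (Or.inr hν))
      rwa [isAlgebraic_iff_mem_acl, acl_acl] at this
  choose S hS hSa hSi using key
  refine ⟨⋃ i, S i, Set.finite_iUnion hS, ?_, ?_⟩
  · intro ν hν
    obtain ⟨i, hi⟩ := Set.mem_iUnion.1 hν
    exact hSa i ν hi
  · intro a ha h
    exact mem_acl_empty_of_forall hy fun i ↦ hSi i a ha fun ν hν ↦ h ν (Set.mem_iUnion.2 ⟨i, hν⟩)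

end Units

/-- A locally constant quadratic character of the automorphism group of an algebraic extension is
a Kummer character. -/
theorem exists_kummer_generator {K F : Type*} [Field K] [Field F] [Algebra K F]
    [Algebra.IsAlgebraic K F] [CharZero K] (χ : (F ≃ₐ[K] F) →* ℤˣ) {T : Set F} (hT : T.Finite)
    (h : ∀ g ∈ fixS K T, χ g = 1) : ∃ α : F, α ≠ 0 ∧ ∀ g, g α = ((χ g : ℤ) : F) * α := by
  by_cases htriv : ∀ g, χ g = 1
  · exact ⟨1, one_ne_zero, fun g ↦ by simp [htriv g]⟩
  push Not at htriv
  obtain ⟨τ, hτ⟩ := htriv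
  have hτ' : χ τ = -1 := (Int.units_eq_one_or _).resolve_left hτ
  have hTf : Finite T := hT
  have hfin : FiniteDimensional K (adjoin K T) :=
    finiteDimensional_adjoin fun x _ ↦ Algebra.IsIntegral.isIntegral x
  obtain ⟨t, ht⟩ := Field.exists_primitive_element K (adjoin K T)
  have hfix : fixS K {(t : F)} ≤ χ.ker := by
    intro g hg
    refine h g fun s hs ↦ ?_
    have h1 : s ∈ K⟮(t : F)⟯ := by
      have h2 : (⟨s, subset_adjoin K T hs⟩ : adjoin K T) ∈ K⟮t⟯ := by rw [ht]; exact mem_top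
      have h3 : K⟮(t : F)⟯ = lift K⟮t⟯ := by
        rw [lift_adjoin_simple]
      rw [h3]
      exact ⟨_, h2, rfl⟩
    rw [← fixS_adjoin] at hg
    exact hg s h1
  have horb : (orb χ.ker (t : F)).Finite := by
    refine (orb_finite_of_mem_acl (k := K) (S := ∅) (a := (t : F)) ?_).subset ?_
    · exact isAlgebraic_iff_mem_acl_empty.1 (Algebra.IsAlgebraic.isAlgebraic _)
    · exact orb_mono (fun g _ ↦ fun s hs ↦ hs.elim) _
  obtain ⟨a, ha, ha'⟩ : ∃ a ∈ fixedField χ.ker, τ a ≠ a := by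
    by_contra! hcon
    exact hτ (mem_of_fixedField horb hfix hcon)
  rw [mem_fixedField'] at ha
  have hpos : ∀ g, χ g = 1 → g (a - τ a) = a - τ a := by
    intro g hg
    have h1 := ha (τ⁻¹ * g * τ) (by rw [MonoidHom.mem_ker]; simp [hg])
    have h2 : g (τ a) = τ a := by
      have := congrArg τ h1
      simpa [AlgEquiv.mul_apply, AlgEquiv.aut_inv] using this
    rw [map_sub, h2, ha g hg]
  refine ⟨a - τ a, sub_ne_zero.2 (Ne.symm ha'), fun g ↦ ?_⟩
  rcases Int.units_eq_one_or (χ g) with hg | hg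
  · rw [hpos g hg, hg]; simp
  · have h1 : g = (g * τ⁻¹) * τ := by simp
    have h2 : τ (a - τ a) = -(a - τ a) := by
      have h3 := ha (τ * τ) (by rw [MonoidHom.mem_ker]; simp [hτ'])
      rw [AlgEquiv.mul_apply] at h3
      rw [map_sub, h3]; ring
    rw [hg, h1, AlgEquiv.mul_apply, h2, map_neg, hpos (g * τ⁻¹) (by simp [hg, hτ'])]
    simp

theorem exists_sq_mul_squarefree {R : Type*} [CommRing R] [IsDomain R]
    [UniqueFactorizationMonoid R] {a : R} (ha : a ≠ 0) :
    ∃ s p : R, Squarefree p ∧ a = s ^ 2 * p := by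
  induction a using UniqueFactorizationMonoid.induction_on_prime with
  | h₁ => exact absurd rfl ha
  | h₂ u hu => exact ⟨1, u, hu.squarefree, by simp⟩
  | h₃ a π ha' hπ ih =>
    obtain ⟨s, p, hp, rfl⟩ := ih ha'
    by_cases hd : π ∣ p
    · obtain ⟨q, rfl⟩ := hd
      exact ⟨π * s, q, hp.of_mul_right, by ring⟩
    · exact ⟨s, π * p, squarefree_mul_iff.2
        ⟨hπ.irreducible.isRelPrime_iff_not_dvd.2 hd, hπ.irreducible.squarefree, hp⟩, by ring⟩

section Twist
variable {k F : Type*} [Field k] [Field F] [Algebra k F] [IsAlgClosed F] [CharZero F]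
variable {ι : Type*} {y : ι → F} {ψ : (F ≃ₐ[k] F) ≃* (F ≃ₐ[k] F)}

/-- Transport of a quadratic Kummer character through `ψ`. -/
theorem exists_twisted_sqrt [CharZero k] (hψ' : NbhdCont ψ.symm) (hy : IsTranscendenceBasis k y) {r : F}
    (hr0 : r ≠ 0)
    (hr : ∀ w, ψ w ∈ fixS k (Set.range y) → w r = r ∨ w r = -r) :
    ∃ α : F, α ≠ 0 ∧ (∃ p : MvPolynomial ι k, Squarefree p ∧ α ^ 2 = MvPolynomial.aeval y p) ∧
      ∀ w, ψ w ∈ fixS k (Set.range y) → ψ w α * r = w r * α := by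
  classical
  let K := adjoin k (Set.range y)
  have halg : Algebra.IsAlgebraic K F := hy.isAlgebraic_field
  have hchar : CharZero K := charZero_of_injective_algebraMap (algebraMap k K).injective
  have hneg : -r ≠ r := fun h ↦ hr0 (by
    have : (2 : F) * r = 0 := by linear_combination -h
    simpa using this)
  let σ : (F ≃ₐ[K] F) → (F ≃ₐ[k] F) := fun v ↦ ψ.symm (v.restrictScalars k)
  have hσ : ∀ v, ψ (σ v) ∈ fixS k (Set.range y) := fun v ↦ by
    rw [← fixS_adjoin, MulEquiv.apply_symm_apply]
    exact restrictScalars_mem_fixS v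
  have hσmul : ∀ v v', σ (v * v') = σ v * σ v' := fun v v' ↦
    map_mul ψ.symm (v.restrictScalars k) (v'.restrictScalars k)
  let χ : (F ≃ₐ[K] F) →* ℤˣ := MonoidHom.mk' (fun v ↦ if σ v r = r then 1 else -1) (by
    intro v v'
    rw [hσmul, AlgEquiv.mul_apply]
    rcases hr _ (hσ v) with h | h <;> rcases hr _ (hσ v') with h' | h' <;>
      simp [h, h', hneg])
  have hχ : ∀ v, ((χ v : ℤ) : F) * r = σ v r := fun v ↦ by
    change (((if σ v r = r then 1 else -1 : ℤˣ) : ℤ) : F) * r = σ v r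
    rcases hr _ (hσ v) with h | h <;> simp [h, hneg]
  obtain ⟨T, hT, hTr⟩ := hψ' {r} (Set.finite_singleton r)
  obtain ⟨α₀, hα₀, h₀⟩ := exists_kummer_generator χ hT fun g hg ↦
    if_pos (hTr (g.restrictScalars k) hg r rfl)
  have htw : ∀ w, ψ w ∈ fixS k (Set.range y) → ψ w α₀ * r = w r * α₀ := fun w hw ↦ by
    rw [← fixS_adjoin] at hw
    have h1 := h₀ (overFix hw)
    have h2 := hχ (overFix hw)
    have h3 : σ (overFix hw) = w := ψ.symm_apply_apply w
    rw [h3] at h2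
    have h4 : (overFix hw) α₀ = ψ w α₀ := rfl
    rw [← h4, h1, ← h2]; ring
  have hfix : α₀ ^ 2 ∈ adjoin k (Set.range y) := by
    refine mem_adjoin_of_fixed fun g hg ↦ ?_
    have h1 := htw (ψ.symm g) (by rwa [MulEquiv.apply_symm_apply])
    have h2 := hr (ψ.symm g) (by rwa [MulEquiv.apply_symm_apply])
    rw [MulEquiv.apply_symm_apply] at h1
    have h3 : (g α₀) ^ 2 * r ^ 2 = α₀ ^ 2 * r ^ 2 := by
      rw [← mul_pow, h1]
      rcases h2 with h | h <;> rw [h] <;> ring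
    rw [map_pow]
    exact mul_right_cancel₀ (pow_ne_zero 2 hr0) h3
  rw [mem_adjoin_range_iff] at hfix
  obtain ⟨a, b, hab⟩ := hfix
  have hb0 : MvPolynomial.aeval y b ≠ 0 := by
    intro h0
    rw [h0, div_zero] at hab
    exact hα₀ (pow_eq_zero_iff two_ne_zero |>.1 hab)
  have ha0 : MvPolynomial.aeval y a ≠ 0 := by
    intro h0
    rw [h0, zero_div] at hab
    exact hα₀ (pow_eq_zero_iff two_ne_zero |>.1 hab)
  have hab0 : a * b ≠ 0 := by
    rintro h0
    have := congrArg (MvPolynomial.aeval y) h0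
    rw [map_mul, map_zero] at this
    exact mul_ne_zero ha0 hb0 this
  obtain ⟨s, p, hp, hsp⟩ := exists_sq_mul_squarefree hab0
  have hsp' : MvPolynomial.aeval y a * MvPolynomial.aeval y b =
      MvPolynomial.aeval y s ^ 2 * MvPolynomial.aeval y p := by
    rw [← map_mul, hsp, map_mul, map_pow]
  have hs0 : MvPolynomial.aeval y s ≠ 0 := by
    intro h0
    rw [h0, zero_pow two_ne_zero, zero_mul] at hsp'
    exact mul_ne_zero ha0 hb0 hsp'
  refine ⟨α₀ * (MvPolynomial.aeval y b / MvPolynomial.aeval y s),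
    mul_ne_zero hα₀ (div_ne_zero hb0 hs0), ⟨p, hp, ?_⟩, fun w hw ↦ ?_⟩
  · rw [mul_pow, hab]
    field_simp
    linear_combination hsp'
  · have hK : ∀ q : MvPolynomial ι k, ψ w (MvPolynomial.aeval y q) = MvPolynomial.aeval y q := by
      intro q
      have h1 : MvPolynomial.aeval y q ∈ adjoin k (Set.range y) :=
        algebra_adjoin_le_adjoin k _ (by
          rw [Algebra.adjoin_range_eq_range_aeval]; exact ⟨q, rfl⟩)
      rw [← fixS_adjoin] at hw
      exact hw _ h1
    rw [map_mul, map_div₀, hK, hK]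
    linear_combination (MvPolynomial.aeval y b / MvPolynomial.aeval y s) * htw w hw

/-- The cocycle attached to a twisted square root is defined over `k(y, gy)`. -/
theorem map_div_mem_adjoin {x r α : F} (hr0 : r ≠ 0) (hα0 : α ≠ 0)
    (hrx : ∀ w ∈ fixS k {x}, w r = r ∨ w r = -r)
    (hx : ∀ w, ψ w ∈ fixS k (Set.range y) → w ∈ fixS k {x})
    (hα : ∀ w, ψ w ∈ fixS k (Set.range y) → ψ w α * r = w r * α)
    {w₀ : F ≃ₐ[k] F} (hw₀ : w₀ ∈ fixS k {x}) :
    ψ w₀ α / α ∈ adjoin k (Set.range y ∪ Set.range (ψ w₀ ∘ y)) := by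
  refine mem_adjoin_of_fixed fun v hv ↦ ?_
  obtain ⟨w, rfl⟩ := ψ.surjective v
  have hvy : ψ w ∈ fixS k (Set.range y) := fun s hs ↦ hv s (Or.inl hs)
  have hconj : ψ (w₀⁻¹ * w * w₀) ∈ fixS k (Set.range y) := by
    rintro _ ⟨i, rfl⟩
    rw [map_mul, map_mul, map_inv, AlgEquiv.mul_apply, AlgEquiv.mul_apply,
      hv (ψ w₀ (y i)) (Or.inr ⟨i, rfl⟩)]
    exact (ψ w₀).symm_apply_apply _
  have h1 := hα w hvy
  have h2 := hα _ hconj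
  have h3 : ψ w₀ (ψ (w₀⁻¹ * w * w₀) α) = ψ w (ψ w₀ α) := by
    rw [← AlgEquiv.mul_apply, ← map_mul, ← AlgEquiv.mul_apply, ← map_mul]
    congr 2
    group
  have h4 : (w₀⁻¹ * w * w₀) r = w r := by
    have e1 : (w₀⁻¹ * w * w₀) r = w₀.symm (w (w₀ r)) := rfl
    rw [e1]
    rw [AlgEquiv.symm_apply_eq]
    rcases hrx w₀ hw₀ with h | h <;> rcases hrx w (hx w hvy) with h' | h' <;> simp [h, h']
  rw [h4] at h2
  rw [map_div₀, ← h3, div_eq_div_iff (by simpa using hα0) hα0]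
  rcases hrx w (hx w hvy) with h | h
  · rw [h] at h1 h2
    have e1 : ψ w α = α := mul_right_cancel₀ hr0 (h1.trans (mul_comm _ _))
    have e2 : ψ (w₀⁻¹ * w * w₀) α = α := mul_right_cancel₀ hr0 (h2.trans (mul_comm _ _))
    rw [e1, e2]
  · rw [h] at h1 h2
    have e1 : ψ w α = -α := mul_right_cancel₀ hr0 (by linear_combination h1)
    have e2 : ψ (w₀⁻¹ * w * w₀) α = -α := mul_right_cancel₀ hr0 (by linear_combination h2)
    rw [e1, e2, map_neg]; ring

end Twist

section Valuations
variable {k F : Type*} [Field k] [Field F] [Algebra k F] [CharZero k]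
variable {ι : Type*} [Finite ι] {y : ι → F}

/-- Finitely many integer-valued functionals detect when a product of powers of cocycles
`g α / α` of square roots of squarefree polynomials is algebraic over `k`. -/
theorem exists_finite_cocycle_valuations (hy : IsTranscendenceBasis k y) (g : F ≃ₐ[k] F) :
    ∃ S : Set (F → ℤ), S.Finite ∧ ∀ (κ : Type) [Fintype κ] (α : κ → F) (r : κ → ℤ),
      (∀ c, α c ≠ 0) →
      (∀ c, ∃ p : MvPolynomial ι k, Squarefree p ∧ α c ^ 2 = MvPolynomial.aeval y p) →
      (∀ c, g (α c) / α c ∈ adjoin k (Set.range y ∪ Set.range (g ∘ y))) →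
      (∀ ν ∈ S, ∑ c, r c * ν (g (α c) / α c) = 0) →
      ∏ c, (g (α c) / α c) ^ r c ∈ acl k ∅ := by
  have hgy : IsTranscendenceBasis k (g ∘ y) := g.isTranscendenceBasis hy
  obtain ⟨D, hD, hD'⟩ := exists_finite_mem_algebraAdjoin (y' := g ∘ y) hy
  obtain ⟨E, hE, hE'⟩ := exists_finite_mem_algebraAdjoin (y' := y) hgy
  obtain ⟨S, hS, hmul, hinteg⟩ := exists_finite_unit_valuations hy (hD.union hE)
  let C := Algebra.adjoin k (D ∪ E)
  let U : Subgroup Fˣ :=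
    { carrier := {u | (u : F) ∈ C ∧ ((u⁻¹ : Fˣ) : F) ∈ C}
      mul_mem' := fun {a b} ha hb ↦ by
        refine ⟨?_, ?_⟩
        · rw [Units.val_mul]; exact mul_mem ha.1 hb.1
        · rw [mul_inv, Units.val_mul]; exact mul_mem ha.2 hb.2
      one_mem' := ⟨by simp, by simp⟩
      inv_mem' := fun {a} ha ↦ ⟨ha.2, by rw [inv_inv]; exact ha.1⟩ }
  refine ⟨S, hS, fun κ _ α r hα hp hz hsum ↦ ?_⟩
  have hmem : ∀ c, g (α c) / α c ∈ C ∧ (g (α c) / α c)⁻¹ ∈ C := by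
    intro c
    obtain ⟨p, hp, hpα⟩ := hp c
    have hg0 : g (α c) ≠ 0 := by simpa using hα c
    have hgp : g (α c) ^ 2 = MvPolynomial.aeval (g ∘ y) p := by
      rw [← map_pow, hpα]
      exact MvPolynomial.comp_aeval_apply y g.toAlgHom p
    constructor
    · refine Algebra.adjoin_mono Set.subset_union_left (hD' p p _ hp (hz c) ?_)
      rw [← hpα, ← hgp, div_pow, div_mul_cancel₀ _ (pow_ne_zero 2 (hα c))]
    · refine Algebra.adjoin_mono Set.subset_union_right (hE' p p _ hp ?_ ?_)
      · rw [Set.union_comm]; exact inv_mem (hz c)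
      · rw [← hpα, ← hgp, inv_div, div_pow, div_mul_cancel₀ _ (pow_ne_zero 2 hg0)]
  let u : κ → U := fun c ↦ ⟨Units.mk0 (g (α c) / α c) (div_ne_zero (by simpa using hα c) (hα c)),
    (hmem c).1, by simpa using (hmem c).2⟩
  have hprod : ((∏ c, u c ^ r c : U) : Fˣ).val = ∏ c, (g (α c) / α c) ^ r c := by
    simp [u]
  rw [← hprod]
  refine hinteg _ (∏ c, u c ^ r c : U).2.1 fun ν hν ↦ ?_
  let N : U →* Multiplicative ℤ := MonoidHom.mk' (fun v ↦ Multiplicative.ofAdd (ν v.1.val))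
    fun v w ↦ by
      rw [← ofAdd_add]
      exact congrArg _ (hmul ν hν _ v.2.1 _ w.2.1 v.1.ne_zero w.1.ne_zero)
  have h1 : N (∏ c, u c ^ r c) = 1 := by
    rw [map_prod]
    apply Multiplicative.toAdd.injective
    rw [toAdd_prod, toAdd_one, ← hsum ν hν]
    refine Finset.sum_congr rfl fun c _ ↦ ?_
    rw [map_zpow, toAdd_zpow, smul_eq_mul]
    rfl
  exact congrArg Multiplicative.toAdd h1

end Valuations

section Independence
variable {k F : Type*} [Field k] [Field F] [Algebra k F]

theorem eq_empty_of_sq_eq_prod {L : IntermediateField k F} {x z : F} (hx : Transcendental L x)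
    (hz : z ∈ L⟮x⟯) {Δ : Finset k} (h : z ^ 2 = ∏ c ∈ Δ, (x - algebraMap k F c)) : Δ = ∅ := by
  classical
  by_contra hne
  obtain ⟨c, hc⟩ := Finset.nonempty_iff_ne_empty.2 hne
  have hinj := transcendental_iff_injective.1 hx
  rw [mem_adjoin_simple_iff] at hz
  obtain ⟨P, Q, rfl⟩ := hz
  let Δ' : Finset L := Δ.map ⟨algebraMap k L, (algebraMap k L).injective⟩
  let p : L[X] := (Δ'.val.map fun c ↦ X - C c).prod
  have hp0 : p ≠ 0 := (monic_multiset_prod_of_monic _ _ fun c _ ↦ monic_X_sub_C c).ne_zero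
  have hpx : aeval x p = ∏ c ∈ Δ, (x - algebraMap k F c) := by
    change aeval x (∏ c ∈ Δ', (X - C c)) = _
    rw [Finset.prod_map, map_prod]
    refine Finset.prod_congr rfl fun c _ ↦ ?_
    simp
  have hpx0 : aeval x p ≠ 0 := by
    rw [Ne, ← map_zero (aeval (R := L) x)]
    exact hinj.ne hp0
  rw [← hpx] at h
  have hQ : aeval x Q ≠ 0 := by
    intro h0
    rw [h0, div_zero, zero_pow two_ne_zero] at h
    exact hpx0 h.symm
  have hQ0 : Q ≠ 0 := by rintro rfl; simp at hQ
  have hPQ : P ^ 2 = Q ^ 2 * p := by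
    apply hinj
    rw [map_mul, map_pow, map_pow, ← h, div_pow, mul_div_cancel₀ _ (pow_ne_zero 2 hQ)]
  have hP0 : P ≠ 0 := by
    rintro rfl
    exact mul_ne_zero (pow_ne_zero 2 hQ0) hp0 (by rw [← hPQ]; simp)
  have hm : p.roots.count (algebraMap k L c) = 1 := by
    change (Δ'.val.map fun c ↦ X - C c).prod.roots.count _ = 1
    rw [roots_multiset_prod_X_sub_C]
    exact Multiset.count_eq_one_of_mem Δ'.nodup (Finset.mem_map.2 ⟨c, hc, rfl⟩)
  have h2 := congrArg (fun q : L[X] ↦ q.roots.count (algebraMap k L c)) hPQ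
  simp only [roots_mul (mul_ne_zero (pow_ne_zero 2 hQ0) hp0), roots_pow, Multiset.count_add,
    Multiset.count_nsmul, hm] at h2
  omega

variable [IsAlgClosed F] [CharZero F]

/-- Only finitely many products of the square roots `√(x - c)` are defined over a given finitely
generated extension of `k`. -/
theorem finite_setOf_prod_sqrt_fixed {ι : Type*} [Finite ι] {y : ι → F}
    (hy : IsTranscendenceBasis k y) {x : F} (hx : x ∉ acl k (∅ : Set F)) {r : k → F}
    (hr : ∀ c, r c ^ 2 = x - algebraMap k F c) {S : Set F} (hS : S.Finite) :
    {Δ : Finset k | ∀ w ∈ fixS k S, w (∏ c ∈ Δ, r c) = ∏ c ∈ Δ, r c}.Finite := by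
  classical
  obtain ⟨i, hi⟩ : ∃ i, x ∉ acl k (y '' {i}ᶜ) := by
    by_contra! h
    exact hx (mem_acl_empty_of_forall hy h)
  let L := acl k (y '' {i}ᶜ)
  have hins : insert (y i) (y '' {i}ᶜ) = Set.range y := by
    rw [← Set.image_insert_eq, ← Set.image_univ]
    congr 1
    ext j
    simp [em]
  have htop : acl k (insert x (L : Set F)) = ⊤ := by
    have h0 : acl k (Set.range y) = ⊤ := (isTranscendenceBasis_iff_acl.1 hy).2
    have h1 : y i ∈ acl k (insert x (y '' {i}ᶜ)) := by
      refine acl_exchange ?_ hi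
      rw [hins, h0]; exact mem_top
    rw [← top_le_iff, ← h0]
    refine acl_le_of_subset ?_
    rw [← hins]
    refine Set.insert_subset ?_ ?_
    · exact acl_mono (Set.insert_subset_insert (subset_acl _)) h1
    · exact ((subset_acl _).trans (Set.subset_insert _ _)).trans (subset_acl _)
  have htr : Transcendental L x := fun h ↦ hi (by
    have := (isAlgebraic_iff_mem_acl L).1 h
    rwa [acl_acl] at this)
  let U := fixS k (insert x (L : Set F))
  have hrc : ∀ c, r c ≠ 0 := by
    intro c h0
    have h1 := hr c
    rw [h0, zero_pow two_ne_zero] at h1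
    refine hx ?_
    rw [sub_eq_zero.1 h1.symm]
    exact IntermediateField.algebraMap_mem _ c
  have hR0 : ∀ Δ : Finset k, ∏ c ∈ Δ, r c ≠ 0 := fun Δ ↦ Finset.prod_ne_zero_iff.2 fun c _ ↦ hrc c
  have hsq : ∀ Δ : Finset k, (∏ c ∈ Δ, r c) ^ 2 = ∏ c ∈ Δ, (x - algebraMap k F c) := fun Δ ↦ by
    rw [← Finset.prod_pow]
    exact Finset.prod_congr rfl fun c _ ↦ hr c
  have hUsq : ∀ u ∈ U, ∀ Δ : Finset k, u (∏ c ∈ Δ, (x - algebraMap k F c)) =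
      ∏ c ∈ Δ, (x - algebraMap k F c) := by
    intro u hu Δ
    rw [map_prod]
    refine Finset.prod_congr rfl fun c _ ↦ ?_
    rw [map_sub, u.commutes, hu x (Set.mem_insert _ _)]
  have hpm : ∀ u ∈ U, ∀ Δ : Finset k, u (∏ c ∈ Δ, r c) = ∏ c ∈ Δ, r c ∨
      u (∏ c ∈ Δ, r c) = -∏ c ∈ Δ, r c := by
    intro u hu Δ
    rw [← sq_eq_sq_iff_eq_or_eq_neg, ← map_pow, hsq, hUsq u hu]
  let res : (F ≃ₐ[k] F) → (S → F) := fun g t ↦ g t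
  have hfin : (res '' (U : Set _)).Finite :=
    finite_restrict_of_orb hS fun t _ ↦ TB_fixS htop t
  refine Set.Finite.of_finite_image (f := fun Δ : Finset k ↦
    {ρ : S → F | ∃ u ∈ U, res u = ρ ∧ u (∏ c ∈ Δ, r c) = ∏ c ∈ Δ, r c})
    (hfin.finite_subsets.subset ?_) ?_
  · rintro _ ⟨Δ, _, rfl⟩ _ ⟨u, hu, rfl, _⟩
    exact ⟨u, hu, rfl⟩
  · intro Δ hΔ Δ' hΔ' heq
    have hres : ∀ Δ : Finset k, (∀ w ∈ fixS k S, w (∏ c ∈ Δ, r c) = ∏ c ∈ Δ, r c) →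
        ∀ u v : F ≃ₐ[k] F, res u = res v → u (∏ c ∈ Δ, r c) = v (∏ c ∈ Δ, r c) := by
      intro Δ hΔ u v huv
      have h1 : v⁻¹ * u ∈ fixS k S := fun s hs ↦ by
        have h2 : u s = v s := congrFun huv ⟨s, hs⟩
        rw [AlgEquiv.mul_apply, h2]
        exact v.symm_apply_apply s
      have h3 := congrArg v (hΔ _ h1)
      rwa [← AlgEquiv.mul_apply, mul_inv_cancel_left] at h3
    have hfix : ∀ u ∈ U, u (∏ c ∈ Δ, r c) = ∏ c ∈ Δ, r c ↔ u (∏ c ∈ Δ', r c) = ∏ c ∈ Δ', r c := by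
      intro u hu
      have h1 := Set.ext_iff.1 heq (res u)
      constructor
      · intro h
        obtain ⟨v, hv, hvu, h2⟩ := h1.1 ⟨u, hu, rfl, h⟩
        rw [← hres Δ' hΔ' v u hvu, h2]
      · intro h
        obtain ⟨v, hv, hvu, h2⟩ := h1.2 ⟨u, hu, rfl, h⟩
        rw [← hres Δ hΔ v u hvu, h2]
    have hmulfix : ∀ u ∈ U, u ((∏ c ∈ Δ, r c) * ∏ c ∈ Δ', r c) =
        (∏ c ∈ Δ, r c) * ∏ c ∈ Δ', r c := by
      intro u hu
      rw [map_mul]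
      by_cases h : u (∏ c ∈ Δ, r c) = ∏ c ∈ Δ, r c
      · rw [h, (hfix u hu).1 h]
      · rw [(hpm u hu Δ).resolve_left h,
          (hpm u hu Δ').resolve_left fun h' ↦ h ((hfix u hu).2 h')]
        ring
    have hdecomp : (∏ c ∈ Δ, r c) * ∏ c ∈ Δ', r c =
        (∏ c ∈ symmDiff Δ Δ', r c) * ∏ c ∈ Δ ∩ Δ', (x - algebraMap k F c) := by
      rw [← hsq]
      have e1 := Finset.prod_union (f := r)
        (Finset.disjoint_sdiff_inter Δ Δ')
      have e2 := Finset.prod_union (f := r)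
        (Finset.disjoint_sdiff_inter Δ' Δ)
      rw [Finset.sdiff_union_inter] at e1 e2
      have e3 := Finset.prod_union (f := r) (disjoint_sdiff_sdiff (x := Δ) (y := Δ'))
      rw [symmDiff_def, Finset.sup_eq_union, e1, e2, e3, Finset.inter_comm Δ' Δ]
      ring
    have hmem : ∏ c ∈ symmDiff Δ Δ', r c ∈ adjoin k (insert x (L : Set F)) := by
      refine mem_adjoin_of_fixed fun u hu ↦ ?_
      have h1 := hmulfix u hu
      rw [hdecomp, map_mul, hUsq u hu] at h1
      refine mul_right_cancel₀ ?_ h1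
      rw [← hsq]
      exact pow_ne_zero 2 (hR0 _)
    have hle : adjoin k (insert x (L : Set F)) ≤ (L⟮x⟯).restrictScalars k := by
      rw [adjoin_le_iff]
      refine Set.insert_subset (mem_adjoin_simple_self L x) fun a ha ↦ ?_
      exact IntermediateField.algebraMap_mem L⟮x⟯ (⟨a, ha⟩ : L)
    have := eq_empty_of_sq_eq_prod htr (hle hmem) (hsq _)
    rwa [← Finset.bot_eq_empty, symmDiff_eq_bot] at this

end Independence

theorem exists_int_relation {κ J : Type*} [Fintype κ] [Finite J] (h : Nat.card J < Fintype.card κ)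
    (f : J → κ → ℤ) : ∃ r : κ → ℤ, r ≠ 0 ∧ ∀ j, ∑ c, r c * f j c = 0 := by
  have := Fintype.ofFinite J
  let T : (κ → ℤ) →ₗ[ℤ] (J → ℤ) := LinearMap.pi fun j ↦
    ∑ c, f j c • LinearMap.proj (R := ℤ) (φ := fun _ : κ ↦ ℤ) c
  have hT : ∀ r j, T r j = ∑ c, r c * f j c := by
    intro r j
    simp [T, mul_comm]
  have hni : ¬ Function.Injective T := by
    intro hi
    have := LinearMap.finrank_le_finrank_of_injective hi
    rw [Module.finrank_fintype_fun_eq_card, Module.finrank_fintype_fun_eq_card,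
      ← Nat.card_eq_fintype_card (α := J)] at this
    omega
  rw [injective_iff_map_eq_zero] at hni
  push Not at hni
  obtain ⟨r, hr, hr0⟩ := hni
  exact ⟨r, hr0, fun j ↦ by rw [← hT, hr]; rfl⟩

section Eigen
variable {k F : Type*} [Field k] [Field F] [Algebra k F]

/-- Algebraically dependent simultaneous eigenvectors have a nontrivial invariant monomial. -/
theorem exists_invariant_monomial {β : Type*} [Fintype β] {B : β → F} (hB : ∀ b, B b ≠ 0)
    (hdep : ¬ AlgebraicIndependent k B) {Ψ : Set (F ≃ₐ[k] F)}
    (hΨ : ∀ g ∈ Ψ, ∀ b, ∃ c : k, g (B b) = algebraMap k F c * B b) :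
    ∃ e : β → ℤ, e ≠ 0 ∧ ∀ g ∈ Ψ, g (∏ b, B b ^ e b) = ∏ b, B b ^ e b := by
  classical
  let M : (β →₀ ℕ) → F := fun d ↦ ∏ b, B b ^ d b
  have hM0 : ∀ d, M d ≠ 0 := fun d ↦ Finset.prod_ne_zero_iff.2 fun b _ ↦ pow_ne_zero _ (hB b)
  have hMa : ∀ d a, MvPolynomial.aeval B (MvPolynomial.monomial d a) = algebraMap k F a * M d := by
    intro d a
    rw [MvPolynomial.aeval_monomial, Finsupp.prod_fintype _ _ (by simp)]
  have hex : ∃ m : ℕ, ∃ P : MvPolynomial β k, P ≠ 0 ∧ MvPolynomial.aeval B P = 0 ∧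
      P.support.card = m := by
    rw [algebraicIndependent_iff] at hdep
    push Not at hdep
    obtain ⟨P, h0, hP⟩ := hdep
    exact ⟨_, P, hP, h0, rfl⟩
  obtain ⟨P, hP0, hPB, hPm⟩ := Nat.find_spec hex
  have hmin : ∀ Q : MvPolynomial β k, MvPolynomial.aeval B Q = 0 →
      Q.support.card < P.support.card → Q = 0 := by
    intro Q hQ hlt
    by_contra hQ0
    rw [hPm] at hlt
    exact Nat.find_min hex hlt ⟨Q, hQ0, hQ, rfl⟩
  obtain ⟨d₀, hd₀⟩ := MvPolynomial.support_nonempty.2 hP0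
  obtain ⟨d₁, hd₁, hne⟩ : ∃ d₁ ∈ P.support, d₁ ≠ d₀ := by
    by_contra! h
    have h1 : P = MvPolynomial.monomial d₀ (P.coeff d₀) := by
      ext d
      rw [MvPolynomial.coeff_monomial]
      split_ifs with h2
      · rw [h2]
      · by_contra h3
        exact h2 (h d (MvPolynomial.mem_support_iff.2 h3)).symm
    rw [h1, hMa] at hPB
    refine mul_ne_zero ?_ (hM0 d₀) hPB
    simpa using MvPolynomial.mem_support_iff.1 hd₀
  have hPsum : ∑ d ∈ P.support, algebraMap k F (P.coeff d) * M d = 0 := by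
    rw [← hPB]
    conv_rhs => rw [P.as_sum, map_sum]
    exact Finset.sum_congr rfl fun d _ ↦ (hMa d _).symm
  refine ⟨fun b ↦ d₁ b - d₀ b, fun h ↦ hne ?_, fun g hg ↦ ?_⟩
  · ext b
    have := congrFun h b
    simp only [Pi.zero_apply] at this
    omega
  choose lam hlam using hΨ g hg
  let mu : (β →₀ ℕ) → k := fun d ↦ ∏ b, lam b ^ d b
  have hgM : ∀ d, g (M d) = algebraMap k F (mu d) * M d := by
    intro d
    simp only [M, mu, map_prod, map_pow, hlam, mul_pow, Finset.prod_mul_distrib]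
  let Q : MvPolynomial β k :=
    ∑ d ∈ P.support, MvPolynomial.monomial d ((mu d - mu d₀) * P.coeff d)
  have hQc : ∀ d, Q.coeff d = (mu d - mu d₀) * P.coeff d := by
    intro d
    simp only [Q, MvPolynomial.coeff_sum, MvPolynomial.coeff_monomial]
    rw [Finset.sum_ite_eq']
    split_ifs with h
    · rfl
    · rw [MvPolynomial.notMem_support_iff.1 h, mul_zero]
  have hQ : Q = 0 := by
    refine hmin Q ?_ ?_
    · simp only [Q, map_sum, hMa]
      have h1 := congrArg g hPsum
      rw [map_sum, map_zero] at h1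
      simp only [map_mul, AlgEquiv.commutes, hgM] at h1
      have h2 : ∑ d ∈ P.support, algebraMap k F (mu d₀) *
          (algebraMap k F (P.coeff d) * M d) = 0 := by
        rw [← Finset.mul_sum, hPsum, mul_zero]
      have h3 := sub_eq_zero.2 (h1.trans h2.symm)
      rw [← Finset.sum_sub_distrib] at h3
      rw [← h3]
      refine Finset.sum_congr rfl fun d _ ↦ ?_
      rw [map_mul, map_sub]
      ring
    · refine Finset.card_lt_card ((Finset.ssubset_iff_of_subset fun d hd ↦ ?_).2 ⟨d₀, hd₀, ?_⟩)
      · rw [MvPolynomial.mem_support_iff, hQc] at hd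
        exact MvPolynomial.mem_support_iff.2 (right_ne_zero_of_mul hd)
      · rw [MvPolynomial.notMem_support_iff, hQc, sub_self, zero_mul]
  have hmu : mu d₁ = mu d₀ := by
    have h1 := hQc d₁
    rw [hQ, MvPolynomial.coeff_zero] at h1
    exact sub_eq_zero.1 ((mul_eq_zero.1 h1.symm).resolve_right (MvPolynomial.mem_support_iff.1 hd₁))
  have hdiv : ∏ b, B b ^ ((d₁ b : ℤ) - d₀ b) = M d₁ / M d₀ := by
    simp only [M, ← Finset.prod_div_distrib]
    refine Finset.prod_congr rfl fun b _ ↦ ?_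
    rw [zpow_sub₀ (hB b), zpow_natCast, zpow_natCast]
  have hmu0 : algebraMap k F (mu d₀) ≠ 0 := by
    intro h0
    have h1 := hgM d₀
    rw [h0, zero_mul] at h1
    exact hM0 d₀ (by simpa using h1)
  rw [hdiv, map_div₀, hgM, hgM, hmu, mul_div_mul_left _ _ hmu0]

end Eigen

section Odd
variable {k F : Type*} [Field k] [Field F] [Algebra k F]
variable {ψ : (F ≃ₐ[k] F) ≃* (F ≃ₐ[k] F)}

/-- A constant monomial in twisted square roots forces a product of the original square roots to
be invariant. -/
theorem exists_prod_fixed_of_zpow_mem {κ : Type*} [Fintype κ] {α r : κ → F}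
    (hr0 : ∀ c, r c ≠ 0) (hα0 : ∀ c, α c ≠ 0) {W : Set (F ≃ₐ[k] F)}
    (hW : ∀ w ∈ W, ∀ c, w (r c) = r c ∨ w (r c) = -r c)
    (hα : ∀ w ∈ W, ∀ c, ψ w (α c) * r c = w (r c) * α c) [IsAlgClosed k]
    {R : κ → ℤ} (hR : R ≠ 0) (hA : ∏ c, α c ^ R c ∈ acl k (∅ : Set F)) :
    ∃ Δ : Finset κ, Δ.Nonempty ∧ ∀ w ∈ W, w (∏ c ∈ Δ, r c) = ∏ c ∈ Δ, r c := by
  classical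
  obtain ⟨c₀, hc₀⟩ := Function.ne_iff.1 hR
  obtain ⟨R', hRR', hgcd⟩ := Finset.extract_gcd (s := Finset.univ) R ⟨c₀, Finset.mem_univ _⟩
  set d := Finset.univ.gcd R
  have hd0 : d ≠ 0 := by
    intro h
    apply hc₀
    rw [hRR' c₀ (Finset.mem_univ _), h, zero_mul]; rfl
  let A := ∏ c, α c ^ R' c
  have hAd : A ^ d ∈ acl k (∅ : Set F) := by
    have : A ^ d = ∏ c, α c ^ R c := by
      rw [← Finset.prod_zpow]
      refine Finset.prod_congr rfl fun c hc ↦ ?_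
      rw [hRR' c hc, mul_comm, zpow_mul]
    rwa [this]
  have hAk : A ∈ acl k (∅ : Set F) := by
    have h1 : A ^ d.natAbs ∈ acl k (∅ : Set F) := by
      rcases Int.natAbs_eq d with h | h
      · rwa [h, zpow_natCast] at hAd
      · rw [h, zpow_neg, zpow_natCast] at hAd
        exact inv_mem_iff.1 hAd
    rw [← isAlgebraic_iff_mem_acl_empty] at h1 ⊢
    exact h1.of_pow (Int.natAbs_pos.2 hd0)
  refine ⟨Finset.univ.filter fun c ↦ Odd (R' c), ?_, fun w hw ↦ ?_⟩
  · by_contra hne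
    rw [Finset.not_nonempty_iff_eq_empty, Finset.filter_eq_empty_iff] at hne
    have h2 : (2 : ℤ) ∣ Finset.univ.gcd R' := Finset.dvd_gcd fun c hc ↦
      (Int.not_odd_iff_even.1 (hne hc)).two_dvd
    rw [hgcd] at h2
    norm_num at h2
  · have hfix : ψ w A = A := by
      obtain ⟨a, ha⟩ := mem_acl_empty.1 hAk
      rw [← ha]; exact (ψ w).commutes a
    let ε : κ → F := fun c ↦ w (r c) / r c
    have hε : ∀ c, ε c = 1 ∨ ε c = -1 := by
      intro c
      rcases hW w hw c with h | h
      · left; simp [ε, h, hr0 c]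
      · right; simp [ε, h, hr0 c]
    have h1 : ∏ c, ε c ^ R' c = 1 := by
      have h2 : ∀ c, ψ w (α c) = ε c * α c := by
        intro c
        have := hα w hw c
        simp only [ε]
        field_simp [hr0 c]
        linear_combination this
      have hA0 : A ≠ 0 := Finset.prod_ne_zero_iff.2 fun c _ ↦ zpow_ne_zero _ (hα0 c)
      refine mul_right_cancel₀ hA0 ?_
      rw [one_mul]
      conv_rhs => rw [← hfix]
      simp only [A, map_prod, map_zpow₀, h2, mul_zpow, Finset.prod_mul_distrib]
    have h3 : ∏ c ∈ Finset.univ.filter (fun c ↦ Odd (R' c)), ε c = 1 := by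
      rw [Finset.prod_filter]
      refine Eq.trans ?_ h1
      refine Finset.prod_congr rfl fun c _ ↦ ?_
      split_ifs with ho
      · rcases hε c with h | h
        · rw [h, one_zpow]
        · rw [h, ho.neg_one_zpow]
      · rcases hε c with h | h
        · rw [h, one_zpow]
        · rw [h, (Int.not_odd_iff_even.1 ho).neg_one_zpow]
    simp only [ε, Finset.prod_div_distrib] at h3
    rw [map_prod]
    exact eq_of_div_eq_one h3

end Odd

section Invariants
variable {k F : Type*} [Field k] [Field F] [Algebra k F] [IsAlgClosed k] [IsAlgClosed F]
  [CharZero k] [CharZero F]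

theorem hasInvariants_of_finite {n : ℕ} (hn : 1 ≤ n) {y : Fin n → F}
    (hy : IsTranscendenceBasis k y) {ψ : (F ≃ₐ[k] F) ≃* (F ≃ₐ[k] F)} (hψ : NbhdCont ψ)
    (hψ' : NbhdCont ψ.symm) : HasInvariants ψ := by
  classical
  have hbasis := isTranscendenceBasis_iff_acl.1 hy
  have hW : TB ((fixS k (Set.range y)).map ψ.symm.toMonoidHom) :=
    (TB_fixS hbasis.2).map hψ'
  have hy0 : y ⟨0, hn⟩ ∉ (⊥ : IntermediateField k F) := by
    rw [← acl_empty]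
    exact fun h ↦ hbasis.1 ⟨0, hn⟩ (acl_mono (Set.empty_subset _) h)
  obtain ⟨x, -, hx, hxfix⟩ := exists_fixed_of_orb_finite (hW (y ⟨0, hn⟩)) hy0
    (L := ⊤) fun _ _ ↦ mem_top
  have hWx : ∀ w, ψ w ∈ fixS k (Set.range y) → w ∈ fixS k {x} := by
    rintro w hw _ rfl
    exact mem_fixedField'.1 hxfix w ⟨ψ w, hw, ψ.symm_apply_apply w⟩
  obtain ⟨S, hS, hSW⟩ := hψ (Set.range y) (Set.finite_range y)
  have hxacl : x ∉ acl k (∅ : Set F) := by rwa [acl_empty]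
  choose r hr using fun c : k ↦ IsAlgClosed.exists_pow_nat_eq (x - algebraMap k F c) two_pos
  have hr0 : ∀ c, r c ≠ 0 := by
    intro c h0
    have h1 := hr c
    rw [h0, zero_pow two_ne_zero] at h1
    apply hx
    rw [sub_eq_zero.1 h1.symm]
    exact IntermediateField.algebraMap_mem _ c
  have hrx : ∀ c, ∀ w ∈ fixS k {x}, w (r c) = r c ∨ w (r c) = -r c := by
    intro c w hw
    rw [← sq_eq_sq_iff_eq_or_eq_neg, ← map_pow, hr, map_sub, AlgEquiv.commutes, hw x rfl]
  choose α hα0 hαp hα using fun c : k ↦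
    exists_twisted_sqrt hψ' hy (hr0 c) fun w hw ↦ hrx c w (hWx w hw)
  have hbad := finite_setOf_prod_sqrt_fixed hy hxacl hr hS
  let good : Set k := (⋃ Δ ∈ {Δ : Finset k | ∀ w ∈ fixS k S,
    w (∏ c ∈ Δ, r c) = ∏ c ∈ Δ, r c}, (Δ : Set k))ᶜ
  have hgood : good.Infinite := (hbad.biUnion fun Δ _ ↦ Δ.finite_toSet).infinite_compl
  have hgood' : ∀ Δ : Finset k, Δ.Nonempty → (Δ : Set k) ⊆ good →
      ∃ w ∈ fixS k S, w (∏ c ∈ Δ, r c) ≠ ∏ c ∈ Δ, r c := by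
    rintro Δ ⟨c, hc⟩ hΔ
    by_contra! h
    exact hΔ hc (Set.mem_biUnion (show Δ ∈ {Δ : Finset k | ∀ w ∈ fixS k S,
      w (∏ c ∈ Δ, r c) = ∏ c ∈ Δ, r c} from h) hc)
  choose V hVfin hV using fun g ↦ exists_finite_cocycle_valuations hy g
  refine ⟨x, hx, fun Φ hΦ hΦx ↦ ?_⟩
  let Ω : Set (k → ℤ) := ⋃ w ∈ Φ, (fun ν c ↦ ν (ψ w (α c) / α c)) '' V (ψ w)
  have hΩ : Ω.Finite := hΦ.biUnion fun w _ ↦ (hVfin (ψ w)).image _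
  have hΩ' : Finite Ω := hΩ
  let N := Nat.card Ω
  have hinfg : Infinite good := hgood.to_subtype
  let emb₀ : ℕ ↪ good := Infinite.natEmbedding good
  let emb : Fin (n + 1) × Fin (N + 1) → k := fun q ↦ emb₀ (finProdFinEquiv q)
  have hemb : Function.Injective emb := fun q q' h ↦
    finProdFinEquiv.injective (Fin.ext (emb₀.injective (Subtype.ext h)))
  choose ρ hρ0 hρ using fun b : Fin (n + 1) ↦ exists_int_relation (κ := Fin (N + 1)) (J := Ω)
    (by rw [Fintype.card_fin]; exact Nat.lt_succ_self _) fun ω j ↦ ω.1 (emb (b, j))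
  let B : Fin (n + 1) → F := fun b ↦ ∏ j, α (emb (b, j)) ^ ρ b j
  have hB0 : ∀ b, B b ≠ 0 := fun b ↦
    Finset.prod_ne_zero_iff.2 fun j _ ↦ zpow_ne_zero _ (hα0 _)
  have hBdep : ¬ AlgebraicIndependent k B := by
    intro h
    have h1 := h.lift_cardinalMk_le_trdeg
    rw [← hy.lift_cardinalMk_eq_trdeg] at h1
    simp only [Cardinal.mk_fin, Cardinal.lift_natCast] at h1
    have h2 : n + 1 ≤ n := by exact_mod_cast h1
    omega
  obtain ⟨e, he0, he⟩ := exists_invariant_monomial hB0 hBdep (Ψ := ψ '' Φ) (by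
    rintro _ ⟨w, hw, rfl⟩ b
    have h1 := hV (ψ w) (Fin (N + 1)) (fun j ↦ α (emb (b, j))) (ρ b) (fun j ↦ hα0 _)
      (fun j ↦ hαp _)
      (fun j ↦ map_div_mem_adjoin (hr0 _) (hα0 _) (hrx _) hWx (hα _) (hΦx hw))
      fun ν hν ↦ hρ b ⟨_, Set.mem_biUnion hw ⟨ν, hν, rfl⟩⟩
    obtain ⟨c, hc⟩ := mem_acl_empty.1 h1
    refine ⟨c, ?_⟩
    rw [hc]
    simp only [B, map_prod, map_zpow₀, ← Finset.prod_mul_distrib]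
    refine Finset.prod_congr rfl fun j _ ↦ ?_
    rw [← mul_zpow, div_mul_cancel₀ _ (hα0 _)])
  refine ⟨∏ b, B b ^ e b, ?_, fun w hw ↦ he _ ⟨w, hw, rfl⟩⟩
  rw [← acl_empty]
  intro hA
  have hR : (fun q : Fin (n + 1) × Fin (N + 1) ↦ ρ q.1 q.2 * e q.1) ≠ 0 := by
    obtain ⟨b, hb⟩ := Function.ne_iff.1 he0
    obtain ⟨j, hj⟩ := Function.ne_iff.1 (hρ0 b)
    exact Function.ne_iff.2 ⟨(b, j), mul_ne_zero hj hb⟩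
  have hA' : ∏ q, α (emb q) ^ (ρ q.1 q.2 * e q.1) ∈ acl k (∅ : Set F) := by
    convert hA using 1
    rw [Fintype.prod_prod_type]
    refine Finset.prod_congr rfl fun b _ ↦ ?_
    rw [← Finset.prod_zpow]
    exact Finset.prod_congr rfl fun j _ ↦ zpow_mul _ _ _
  obtain ⟨Δ, hΔ, hfix⟩ := exists_prod_fixed_of_zpow_mem (ψ := ψ) (r := fun q ↦ r (emb q))
    (α := fun q ↦ α (emb q)) (W := fixS k S) (fun _ ↦ hr0 _) (fun _ ↦ hα0 _)
    (fun w hw q ↦ hrx _ w (hWx w (hSW w hw))) (fun w hw q ↦ hα _ w (hSW w hw)) hR hA'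
  obtain ⟨w, hw, hne⟩ := hgood' (Δ.map ⟨emb, hemb⟩) (hΔ.map) (by
    intro c hc
    obtain ⟨q, -, rfl⟩ := Finset.mem_map.1 hc
    exact (emb₀ _).2)
  rw [Finset.prod_map] at hne
  exact hne (hfix w hw)

end Invariants

section Assembly
variable {k F : Type*} [Field k] [Field F] [Algebra k F]

theorem card_le_of_acl_eq_top {ι : Type*} {y : ι → F} (hy : IsTranscendenceBasis k y)
    {S : Set F} (hfin : S.Finite) (hS : acl k S = ⊤) : Finite ι ∧ Nat.card ι ≤ S.ncard := by
  have halg : Algebra.IsAlgebraic (Algebra.adjoin k S) F :=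
    ⟨fun a ↦ mem_acl'.1 (by rw [hS]; exact mem_top)⟩
  obtain ⟨t, hts, ht⟩ := exists_isTranscendenceBasis_subset (R := k) S
  obtain ⟨e⟩ := Cardinal.lift_mk_eq'.1 (hy.lift_cardinalMk_eq ht)
  have hft : Finite t := hfin.subset hts
  refine ⟨Finite.of_equiv _ e.symm, ?_⟩
  rw [Nat.card_congr e]
  exact Set.ncard_le_ncard hts hfin

theorem mem_fixS_top {g : F ≃ₐ[k] F} :
    g ∈ fixS k ((⊤ : IntermediateField k F) : Set F) ↔ g = 1 :=
  ⟨fun h ↦ AlgEquiv.ext fun a ↦ h a mem_top, by rintro rfl; exact one_mem _⟩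

variable [IsAlgClosed k] [IsAlgClosed F] [CharZero k] [CharZero F]

theorem exists_acl_correspondence
    (hn : (∃ x : ℕ → F, IsTranscendenceBasis k x) ∨
      ∃ n : ℕ, 1 ≤ n ∧ ∃ x : Fin n → F, IsTranscendenceBasis k x)
    {ψ : (F ≃ₐ[k] F) ≃* (F ≃ₐ[k] F)} (hψ : NbhdCont ψ) (hψ' : NbhdCont ψ.symm) :
    ∃ x f : F, x ∉ (⊥ : IntermediateField k F) ∧ f ∉ (⊥ : IntermediateField k F) ∧
      ∀ g, g ∈ fixS k (acl k {x} : Set F) ↔ ψ g ∈ fixS k (acl k {f} : Set F) := by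
  obtain ⟨y, hy⟩ | ⟨n, hn, y, hy⟩ := hn
  · refine exists_acl_correspondence_of_infinite (fun S hS ↦ ?_) hψ hψ'
    by_contra! h
    exact not_finite_iff_infinite.2 inferInstance
      (card_le_of_acl_eq_top hy hS (eq_top_iff.2 fun a _ ↦ h a)).1
  · have hbasis := isTranscendenceBasis_iff_acl.1 hy
    rcases hn.eq_or_lt with rfl | hn2
    · have hy0 : y 0 ∉ (⊥ : IntermediateField k F) := by
        rw [← acl_empty]
        exact fun h ↦ hbasis.1 0 (acl_mono (Set.empty_subset _) h)
      have htop : acl k {y 0} = ⊤ := by rw [← hbasis.2, Set.range_unique]; rfl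
      refine ⟨y 0, y 0, hy0, hy0, fun g ↦ ?_⟩
      rw [htop, mem_fixS_top, mem_fixS_top, MulEquiv.map_eq_one_iff]
    · refine exists_acl_correspondence_of_invariants hψ hψ' (hasInvariants_of_finite hn hy hψ hψ')
        (hasInvariants_of_finite hn hy hψ' hψ) (Set.finite_range y) hbasis.2 fun x ↦ ?_
      by_contra! h
      have := (card_le_of_acl_eq_top hy (Set.finite_singleton x) (eq_top_iff.2 fun a _ ↦ h a)).2
      rw [Nat.card_fin, Set.ncard_singleton] at this
      omega

theorem exists_notMem_bot
    (hn : (∃ x : ℕ → F, IsTranscendenceBasis k x) ∨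
      ∃ n : ℕ, 1 ≤ n ∧ ∃ x : Fin n → F, IsTranscendenceBasis k x) :
    ∃ x : F, x ∉ (⊥ : IntermediateField k F) := by
  obtain ⟨x, _, hx, _⟩ := exists_acl_correspondence hn (ψ := MulEquiv.refl _)
    (fun S hS ↦ ⟨S, hS, fun _ h ↦ h⟩) (fun S hS ↦ ⟨S, hS, fun _ h ↦ h⟩)
  exact ⟨x, hx⟩

end Assembly

end FinitelyGenerated

/-- Conjugation by a field automorphism preserving `k`. -/
def conjAlg {k F : Type*} [Field k] [Field F] [Algebra k F] (φ : presField k F)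
    (g : F ≃ₐ[k] F) : F ≃ₐ[k] F :=
  AlgEquiv.ofRingEquiv (f := (φ : F ≃+* F).symm.trans (g.toRingEquiv.trans (φ : F ≃+* F)))
    (fun c => by
      obtain ⟨d, hd⟩ := ((φ⁻¹).2 (algebraMap k F c)).1 ⟨c, rfl⟩
      have hd' : (φ : F ≃+* F).symm (algebraMap k F c) = algebraMap k F d := hd.symm
      simp [hd']
      rw [← hd']
      exact (φ : F ≃+* F).apply_symm_apply _)

theorem conjAlg_apply {k F : Type*} [Field k] [Field F] [Algebra k F] (φ : presField k F)
    (g : F ≃ₐ[k] F) (x : F) :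
    conjAlg φ g x = (φ : F ≃+* F) (g ((φ : F ≃+* F).symm x)) := rfl

theorem continuous_conjAlg {k F : Type*} [Field k] [Field F] [Algebra k F] (φ : presField k F) :
    @Continuous _ _ (autTop k F) (autTop k F) (conjAlg φ) := by
  let : TopologicalSpace F := ⊥
  have : DiscreteTopology F := ⟨rfl⟩
  let := autTop k F
  refine continuous_induced_rng.2 (continuous_pi fun x => ?_)
  have h1 : Continuous fun g : F ≃ₐ[k] F => g ((φ : F ≃+* F).symm x) :=
    (continuous_apply ((φ : F ≃+* F).symm x)).comp continuous_induced_dom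
  exact (continuous_of_discreteTopology (f := fun y : F => (φ : F ≃+* F) y)).comp h1

/-- Conjugation as a homomorphism to the abstract automorphism group of `Aut(F/k)`. -/
def conjHom (k F : Type*) [Field k] [Field F] [Algebra k F] :
    presField k F →* MulAut (F ≃ₐ[k] F) where
  toFun φ :=
    { toFun := conjAlg φ
      invFun := conjAlg φ⁻¹
      left_inv := fun g => by
        ext x
        exact ((φ : F ≃+* F).symm_apply_apply _).trans
          (congrArg g ((φ : F ≃+* F).symm_apply_apply x))
      right_inv := fun g => by
        ext x
        exact ((φ : F ≃+* F).apply_symm_apply _).trans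
          (congrArg g ((φ : F ≃+* F).apply_symm_apply x))
      map_mul' := fun g h => by
        ext x
        simp [conjAlg_apply] }
  map_one' := by ext g x; rfl
  map_mul' := fun φ χ => by ext g x; rfl

/-- Conjugation as a homomorphism to the group of continuous automorphisms. -/
def conjContHom (k F : Type*) [Field k] [Field F] [Algebra k F] :
    presField k F →* contAut k F :=
  (conjHom k F).codRestrict (contAut k F)
    fun φ => ⟨continuous_conjAlg φ, continuous_conjAlg φ⁻¹⟩

/-- The map `φ ↦ (g ↦ φ ∘ g ∘ φ⁻¹)` is a group isomorphism from the group of field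
automorphisms of `F` preserving `k` onto the group of continuous automorphisms of
`G = Aut(F/k)`. -/
theorem statement5 (k F : Type*) [Field k] [Field F] [Algebra k F]
    [IsAlgClosed k] [IsAlgClosed F] [CharZero k] [CharZero F]
    (hn : (∃ x : ℕ → F, IsTranscendenceBasis k x) ∨
      ∃ n : ℕ, 1 ≤ n ∧ ∃ x : Fin n → F, IsTranscendenceBasis k x) :
    ∃ e : presField k F ≃* contAut k F,
      ∀ (φ : presField k F) (g : F ≃ₐ[k] F) (x : F),
        ((e φ : MulAut (F ≃ₐ[k] F)) g) ((φ : F ≃+* F) x) = (φ : F ≃+* F) (g x) := by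
  have hbij : Function.Bijective (conjContHom k F) := by
    constructor
    · intro φ χ h
      obtain ⟨x, hx⟩ := exists_notMem_bot hn
      have h1 : conjContHom k F (χ⁻¹ * φ) = 1 := by
        rw [map_mul, map_inv, h, inv_mul_cancel]
      have h2 : ∀ a, ((χ⁻¹ * φ : presField k F) : F ≃+* F) a = a := by
        refine eq_self_of_commute hx _ fun g a ↦ ?_
        have h3 : conjAlg (χ⁻¹ * φ) g = g :=
          congrArg (fun ψ : contAut k F ↦ (ψ : MulAut (F ≃ₐ[k] F)) g) h1
        have h4 := AlgEquiv.congr_fun h3 (((χ⁻¹ * φ : presField k F) : F ≃+* F) a)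
        rwa [conjAlg_apply, RingEquiv.symm_apply_apply] at h4
      have h5 : χ⁻¹ * φ = 1 := Subtype.ext (RingEquiv.ext h2)
      exact (inv_mul_eq_one.1 h5).symm
    · intro ψ
      have hψ := nbhdCont_of_continuous ψ.2.1
      have hψ' := nbhdCont_of_continuous ψ.2.2
      obtain ⟨x, f, hx, hf, h⟩ := exists_acl_correspondence hn hψ hψ'
      obtain ⟨x₁, f₁, hx₁, hf₁, h₁⟩ := exists_stabilizer_of_acl hψ hψ' hx hf h
      obtain ⟨e, hebot, he⟩ := exists_ringEquiv_of_stabilizer hx₁ hf₁ h₁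
      have hmem : e ∈ presField k F := fun a ↦ by
        have := hebot a
        rwa [IntermediateField.mem_bot, IntermediateField.mem_bot] at this
      refine ⟨⟨e, hmem⟩, Subtype.ext (MulEquiv.ext fun g ↦ AlgEquiv.ext fun a ↦ ?_)⟩
      exact (he g (e.symm a)).trans (congrArg _ (e.apply_symm_apply a))
  refine ⟨MulEquiv.ofBijective (conjContHom k F) hbij, fun φ g x => ?_⟩
  exact congrArg (fun y => (φ : F ≃+* F) (g y)) ((φ : F ≃+* F).symm_apply_apply x)
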